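/- arXiv:2011.11427 — 2 statements merged into one kernel-verified Lean document; each statement's English description precedes it below -/
import Mathlib

section
/- For all integers k ≥ 2 and n ≥ (2k)^{8k²}, every C_{2k}-free graph on n vertices has at most 80·√k·(log k)·n^{1+1/k} + 10k²·n edges (log denoting the natural logarithm); that is, ex(n, C_{2k}) ≤ 80√k log k · n^{1+1/k} + 10k²n. -/
open SimpleGraph

/-- `G` contains a copy of `H` as a (not necessarily induced) subgraph. -/
def HasSubCopy {α β : Type*} (H : SimpleGraph α) (G : SimpleGraph β) : Prop :=
  ∃ f : H →g G, Function.Injective f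

/-- `G` is `C_m`-free: it contains no copy of the cycle on `m` vertices. -/
def CycleFree (m : ℕ) {β : Type*} (G : SimpleGraph β) : Prop :=
  ¬ HasSubCopy (cycleGraph m) G

/-! ### Cycles with a chord -/

/-- The first `m + 1` values of `p` form a path of length `m` in `G`. -/
structure IsPathFn {V : Type*} (G : SimpleGraph V) (p : ℕ → V) (m : ℕ) : Prop where
  adj : ∀ t < m, G.Adj (p t) (p (t + 1))
  inj : ∀ s t, s ≤ m → t ≤ m → p s = p t → s = t

lemma hasSubCopy_cycleGraph {V : Type*} {G : SimpleGraph V} {m : ℕ} (hm : 3 ≤ m) (c : ℕ → V)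
    (inj : ∀ s t, s < m → t < m → c s = c t → s = t)
    (adj : ∀ t, t + 1 < m → G.Adj (c t) (c (t + 1))) (close : G.Adj (c (m - 1)) (c 0)) :
    HasSubCopy (cycleGraph m) G := by
  obtain ⟨n, rfl⟩ : ∃ n, m = n + 2 := ⟨m - 2, by omega⟩
  have step : ∀ u v : Fin (n + 2), u - v = 1 → G.Adj (c v) (c u) := by
    intro u v h
    have hu : u = v + 1 := by rw [← h]; abel
    subst hu
    by_cases hv : v = Fin.last _
    · subst hv
      simpa using close
    · have : ((v + 1 : Fin (n + 2)) : ℕ) = v + 1 := Fin.val_add_one_of_lt (Fin.lt_last_iff_ne_last.2 hv)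
      rw [this]
      exact adj _ (by rw [← this]; exact (v + 1).2)
  refine ⟨⟨fun i => c i, ?_⟩, fun a b h => Fin.ext (inj _ _ a.2 b.2 h)⟩
  intro a b h
  rcases cycleGraph_adj.1 h with h | h
  · exact (step _ _ h).symm
  · exact step _ _ h

lemma iff_add_mul_of_iff_add {ψ : ℤ → Prop} {q : ℤ} (h : ∀ x, ψ x ↔ ψ (x + q)) (n x : ℤ) :
    ψ x ↔ ψ (x + n * q) := by
  induction n with
  | zero => simp
  | succ i ih => rw [ih, h]; ring_nf
  | pred i ih => rw [ih, h (x + (-i - 1) * q)]; ring_nf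

lemma forall_of_forall_window {ψ : ℤ → Prop} {q : ℤ} (hq : 0 < q) (h : ∀ x, ψ x ↔ ψ (x + q))
    (c : ℤ) (hc : ∀ x, c ≤ x → x < c + q → ψ x) (x : ℤ) : ψ x := by
  have h1 := hc (c + (x - c) % q) (by have := Int.emod_nonneg (x - c) hq.ne'; omega)
    (by have := Int.emod_lt_of_pos (x - c) hq; omega)
  rw [iff_add_mul_of_iff_add h ((x - c) / q)] at h1
  convert h1 using 1
  have := Int.emod_add_mul_ediv (x - c) q
  linarith

lemma iff_succ_of_theta {ψ : ℤ → Prop} {l N ρ : ℤ} (hl : 0 < l) (hlN : l < N) (hρ : 1 ≤ ρ)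
    (hρN : 2 * ρ + 1 ≤ N) (H0 : ∀ x, ψ x ↔ ψ (x + l)) (HN : ∀ x, ψ x ↔ ψ (x + N))
    (H1 : l + ρ < N → ∀ a, 0 ≤ a → a < l → (ψ (-a) ↔ ψ (ρ + l - a)))
    (H2 : l ≤ ρ → ∀ a, 0 ≤ a → a < l → (ψ a ↔ ψ (ρ + 1 - l + a)))
    (H3 : ∀ a, 0 ≤ a → a < l → l - ρ ≤ a → a ≤ N - ρ - 1 → (ψ (-a) ↔ ψ (ρ + 1 - l + a)))
    (H4 : ∀ a, 0 ≤ a → a < l → l - N + ρ + 1 ≤ a → a ≤ ρ → (ψ a ↔ ψ (ρ + l - a))) (x : ℤ) :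
    ψ x ↔ ψ (x + 1) := by
  have shift1 : l + ρ < N → ∀ x, ψ x ↔ ψ (x + ρ) := by
    intro h
    apply forall_of_forall_window hl (ψ := fun x => ψ x ↔ ψ (x + ρ))
      (fun x => by rw [H0 x, H0 (x + ρ), add_right_comm]) (-l + 1)
    intro x h1 h2
    have := H1 h (-x) (by omega) (by omega)
    rw [neg_neg] at this
    rw [this, H0 (x + ρ)]
    ring_nf
  by_cases c1 : l ≤ ρ
  · have s1 := shift1 (by omega)
    have s2 : ∀ x, ψ x ↔ ψ (x + (ρ + 1)) := by
      apply forall_of_forall_window hl (ψ := fun x => ψ x ↔ ψ (x + (ρ + 1)))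
        (fun x => by rw [H0 x, H0 (x + (ρ + 1)), add_right_comm]) 0
      intro x h1 h2
      rw [H2 c1 x h1 (by omega), H0]
      ring_nf
    rw [s2 x, s1 (x + 1)]
    ring_nf
  push Not at c1
  by_cases c2 : l + ρ < N
  · have s1 := shift1 c2
    apply forall_of_forall_window (q := ρ) (by omega) (ψ := fun x => ψ x ↔ ψ (x + 1))
        (fun x => by rw [s1 x, s1 (x + 1), add_right_comm]) 0
    intro x h1 h2
    have e3 := H3 (l - (x + 1)) (by omega) (by omega) (by omega) (by omega)
    have e4 := H4 x h1 (by omega) (by omega) (by omega)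
    rw [H0] at e3
    rw [e4, ← show -(l - (x + 1)) + l = x + 1 by ring, e3, H0 (ρ + 1 - l + (l - (x + 1)))]
    ring_nf
  push Not at c2
  have P : ∀ x, ψ x ↔ ψ (x + (N - l)) := fun x => by
    rw [HN x, H0 (x + (N - l))]; ring_nf
  have e3 : ∀ a, (ψ (-a) ↔ ψ (ρ + 1 - l + a)) := by
    apply forall_of_forall_window (q := N - l) (by omega) (ψ := fun a => ψ (-a) ↔ ψ (ρ + 1 - l + a))
        _ (l - ρ)
    · intro x h1 h2
      exact H3 x (by omega) (by omega) (by omega) (by omega)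
    · intro x
      rw [P (-(x + (N - l))), P (ρ + 1 - l + x)]
      ring_nf
  have e4 : ∀ a, (ψ a ↔ ψ (ρ + l - a)) := by
    apply forall_of_forall_window (q := N - l) (by omega) (ψ := fun a => ψ a ↔ ψ (ρ + l - a))
        _ (l - N + ρ + 1)
    · intro x h1 h2
      exact H4 x (by omega) (by omega) (by omega) (by omega)
    · intro x
      rw [P x, P (ρ + l - (x + (N - l)))]
      ring_nf
  have := e3 (-(x + 1))
  rw [neg_neg] at this
  rw [this, e4 x, H0 (ρ + 1 - l + _)]
  have h2 := iff_add_mul_of_iff_add H0 (-1) (ρ + l - x)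
  rw [h2]
  ring_nf

/-- A non-constant colouring of one part of an even cycle with a chord between the two parts admits
bichromatic paths of every even length smaller than the length of the cycle. -/
lemma exists_path_of_theta_aux {V : Type*} {G : SimpleGraph V} {c : ℤ → V} {l N ρ : ℕ}
    (hl : 0 < l) (hlN : l < N) (hρ : 1 ≤ ρ) (hρN : 2 * ρ + 1 ≤ N)
    (hc : ∀ x y, c x = c y ↔ (2 * N : ℤ) ∣ x - y) (adj : ∀ x, G.Adj (c x) (c (x + 1)))
    (chord : G.Adj (c 0) (c (2 * ρ + 1))) (Q : V → Prop) (h1 : ∃ x, Q (c (2 * x)))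
    (h2 : ∃ x, ¬ Q (c (2 * x))) :
    ∃ p : ℕ → V, IsPathFn G p (2 * l) ∧ (∀ t, ∃ x, p t = c x) ∧
      (∃ x, p 0 = c (2 * x) ∧ Q (p 0)) ∧ (∃ x, p (2 * l) = c (2 * x) ∧ ¬ Q (p (2 * l))) := by
  by_contra hno
  push Not at hno
  have inj0 : ∀ x y, c x = c y → |x - y| < 2 * N → x = y := by
    intro x y h hlt
    have := Int.eq_zero_of_abs_lt_dvd ((hc x y).1 h) hlt
    omega
  have key1 : ∀ (g : ℕ → ℤ) (x y : ℤ), (∀ t < 2 * l, G.Adj (c (g t)) (c (g (t + 1)))) →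
      (∀ s t, s ≤ 2 * l → t ≤ 2 * l → c (g s) = c (g t) → s = t) → g 0 = 2 * x → g (2 * l) = 2 * y →
      Q (c (2 * x)) → Q (c (2 * y)) := by
    intro g x y ha hi h0 h2l hQ
    have := hno (fun t => c (g t)) ⟨ha, hi⟩ (fun t => ⟨_, rfl⟩) ⟨x, by simp only [h0], by simp only [h0]; exact hQ⟩
      y (by simp only [h2l])
    simpa only [h2l] using this
  have key : ∀ (g : ℕ → ℤ) (x y : ℤ), (∀ t < 2 * l, G.Adj (c (g t)) (c (g (t + 1)))) →
      (∀ s t, s ≤ 2 * l → t ≤ 2 * l → c (g s) = c (g t) → s = t) → g 0 = 2 * x → g (2 * l) = 2 * y →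
      (Q (c (2 * x)) ↔ Q (c (2 * y))) := by
    intro g x y ha hi h0 h2l
    refine ⟨key1 g x y ha hi h0 h2l, key1 (fun t => g (2 * l - t)) y x ?_ ?_ (by simpa) (by simpa)⟩
    · intro t ht
      have := (ha (2 * l - (t + 1)) (by omega)).symm
      rwa [show 2 * l - (t + 1) + 1 = 2 * l - t by omega] at this
    · intro s t hs ht h
      have := hi _ _ (by omega) (by omega) h
      omega
  have adj' : ∀ x y : ℤ, y = x + 1 ∨ x = y + 1 ∨ (x = 0 ∧ y = 2 * ρ + 1) → G.Adj (c x) (c y) := by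
    rintro x y (rfl | rfl | ⟨rfl, rfl⟩)
    · exact adj _
    · exact (adj _).symm
    · exact chord
  have step := iff_succ_of_theta (ψ := fun x => Q (c (2 * x))) (l := l) (N := N) (ρ := ρ)
    (by omega) (by omega) (by omega) (by omega) ?_ ?_ ?_ ?_ ?_ ?_
  · obtain ⟨x, hx⟩ := h1
    obtain ⟨y, hy⟩ := h2
    have := iff_add_mul_of_iff_add step (y - x) x
    rw [mul_one, add_sub_cancel] at this
    exact hy (this.1 hx)
  · intro x
    refine key (fun t => 2 * x + t) _ _ ?_ ?_ (by simp) (by push_cast; ring)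
    · intro t ht
      exact adj' _ _ (by left; push_cast; ring)
    · intro s t hs ht h
      have := inj0 _ _ h (by rw [abs_lt]; omega)
      omega
  · intro x
    rw [show c (2 * x) = c (2 * (x + N)) from (hc _ _).2 ⟨-1, by ring⟩]
  · intro hN a h0 hal
    lift a to ℕ using h0
    refine key (fun t => if t ≤ 2 * a then (t : ℤ) - 2 * a else 2 * ρ + 1 + (t - 2 * a - 1))
      _ _ ?_ ?_ (by simp) ?_
    · intro t ht
      apply adj'
      split_ifs <;> push_cast <;> omega
    · intro s t hs ht h
      have := inj0 _ _ h (by rw [abs_lt]; split_ifs <;> omega)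
      split_ifs at this <;> omega
    · split_ifs <;> push_cast <;> omega
  · intro hN a h0 hal
    lift a to ℕ using h0
    refine key (fun t => if t ≤ 2 * a then 2 * a - (t : ℤ) else 2 * ρ + 1 - (t - 2 * a - 1))
      _ _ ?_ ?_ (by simp) ?_
    · intro t ht
      apply adj'
      split_ifs <;> push_cast <;> omega
    · intro s t hs ht h
      have := inj0 _ _ h (by rw [abs_lt]; split_ifs <;> omega)
      split_ifs at this <;> omega
    · split_ifs <;> push_cast <;> omega
  · intro a h0 hal h3 h4
    lift a to ℕ using h0
    refine key (fun t => if t ≤ 2 * a then (t : ℤ) - 2 * a else 2 * ρ + 1 - (t - 2 * a - 1))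
      _ _ ?_ ?_ (by simp) ?_
    · intro t ht
      apply adj'
      split_ifs <;> push_cast <;> omega
    · intro s t hs ht h
      have := inj0 _ _ h (by rw [abs_lt]; split_ifs <;> omega)
      split_ifs at this <;> omega
    · split_ifs <;> push_cast <;> omega
  · intro a h0 hal h3 h4
    lift a to ℕ using h0
    refine key (fun t => if t ≤ 2 * a then 2 * a - (t : ℤ) else 2 * ρ + 1 + (t - 2 * a - 1))
      _ _ ?_ ?_ (by simp) ?_
    · intro t ht
      apply adj'
      split_ifs <;> push_cast <;> omega
    · intro s t hs ht h
      have := inj0 _ _ h (by rw [abs_lt]; split_ifs <;> omega)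
      split_ifs at this <;> omega
    · split_ifs <;> push_cast <;> omega

lemma exists_path_of_theta_int {V : Type*} {G : SimpleGraph V} {c : ℤ → V} {l N : ℕ} {r : ℤ}
    (hl : 0 < l) (hlN : l < N) (hr : 3 ≤ r) (hrN : r + 3 ≤ 2 * N) (hodd : r % 2 = 1)
    (hc : ∀ x y, c x = c y ↔ (2 * N : ℤ) ∣ x - y) (adj : ∀ x, G.Adj (c x) (c (x + 1)))
    (chord : G.Adj (c 0) (c r)) (Q : V → Prop) (h1 : ∃ x, Q (c (2 * x)))
    (h2 : ∃ x, ¬ Q (c (2 * x))) :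
    ∃ p : ℕ → V, IsPathFn G p (2 * l) ∧ (∀ t, ∃ x, p t = c x) ∧
      (∃ x, p 0 = c (2 * x) ∧ Q (p 0)) ∧ (∃ x, p (2 * l) = c (2 * x) ∧ ¬ Q (p (2 * l))) := by
  by_cases hrN' : r ≤ N
  · refine exists_path_of_theta_aux (ρ := ((r - 1) / 2).toNat) hl hlN (by omega) (by omega) hc adj ?_ Q h1 h2
    convert chord using 2
    omega
  · have hc1 : ∀ x y, c (-x) = c (-y) ↔ (2 * N : ℤ) ∣ x - y := fun x y => by
      rw [hc, ← dvd_neg, neg_sub_neg, neg_sub]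
    have adj1 : ∀ x, G.Adj (c (-x)) (c (-(x + 1))) := fun x => by
      have := adj (-(x + 1))
      rw [show -(x + 1) + 1 = -x by ring] at this
      exact this.symm
    have chord1 : G.Adj (c (-0)) (c (-(2 * (((2 * N - r - 1) / 2).toNat : ℤ) + 1))) := by
      have : c r = c (-(2 * (((2 * N - r - 1) / 2).toNat : ℤ) + 1)) := (hc _ _).2 ⟨1, by omega⟩
      rw [← this]
      simpa using chord
    obtain ⟨p, hp, hc', ⟨x, hx⟩, ⟨y, hy⟩⟩ := exists_path_of_theta_aux (c := fun x => c (-x)) hl hlN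
      (by omega) (by omega) hc1 adj1 chord1 Q (h1.imp' (fun x => -x) (fun x hx => by simpa using hx))
      (h2.imp' (fun x => -x) (fun x hx => by simpa using hx))
    refine ⟨p, hp, fun t => ?_, ⟨-x, ?_⟩, ⟨-y, ?_⟩⟩
    · obtain ⟨x, hx⟩ := hc' t
      exact ⟨-x, hx⟩
    · simpa using hx
    · simpa using hy

/-- Let `p 0, …, p M` be a cycle with a chord `p 0 p j`, all whose edges join a vertex satisfying
`E` to a vertex violating it. Any non-constant colouring of the vertices satisfying `E` admits
bichromatic paths of all short even lengths. -/
lemma exists_path_of_theta {V : Type*} {G : SimpleGraph V} {p : ℕ → V} {M j l : ℕ}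
    (hp : IsPathFn G p M) (hj : 2 ≤ j) (hjM : j < M) (hclose : G.Adj (p 0) (p M))
    (hchord : G.Adj (p 0) (p j)) (E : V → Prop) (hE : ∀ t < M, E (p t) ↔ ¬ E (p (t + 1)))
    (hEM : E (p 0) ↔ ¬ E (p M)) (hEj : E (p 0) ↔ ¬ E (p j)) (hl : 0 < l) (hlM : 2 * l < M)
    (Q : V → Prop) (h1 : ∃ t ≤ M, E (p t) ∧ Q (p t)) (h2 : ∃ t ≤ M, E (p t) ∧ ¬ Q (p t)) :
    ∃ q : ℕ → V, IsPathFn G q (2 * l) ∧ (∀ t, ∃ s ≤ M, q t = p s) ∧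
      (E (q 0) ∧ Q (q 0)) ∧ (E (q (2 * l)) ∧ ¬ Q (q (2 * l))) := by
  have par : ∀ t ≤ M, (E (p t) ↔ (E (p 0) ↔ t % 2 = 0)) := by
    intro t
    induction t with
    | zero => simp
    | succ t ih =>
      intro ht
      have a := ih (by omega)
      have b := hE t (by omega)
      have c : (t + 1) % 2 = 0 ↔ ¬ (t % 2 = 0) := by omega
      rw [c]
      tauto
  have hModd : M % 2 = 1 := by
    have := par M le_rfl
    by_contra h
    have h : M % 2 = 0 := by omega
    tauto
  have hjodd : j % 2 = 1 := by
    have := par j hjM.le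
    by_contra h
    have h : j % 2 = 0 := by omega
    tauto
  obtain ⟨N, hN⟩ : ∃ N, M + 1 = 2 * N := ⟨(M + 1) / 2, by omega⟩
  have hMz : (0 : ℤ) < (M : ℤ) + 1 := by omega
  have hMN : (M : ℤ) + 1 = 2 * N := by omega
  let i : ℤ → ℕ := fun x => (x % ((M : ℤ) + 1)).toNat
  have hi : ∀ x, (i x : ℤ) = x % ((M : ℤ) + 1) := fun x =>
    Int.toNat_of_nonneg (Int.emod_nonneg _ hMz.ne')
  have hiM : ∀ x, i x ≤ M := fun x => by
    have := Int.emod_lt_of_pos x hMz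
    have := hi x
    omega
  have hit : ∀ t : ℕ, t ≤ M → i t = t := fun t ht => by
    have := hi t
    rw [Int.emod_eq_of_lt (by omega) (by omega)] at this
    omega
  have hi2 : ∀ x, (i x : ℤ) % 2 = x % 2 := fun x => by
    rw [hi, hMN, Int.emod_emod_of_dvd _ (Dvd.intro _ rfl)]
  let c : ℤ → V := fun x => p (i x)
  have hc : ∀ x y, c x = c y ↔ (2 * N : ℤ) ∣ x - y := by
    intro x y
    rw [← hMN, ← Int.emod_eq_emod_iff_emod_sub_eq_zero.trans Int.dvd_iff_emod_eq_zero.symm, ← hi, ← hi]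
    refine ⟨fun h => ?_, fun h => ?_⟩
    · rw [hp.inj _ _ (hiM x) (hiM y) h]
    · exact congrArg p (by exact_mod_cast h)
  have hct : ∀ t : ℕ, t ≤ M → c t = p t := fun t ht => by simp only [c, hit t ht]
  have hcy : ∀ x, c x = c (i x) := fun x => by rw [hct _ (hiM x)]
  have adj : ∀ x, G.Adj (c x) (c (x + 1)) := by
    intro x
    by_cases h : i x = M
    · have e : c (x + 1) = c 0 := (hc _ _).2 (by
        rw [← hMN]
        have := Int.emod_add_mul_ediv x ((M : ℤ) + 1)
        refine ⟨x / (M + 1) + 1, ?_⟩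
        have h' := hi x
        rw [h] at h'
        rw [← h'] at this
        linarith)
      rw [e, hcy, h, hct _ le_rfl, show (0 : ℤ) = (0 : ℕ) by simp, hct _ (by omega)]
      exact hclose.symm
    · have e : c (x + 1) = c ((i x + 1 : ℕ) : ℤ) := (hc _ _).2 (by
        rw [← hMN]
        have := Int.emod_add_mul_ediv x ((M : ℤ) + 1)
        refine ⟨x / (M + 1), ?_⟩
        have h' := hi x
        push_cast
        linarith)
      have := hiM x
      rw [e, hcy, hct _ (by omega), hct _ (by omega)]
      exact hp.adj _ (by omega)
  have hcE : ∀ x, E (c x) ↔ (E (p 0) ↔ x % 2 = 0) := fun x => by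
    rw [show c x = p (i x) from rfl, par _ (hiM x)]
    have := hi2 x
    have : i x % 2 = 0 ↔ x % 2 = 0 := by omega
    rw [this]
  have c0 : c 0 = p 0 := by simpa using hct 0 (by omega)
  -- a reparametrisation of the cycle for which the even positions are those satisfying `E`
  have main : ∀ c' : ℤ → V, ∀ τ : ℤ → ℤ, (∀ x, c' x = c (τ x)) → (∀ x, E (c' (2 * x))) →
      (∀ x, E (c (τ x)) → x % 2 = 0) → (∀ x, ∃ y, τ y = x) →
      (∀ x y, c' x = c' y ↔ (2 * N : ℤ) ∣ x - y) → (∀ x, G.Adj (c' x) (c' (x + 1))) →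
      (G.Adj (c' 0) (c' j)) → ∃ q : ℕ → V, IsPathFn G q (2 * l) ∧ (∀ t, ∃ s ≤ M, q t = p s) ∧
      (E (q 0) ∧ Q (q 0)) ∧ (E (q (2 * l)) ∧ ¬ Q (q (2 * l))) := by
    intro c' τ hτ hE' hτ2 hsurj hc' adj' chord'
    have conv : ∀ P : V → Prop, (∃ t ≤ M, E (p t) ∧ P (p t)) → ∃ x, P (c' (2 * x)) := by
      rintro P ⟨t, ht, hEt, hPt⟩
      obtain ⟨y, hy⟩ := hsurj t
      have h2 := hτ2 y (by rwa [hy, hct _ ht])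
      refine ⟨y / 2, ?_⟩
      rw [show 2 * (y / 2) = y by omega, hτ, hy, hct _ ht]
      exact hPt
    obtain ⟨q, hq, hqc, ⟨x, hx, hx'⟩, ⟨y, hy, hy'⟩⟩ := exists_path_of_theta_int (l := l) hl (by omega)
      (by omega) (by omega) (by omega) hc' adj' chord' Q (conv Q h1)
        (conv (fun v => ¬ Q v) h2)
    refine ⟨q, hq, fun t => ?_, ⟨?_, hx'⟩, ?_, hy'⟩
    · obtain ⟨x, hx⟩ := hqc t
      exact ⟨i (τ x), hiM _, by rw [hx, hτ]⟩
    · rw [hx]; exact hE' _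
    · rw [hy]; exact hE' _
  by_cases h0 : E (p 0)
  · refine main c id (fun _ => rfl) (fun x => ?_) (fun x => ?_) (fun x => ⟨x, rfl⟩) hc adj ?_
    · rw [hcE]
      simp [h0]
    · simp [hcE, h0]
    · rw [c0, hct _ hjM.le]; exact hchord
  · refine main (fun x => c (j - x)) (fun x => j - x) (fun _ => rfl) (fun x => ?_) (fun x => ?_)
      (fun x => ⟨j - x, by ring⟩) ?_ ?_ ?_
    · rw [hcE]
      simp only [h0, false_iff]
      omega
    · simp only [hcE, h0, false_iff]
      omega
    · intro x y
      rw [hc, ← dvd_neg]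
      ring_nf
    · intro x
      have := (adj (j - (x + 1))).symm
      rwa [show (j : ℤ) - (x + 1) + 1 = j - x by ring] at this
    · rw [sub_zero, sub_self, c0, hct _ hjM.le]; exact hchord.symm

/-- In a `C_{2k}`-free graph with a tree-like level structure, there is no long cycle with a chord
alternating between level `i` and its complement, provided that each vertex of level `i` on it has
a parent outside of the cycle. -/
lemma CycleFree.false_of_theta {V : Type*} {G : SimpleGraph V} {k i M j : ℕ} {lv : V → ℕ}
    (hG : CycleFree (2 * k) G) (root : ∀ u v, lv u = 0 → lv v = 0 → u = v)
    (par : ∀ v, 0 < lv v → lv v ≤ i → ∃ u, G.Adj v u ∧ lv u + 1 = lv v) (hi : 1 ≤ i) (hik : i < k)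
    {p : ℕ → V} (hp : IsPathFn G p M) (hj : 2 ≤ j) (hjM : j < M) (hclose : G.Adj (p 0) (p M))
    (hchord : G.Adj (p 0) (p j)) (hE : ∀ t < M, lv (p t) = i ↔ ¬ lv (p (t + 1)) = i)
    (hEM : lv (p 0) = i ↔ ¬ lv (p M) = i) (hEj : lv (p 0) = i ↔ ¬ lv (p j) = i)
    (hkM : 2 * k ≤ M + 1) (hlow : ∀ t ≤ M, i ≤ lv (p t) + 1)
    (hoff : ∀ t ≤ M, lv (p t) = i → ∃ u, G.Adj (p t) u ∧ lv u + 1 = i ∧ ∀ s ≤ M, p s ≠ u) :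
    False := by
  have hpar : ∀ v, ∃ u, 0 < lv v → lv v ≤ i → G.Adj v u ∧ lv u + 1 = lv v := by
    intro v
    by_cases h : 0 < lv v ∧ lv v ≤ i
    · obtain ⟨u, hu⟩ := par v h.1 h.2
      exact ⟨u, fun _ _ => hu⟩
    · exact ⟨v, fun a b => (h ⟨a, b⟩).elim⟩
  choose f hf using hpar
  let C : V → Prop := fun v => lv v = i ∧ ∃ t ≤ M, p t = v
  have hoff' : ∀ v, ∃ u, C v → G.Adj v u ∧ lv u + 1 = i ∧ ∀ s ≤ M, p s ≠ u := by
    intro v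
    by_cases h : C v
    · obtain ⟨h, t, ht, rfl⟩ := h
      obtain ⟨u, hu⟩ := hoff t ht h
      exact ⟨u, fun _ => hu⟩
    · exact ⟨v, fun a => (h a).elim⟩
  choose g hg using hoff'
  let anc : V → ℕ → V := fun w s => s.casesOn w (fun s => f^[s] (g w))
  have anc0 : ∀ w, anc w 0 = w := fun w => rfl
  have anc1 : ∀ w, anc w 1 = g w := fun w => rfl
  have anc2 : ∀ w s, anc w (s + 2) = f (anc w (s + 1)) := fun w s => Function.iterate_succ_apply' f s (g w)
  have lvanc : ∀ w, C w → ∀ s, s ≤ i → lv (anc w s) + s = i := by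
    intro w hw s
    induction s with
    | zero => intro _; exact hw.1
    | succ s ih =>
      intro hs
      have := ih (by omega)
      cases s with
      | zero => exact (hg w hw).2.1
      | succ s =>
        rw [anc2]
        have := (hf (anc w (s + 1)) (by omega) (by omega)).2
        omega
  have adjanc : ∀ w, C w → ∀ s, s < i → G.Adj (anc w s) (anc w (s + 1)) := by
    intro w hw s hs
    cases s with
    | zero => exact (hg w hw).1
    | succ s =>
      rw [anc2]
      have := lvanc w hw (s + 1) (by omega)
      exact (hf (anc w (s + 1)) (by omega) (by omega)).1
  have offanc : ∀ w, C w → ∀ s, s < i → ∀ t ≤ M, p t ≠ anc w (s + 1) := by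
    intro w hw s hs t ht
    cases s with
    | zero => exact (hg w hw).2.2 t ht
    | succ s =>
      intro h
      have a : lv (anc w (s + 1 + 1)) + (s + 2) = i := lvanc w hw (s + 2) (by omega)
      have b := hlow t ht
      rw [h] at b
      omega
  have eqanc : ∀ w z s, anc w s = anc z s → ∀ d, anc w (s + d) = anc z (s + d) := by
    intro w z s h d
    induction d with
    | zero => exact h
    | succ d ih =>
      rcases Nat.eq_zero_or_pos (s + d) with h0 | h0
      · obtain ⟨rfl, rfl⟩ : s = 0 ∧ d = 0 := by omega
        rw [anc0, anc0] at h
        rw [h]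
      · obtain ⟨e, he⟩ : ∃ e, s + d = e + 1 := ⟨s + d - 1, by omega⟩
        rw [← add_assoc, he, anc2, anc2, ← he, ih]
  have hex : ∃ h, ∀ w z, C w → C z → anc w h = anc z h := by
    refine ⟨i, fun w z hw hz => root _ _ ?_ ?_⟩
    · have := lvanc w hw i le_rfl; omega
    · have := lvanc z hz i le_rfl; omega
  obtain ⟨h, hh, hmin⟩ : ∃ h, (∀ w z, C w → C z → anc w h = anc z h) ∧
      ∀ m < h, ¬ ∀ w z, C w → C z → anc w m = anc z m := by
    classical
    exact ⟨Nat.find hex, Nat.find_spec hex, fun m hm => Nat.find_min hex hm⟩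
  have hhi : h ≤ i := by
    by_contra hlt
    refine hmin i (by omega) fun w z hw hz => root _ _ ?_ ?_
    · have := lvanc w hw i le_rfl; omega
    · have := lvanc z hz i le_rfl; omega
  have h1 : 1 ≤ h := by
    by_contra h0
    have h0 : h = 0 := by omega
    subst h0
    have a0 := hE 0 (by omega)
    have a1 := hE 1 (by omega)
    have a2 := hE 2 (by omega)
    simp only [zero_add, Nat.reduceAdd] at a0 a1 a2
    by_cases e : lv (p 0) = i
    · have := hp.inj _ _ (by omega) (by omega) (hh (p 0) (p 2) ⟨e, 0, by omega, rfl⟩ ⟨by tauto, 2, by omega, rfl⟩)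
      omega
    · have := hp.inj _ _ (by omega) (by omega) (hh (p 1) (p 3) ⟨by tauto, 1, by omega, rfl⟩ ⟨by tauto, 3, by omega, rfl⟩)
      omega
  obtain ⟨w0, z0, hw0, hz0, hwz⟩ : ∃ w z, C w ∧ C z ∧ anc w (h - 1) ≠ anc z (h - 1) := by
    have := hmin (h - 1) (by omega)
    push Not at this
    exact this
  obtain ⟨l, hl⟩ : ∃ l, k = l + h := ⟨k - h, by omega⟩
  obtain ⟨q, hq, hqp, ⟨hEw, hQw⟩, hEz, hQz⟩ := exists_path_of_theta (l := l) hp hj hjM hclose hchord (fun v => lv v = i) hE hEM hEj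
    (by omega) (by omega) (fun v => anc v (h - 1) = anc z0 (h - 1))
    (by obtain ⟨a, t, ht, rfl⟩ := hz0; exact ⟨t, ht, a, rfl⟩)
    (by obtain ⟨a, t, ht, rfl⟩ := hw0; exact ⟨t, ht, a, hwz⟩)
  have hCw : C (q 0) := ⟨hEw, by obtain ⟨s, hs, e⟩ := hqp 0; exact ⟨s, hs, e.symm⟩⟩
  have hCz : C (q (2 * l)) := ⟨hEz, by obtain ⟨s, hs, e⟩ := hqp (2 * l); exact ⟨s, hs, e.symm⟩⟩
  set w := q 0 with hw
  set z := q (2 * l) with hz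
  have hne : ∀ s < h, anc w s ≠ anc z s := by
    intro s hs e
    have := eqanc w z s e (h - 1 - s)
    rw [show s + (h - 1 - s) = h - 1 by omega] at this
    exact hQz (this ▸ hQw)
  let c : ℕ → V := fun t => if t ≤ 2 * l then q t else if t ≤ 2 * l + h then anc z (t - 2 * l)
    else anc w (2 * k - t)
  have hc1 : ∀ t, t ≤ 2 * l → c t = q t := fun t ht => if_pos ht
  have hc2 : ∀ t, t ≤ h → c (2 * l + t) = anc z t := by
    intro t ht
    rcases Nat.eq_zero_or_pos t with rfl | h0
    · exact hc1 _ (by omega)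
    · simp only [c]
      rw [if_neg (by omega), if_pos (by omega)]
      congr 1
      omega
  have hc3 : ∀ t, 1 ≤ t → t ≤ h → c (2 * k - t) = anc w t := by
    intro t ht ht'
    rcases Nat.eq_or_lt_of_le ht' with rfl | h0
    · rw [show 2 * k - t = 2 * l + t by omega, hc2 _ le_rfl]
      exact hh _ _ hCz hCw
    · simp only [c]
      rw [if_neg (by omega), if_neg (by omega)]
      congr 1
      omega
  have hsplit : ∀ t, t < 2 * k → t ≤ 2 * l ∨ (∃ a, 1 ≤ a ∧ a ≤ h ∧ t = 2 * l + a) ∨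
      ∃ a, 1 ≤ a ∧ a < h ∧ t = 2 * k - a := by
    intro t ht
    by_cases h1 : t ≤ 2 * l
    · exact Or.inl h1
    by_cases h2 : t ≤ 2 * l + h
    · exact Or.inr (Or.inl ⟨t - 2 * l, by omega, by omega, by omega⟩)
    · exact Or.inr (Or.inr ⟨2 * k - t, by omega, by omega, by omega⟩)
  have hinj : ∀ s t, s < t → t < 2 * k → c s ≠ c t := by
    intro s t hst ht e
    have offq : ∀ a, a ≤ 2 * l → ∀ v, C v → ∀ b, 1 ≤ b → b ≤ h → q a ≠ anc v b := by
      intro a _ v hv b hb hbh e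
      obtain ⟨s, hs, e'⟩ := hqp a
      obtain ⟨b, rfl⟩ : ∃ b', b = b' + 1 := ⟨b - 1, by omega⟩
      exact offanc v hv b (by omega) s hs (e' ▸ e)
    rcases hsplit s (by omega) with hs | ⟨a, ha, ha', rfl⟩ | ⟨a, ha, ha', rfl⟩
    · rw [hc1 s hs] at e
      rcases hsplit t ht with ht' | ⟨b, hb, hb', rfl⟩ | ⟨b, hb, hb', rfl⟩
      · rw [hc1 t ht'] at e
        have := hq.inj _ _ hs ht' e
        omega
      · rw [hc2 _ hb'] at e
        exact offq _ hs _ hCz _ hb hb' e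
      · rw [hc3 _ hb hb'.le] at e
        exact offq _ hs _ hCw _ hb hb'.le e
    · rw [hc2 _ ha'] at e
      have l1 := lvanc z hCz a (by omega)
      rcases hsplit t ht with ht' | ⟨b, hb, hb', rfl⟩ | ⟨b, hb, hb', rfl⟩
      · omega
      · rw [hc2 _ hb'] at e
        have l2 := lvanc z hCz b (by omega)
        rw [e] at l1
        omega
      · rw [hc3 _ hb hb'.le] at e
        have l2 := lvanc w hCw b (by omega)
        rw [e] at l1
        obtain rfl : a = b := by omega
        exact hne a hb' e.symm
    · rw [hc3 _ ha ha'.le] at e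
      have l1 := lvanc w hCw a (by omega)
      rcases hsplit t ht with ht' | ⟨b, hb, hb', rfl⟩ | ⟨b, hb, hb', rfl⟩
      · omega
      · omega
      · rw [hc3 _ hb hb'.le] at e
        have l2 := lvanc w hCw b (by omega)
        rw [e] at l1
        omega
  refine hG (hasSubCopy_cycleGraph (by omega) c (fun s t hs ht e => ?_) (fun t ht => ?_) ?_)
  · rcases lt_trichotomy s t with hlt | rfl | hlt
    · exact (hinj s t hlt ht e).elim
    · rfl
    · exact (hinj t s hlt hs e.symm).elim
  · by_cases t1 : t < 2 * l
    · rw [hc1 t (by omega), hc1 (t + 1) (by omega)]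
      exact hq.adj t t1
    · by_cases t2 : t < 2 * l + h
      · obtain ⟨a, rfl⟩ : ∃ a, t = 2 * l + a := ⟨t - 2 * l, by omega⟩
        rw [add_assoc, hc2 _ (by omega), hc2 _ (by omega)]
        exact adjanc z hCz a (by omega)
      · obtain ⟨a, ha⟩ : ∃ a, t + 1 + a = 2 * k := ⟨2 * k - (t + 1), by omega⟩
        rw [show t = 2 * k - (a + 1) by omega, show 2 * k - (a + 1) + 1 = 2 * k - a by omega,
          hc3 _ (by omega) (by omega), hc3 _ (by omega) (by omega)]
        exact (adjanc w hCw a (by omega)).symm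
  · rw [hc3 1 le_rfl h1, hc1 0 (by omega)]
    exact (adjanc w hCw 0 (by omega)).symm

/-- A `C_{2k}`-free graph whose vertices carry levels such that each vertex of positive level
`≤ i` has a neighbour one level below. -/
structure IsLevelled {V : Type*} (G : SimpleGraph V) (k i : ℕ) (lv : V → ℕ) : Prop where
  free : CycleFree (2 * k) G
  root : ∀ u v, lv u = 0 → lv v = 0 → u = v
  par : ∀ v, 0 < lv v → lv v ≤ i → ∃ u, G.Adj v u ∧ lv u + 1 = lv v
  pos : 1 ≤ i
  lt : i < k

/-- A path alternating between level `i` and other levels at least `i - 1`, such that each vertex of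
level `i` on it has a parent outside of the path. -/
structure IsGoodPath {V : Type*} (G : SimpleGraph V) (lv : V → ℕ) (i : ℕ) (p : ℕ → V) (m : ℕ) :
    Prop extends IsPathFn G p m where
  alt : ∀ t < m, lv (p t) = i ↔ ¬ lv (p (t + 1)) = i
  low : ∀ t ≤ m, i ≤ lv (p t) + 1
  off : ∀ t ≤ m, lv (p t) = i → ∃ u, G.Adj (p t) u ∧ lv u + 1 = i ∧ ∀ s ≤ m, p s ≠ u

namespace IsGoodPath

variable {V : Type*} {G : SimpleGraph V} {lv : V → ℕ} {i m : ℕ} {p : ℕ → V}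

lemma window (hp : IsGoodPath G lv i p m) {a b : ℕ} (hb : b ≤ m) (hab : a ≤ b) :
    IsGoodPath G lv i (fun t => p (a + t)) (b - a) where
  adj t ht := hp.adj (a + t) (by omega)
  inj s t hs ht h := by have := hp.inj _ _ (by omega) (by omega) h; omega
  alt t ht := hp.alt (a + t) (by omega)
  low t ht := hp.low _ (by omega)
  off t ht h := by
    obtain ⟨u, h1, h2, h3⟩ := hp.off _ (by omega) h
    exact ⟨u, h1, h2, fun s hs => h3 _ (by omega)⟩

lemma reverse (hp : IsGoodPath G lv i p m) : IsGoodPath G lv i (fun t => p (m - t)) m where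
  adj t ht := by
    have := hp.adj (m - (t + 1)) (by omega)
    rw [show m - (t + 1) + 1 = m - t by omega] at this
    exact this.symm
  inj s t hs ht h := by have := hp.inj _ _ (by omega) (by omega) h; omega
  alt t ht := by
    have := hp.alt (m - (t + 1)) (by omega)
    rw [show m - (t + 1) + 1 = m - t by omega] at this
    tauto
  low t ht := hp.low _ (by omega)
  off t ht h := by
    obtain ⟨u, h1, h2, h3⟩ := hp.off _ (by omega) h
    exact ⟨u, h1, h2, fun s hs => h3 _ (by omega)⟩

lemma lv_eq_iff (hp : IsGoodPath G lv i p m) {t : ℕ} (ht : t ≤ m) :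
    lv (p t) = i ↔ (lv (p 0) = i ↔ t % 2 = 0) := by
  induction t with
  | zero => simp
  | succ t ih =>
    have a := ih (by omega)
    have b := hp.alt t (by omega)
    have c : (t + 1) % 2 = 0 ↔ ¬ (t % 2 = 0) := by omega
    rw [c]
    tauto

lemma false_of_adj_right {k : ℕ} (hp : IsGoodPath G lv i p m) (hG : IsLevelled G k i lv)
    {a j b : ℕ} (haj : a + 2 ≤ j) (hjb : j < b) (hbm : b ≤ m) (hab : a + 2 * k ≤ b + 1)
    (h1 : G.Adj (p a) (p b)) (h2 : G.Adj (p a) (p j)) (e1 : lv (p a) = i ↔ ¬ lv (p b) = i)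
    (e2 : lv (p a) = i ↔ ¬ lv (p j) = i) : False := by
  have hw := hp.window hbm (show a ≤ b by omega)
  refine hG.free.false_of_theta (j := j - a) hG.root hG.par hG.pos hG.lt hw.toIsPathFn (by omega)
    (by omega) ?_ ?_ hw.alt ?_ ?_ (by omega) hw.low hw.off
  · simpa only [add_zero, show a + (b - a) = b by omega] using h1
  · simpa only [add_zero, show a + (j - a) = j by omega] using h2
  · simpa only [add_zero, show a + (b - a) = b by omega] using e1
  · simpa only [add_zero, show a + (j - a) = j by omega] using e2

lemma false_of_adj_left {k : ℕ} (hp : IsGoodPath G lv i p m) (hG : IsLevelled G k i lv)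
    {a j b : ℕ} (haj : a < j) (hjb : j + 2 ≤ b) (hbm : b ≤ m) (hab : a + 2 * k ≤ b + 1)
    (h1 : G.Adj (p b) (p a)) (h2 : G.Adj (p b) (p j)) (e1 : lv (p b) = i ↔ ¬ lv (p a) = i)
    (e2 : lv (p b) = i ↔ ¬ lv (p j) = i) : False := by
  refine hp.reverse.false_of_adj_right hG (a := m - b) (j := m - j) (b := m - a) (by omega)
    (by omega) (by omega) (by omega) ?_ ?_ ?_ ?_ <;>
  simpa only [show m - (m - b) = b by omega, show m - (m - a) = a by omega,
    show m - (m - j) = j by omega]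

end IsGoodPath

lemma mul_card_le_of_mod_eq {P : Finset ℕ} {q a b r : ℕ} (hq : 0 < q)
    (h : ∀ t ∈ P, a ≤ t ∧ t ≤ b ∧ t % q = r) : q * P.card ≤ b - a + q := by
  have : P.card ≤ (Finset.range ((b - a) / q + 1)).card := by
    refine Finset.card_le_card_of_injOn (fun t => (t - a) / q) (fun t ht => ?_) ?_
    · obtain ⟨h1, h2, h3⟩ := h t ht
      simp only [Finset.coe_range, Set.mem_Iio]
      have := Nat.div_le_div_right (c := q) (show t - a ≤ b - a by omega)
      omega
    · intro s hs t ht e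
      obtain ⟨h1, h2, h3⟩ := h s hs
      obtain ⟨h4, h5, h6⟩ := h t ht
      simp only at e
      have key : ∀ x y : ℕ, a ≤ x → x ≤ y → (x - a) / q = (y - a) / q → x % q = y % q → x = y := by
        intro x y hx hxy e e'
        have hd : q ∣ y - x := (Nat.modEq_iff_dvd' hxy).1 e'
        have d1 := Nat.div_add_mod (x - a) q
        have d2 := Nat.div_add_mod (y - a) q
        have m1 := Nat.mod_lt (x - a) hq
        have m2 := Nat.mod_lt (y - a) hq
        rw [e] at d1
        have := Nat.eq_zero_of_dvd_of_lt hd (by omega)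
        omega
      rcases le_total s t with hst | hst
      · exact key s t h1 hst e (by omega)
      · exact (key t s h4 hst e.symm (by omega)).symm
  rw [Finset.card_range] at this
  have h1 := Nat.mul_le_mul_left q this
  have h2 := Nat.mul_div_le (b - a) q
  rw [mul_add, mul_one] at h1
  omega

namespace IsGoodPath

variable {V : Type*} {G : SimpleGraph V} {lv : V → ℕ} {i m : ℕ} {p : ℕ → V}

lemma snoc (hp : IsGoodPath G lv i p m) {v : V} (hadj : G.Adj (p m) v) (hnew : ∀ t ≤ m, p t ≠ v)
    (halt : lv (p m) = i ↔ ¬ lv v = i) (hlow : i ≤ lv v + 1)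
    (hoff : ∀ t ≤ m, lv (p t) = i →
      ∃ u, G.Adj (p t) u ∧ lv u + 1 = i ∧ (∀ s ≤ m, p s ≠ u) ∧ u ≠ v)
    (hoffv : lv v = i → ∃ u, G.Adj v u ∧ lv u + 1 = i ∧ ∀ s ≤ m, p s ≠ u) :
    IsGoodPath G lv i (Function.update p (m + 1) v) (m + 1) := by
  have e1 : Function.update p (m + 1) v (m + 1) = v := Function.update_self ..
  have e2 : ∀ t ≤ m, Function.update p (m + 1) v t = p t := fun t ht =>
    Function.update_of_ne (by omega) ..
  have split : ∀ t ≤ m + 1, t ≤ m ∨ t = m + 1 := fun t ht => by omega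
  refine ⟨⟨fun t ht => ?_, fun s t hs ht h => ?_⟩, fun t ht => ?_, fun t ht => ?_, fun t ht h => ?_⟩
  · rw [e2 t (by omega)]
    rcases split (t + 1) (by omega) with h | h
    · rw [e2 _ h]; exact hp.adj t (by omega)
    · rw [h, e1, show t = m by omega]; exact hadj
  · rcases split s hs with hs | rfl <;> rcases split t ht with ht | rfl
    · rw [e2 _ hs, e2 _ ht] at h; exact hp.inj _ _ hs ht h
    · rw [e2 _ hs, e1] at h; exact (hnew _ hs h).elim
    · rw [e2 _ ht, e1] at h; exact (hnew _ ht h.symm).elim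
    · rfl
  · rw [e2 t (by omega)]
    rcases split (t + 1) (by omega) with h | h
    · rw [e2 _ h]; exact hp.alt t (by omega)
    · rw [h, e1, show t = m by omega]; exact halt
  · rcases split t ht with ht | rfl
    · rw [e2 _ ht]; exact hp.low t ht
    · rw [e1]; exact hlow
  · rcases split t ht with ht | rfl
    · rw [e2 _ ht] at h ⊢
      obtain ⟨u, h1, h2, h3, h4⟩ := hoff t ht h
      refine ⟨u, h1, h2, fun s hs => ?_⟩
      rcases split s hs with hs | rfl
      · rw [e2 _ hs]; exact h3 s hs
      · rw [e1]; exact h4.symm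
    · rw [e1] at h ⊢
      obtain ⟨u, h1, h2, h3⟩ := hoffv h
      refine ⟨u, h1, h2, fun s hs => ?_⟩
      rcases split s hs with hs | rfl
      · rw [e2 _ hs]; exact h3 s hs
      · rw [e1]; exact h1.ne

lemma snoc_of_le (hp : IsGoodPath G lv i p m) {v : V} (hadj : G.Adj (p m) v)
    (hnew : ∀ t ≤ m, p t ≠ v) (halt : lv (p m) = i ↔ ¬ lv v = i) (hlow : i ≤ lv v)
    (hoffv : lv v = i → ∃ u, G.Adj v u ∧ lv u + 1 = i ∧ ∀ s ≤ m, p s ≠ u) :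
    IsGoodPath G lv i (Function.update p (m + 1) v) (m + 1) := by
  refine hp.snoc hadj hnew halt (by omega) (fun t ht h => ?_) hoffv
  obtain ⟨u, h1, h2, h3⟩ := hp.off t ht h
  exact ⟨u, h1, h2, h3, fun e => by subst e; omega⟩

lemma lt_card [Fintype V] (hp : IsGoodPath G lv i p m) : m < Fintype.card V := by
  have := Fintype.card_le_of_injective (fun t : Fin (m + 1) => p t)
    (fun s t h => Fin.ext (hp.inj _ _ (by omega) (by omega) h))
  simpa using this

end IsGoodPath

open Classical in
/-- A level and a set of vertices of higher level cannot span a bipartite graph of large minimum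
degree. -/
lemma IsLevelled.false_of_degrees {V : Type*} [Fintype V] {G : SimpleGraph V} {k i : ℕ} {lv : V → ℕ}
    (hG : IsLevelled G k i lv) {S T : Finset V} (hS : ∀ v ∈ S, lv v = i) (hT : ∀ v ∈ T, i < lv v)
    (hne : S.Nonempty) (h1 : ∀ v ∈ S, k + 2 ≤ (T.filter (G.Adj v)).card)
    (h2 : ∀ v ∈ T, k + 2 ≤ (S.filter (G.Adj v)).card) : False := by
  have parent : ∀ v, lv v = i → ∃ u, G.Adj v u ∧ lv u + 1 = i := fun v hv => by
    obtain ⟨u, h, h'⟩ := hG.par v (by have := hG.pos; omega) hv.le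
    exact ⟨u, h, by omega⟩
  have hST : ∀ v ∈ S ∪ T, i ≤ lv v := fun v hv => by
    rcases Finset.mem_union.1 hv with h | h
    · exact (hS v h).ge
    · exact (hT v h).le
  let P : ℕ → Prop := fun m => ∃ p, IsGoodPath G lv i p m ∧ ∀ t ≤ m, p t ∈ S ∪ T
  have hP0 : P 0 := by
    obtain ⟨v, hv⟩ := hne
    refine ⟨fun _ => v, ⟨⟨fun t ht => by omega, fun s t hs ht _ => by omega⟩, fun t ht => by omega,
      fun t _ => by have := hS v hv; omega, fun t _ h => ?_⟩, fun _ _ => Finset.mem_union_left _ hv⟩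
    obtain ⟨u, h1, h2⟩ := parent v h
    exact ⟨u, h1, h2, fun _ _ => h1.ne⟩
  have hbd : ∀ m, P m → m ≤ Fintype.card V := fun m ⟨p, hp, _⟩ => hp.lt_card.le
  obtain ⟨m, ⟨p, hp, hpST⟩, hmax⟩ : ∃ m, P m ∧ ∀ m', P m' → m' ≤ m :=
    ⟨Nat.findGreatest P (Fintype.card V), Nat.findGreatest_spec (Nat.zero_le _) hP0,
      fun m' h => Nat.le_findGreatest (hbd m' h) h⟩
  -- the neighbours of the last vertex
  obtain ⟨W, hW, hWl, hWST⟩ : ∃ W : Finset V, k + 2 ≤ (W.filter (G.Adj (p m))).card ∧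
      (∀ w ∈ W, lv (p m) = i ↔ ¬ lv w = i) ∧ W ⊆ S ∪ T := by
    rcases Finset.mem_union.1 (hpST m le_rfl) with h | h
    · refine ⟨T, h1 _ h, fun w hw => ?_, Finset.subset_union_right⟩
      have := hT w hw
      have := hS _ h
      omega
    · refine ⟨S, h2 _ h, fun w hw => ?_, Finset.subset_union_left⟩
      have := hS w hw
      have := hT _ h
      omega
  have hon : ∀ w ∈ W, G.Adj (p m) w → ∃ t ≤ m, p t = w := by
    intro w hw hadj
    by_contra hcon
    push Not at hcon
    have := hmax (m + 1) ⟨_, hp.snoc_of_le hadj hcon (hWl w hw) (hST _ (hWST hw)) fun h => by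
      obtain ⟨u, h1, h2⟩ := parent w h
      exact ⟨u, h1, h2, fun s hs e => by have := hST _ (hpST s hs); rw [e] at this; omega⟩, fun t ht => by
      by_cases h : t = m + 1
      · rw [h, Function.update_self]; exact hWST hw
      · rw [Function.update_of_ne h]; exact hpST t (by omega)⟩
    omega
  let I := (Finset.range m).filter fun t => p t ∈ W ∧ G.Adj (p m) (p t)
  have hI : k + 2 ≤ I.card := by
    refine hW.trans ((Finset.card_le_card fun w hw => ?_).trans (Finset.card_image_le (f := p)))
    obtain ⟨hw, hadj⟩ := Finset.mem_filter.1 hw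
    obtain ⟨t, ht, rfl⟩ := hon w hw hadj
    refine Finset.mem_image.2 ⟨t, Finset.mem_filter.2 ⟨Finset.mem_range.2 ?_, hw, hadj⟩, rfl⟩
    rcases Nat.lt_or_ge t m with h | h
    · exact h
    · rw [show t = m by omega] at hadj; exact (G.irrefl hadj).elim
  have hIne : I.Nonempty := Finset.card_pos.1 (by omega)
  set a := I.min' hIne with ha
  have haI : a ∈ I := I.min'_mem hIne
  obtain ⟨ham, haW, hadja⟩ := Finset.mem_filter.1 haI
  rw [Finset.mem_range] at ham
  have hparI : ∀ t ∈ I, a ≤ t ∧ t ≤ m - 1 ∧ t % 2 = (m + 1) % 2 := by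
    intro t ht
    refine ⟨I.min'_le t ht, ?_, ?_⟩ <;> obtain ⟨h1, h2, h3⟩ := Finset.mem_filter.1 ht <;>
    rw [Finset.mem_range] at h1
    · omega
    · have a1 := hp.lv_eq_iff h1.le
      have a2 := hp.lv_eq_iff (le_refl m)
      have a3 := hWl _ h2
      by_contra hne
      have : t % 2 = 0 ↔ m % 2 = 0 := by omega
      tauto
  have hcard := mul_card_le_of_mod_eq two_pos hparI
  obtain ⟨j, hj, hja, hjm⟩ : ∃ j ∈ I, j ≠ a ∧ j ≠ m - 1 := by
    by_contra hcon
    push Not at hcon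
    have : I ⊆ {a, m - 1} := fun t ht => by
      by_cases h : t = a
      · simp [h]
      · simp [hcon t ht h]
    have := (Finset.card_le_card this).trans Finset.card_le_two
    have := hG.pos
    have := hG.lt
    omega
  obtain ⟨hj1, hj2, hj3⟩ := Finset.mem_filter.1 hj
  have := hparI j hj
  exact hp.false_of_adj_left hG (a := a) (j := j) (b := m) (by omega) (by omega) le_rfl (by omega)
    hadja hj3 (hWl _ haW) (hWl _ hj2)

open Classical in
/-- A dense bipartite relation contains a subrelation of large minimum degree. -/
lemma exists_min_degree_of_lt_sum {V : Type*} (R : V → V → Prop) (c : ℕ) (S T : Finset V)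
    (h : c * (S.card + T.card) < ∑ s ∈ S, (T.filter (R s)).card) :
    ∃ S' ⊆ S, ∃ T' ⊆ T, S'.Nonempty ∧ (∀ v ∈ S', c < (T'.filter (R v)).card) ∧
      ∀ v ∈ T', c < (S'.filter fun s => R s v).card := by
  induction hN : S.card + T.card generalizing S T with
  | zero =>
    obtain ⟨rfl, rfl⟩ : S = ∅ ∧ T = ∅ := by
      rw [← Finset.card_eq_zero, ← Finset.card_eq_zero]; omega
    simp at h
  | succ N ih =>
    by_cases h1 : ∃ v ∈ S, (T.filter (R v)).card ≤ c
    · obtain ⟨v, hv, hc⟩ := h1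
      have e := Finset.card_erase_add_one hv
      have e2 := Finset.add_sum_erase S (fun s => (T.filter (R s)).card) hv
      obtain ⟨S', hS', T', hT', h'⟩ := ih (S.erase v) T (by nlinarith) (by omega)
      exact ⟨S', hS'.trans (Finset.erase_subset _ _), T', hT', h'⟩
    by_cases h2 : ∃ v ∈ T, (S.filter fun s => R s v).card ≤ c
    · obtain ⟨v, hv, hc⟩ := h2
      have e := Finset.card_erase_add_one hv
      have e2 := Finset.add_sum_erase T (fun t => (S.filter fun s => R s t).card) hv
      have e3 : ∀ T : Finset V, ∑ s ∈ S, (T.filter (R s)).card = ∑ t ∈ T, (S.filter fun s => R s t).card :=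
        fun T => Finset.sum_card_bipartiteAbove_eq_sum_card_bipartiteBelow R
      obtain ⟨S', hS', T', hT', h'⟩ := ih S (T.erase v) (by rw [e3] at h ⊢; nlinarith) (by omega)
      exact ⟨S', hS', T', hT'.trans (Finset.erase_subset _ _), h'⟩
    push Not at h1 h2
    refine ⟨S, subset_rfl, T, subset_rfl, ?_, h1, h2⟩
    rw [Finset.nonempty_iff_ne_empty]
    rintro rfl
    simp at h

open Classical in
lemma IsLevelled.sum_card_le {V : Type*} [Fintype V] {G : SimpleGraph V} {k i : ℕ} {lv : V → ℕ}
    (hG : IsLevelled G k i lv) {S T : Finset V} (hS : ∀ v ∈ S, lv v = i) (hT : ∀ v ∈ T, i < lv v) :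
    ∑ s ∈ S, (T.filter (G.Adj s)).card ≤ (k + 1) * (S.card + T.card) := by
  by_contra hcon
  obtain ⟨S', hS', T', hT', hne, h1, h2⟩ := exists_min_degree_of_lt_sum G.Adj (k + 1) S T (by omega)
  refine hG.false_of_degrees (fun v hv => hS v (hS' hv)) (fun v hv => hT v (hT' hv)) hne h1
    fun v hv => ?_
  simp only [G.adj_comm v]
  exact h2 v hv

namespace IsGoodPath

variable {V : Type*} {G : SimpleGraph V} {lv : V → ℕ} {i m k : ℕ} {p : ℕ → V}

/-- A far neighbour of the last vertex of a good path leaves no room for other neighbours. -/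
lemma eq_or_eq_of_far (hp : IsGoodPath G lv i p m) (hG : IsLevelled G k i lv) {a j : ℕ}
    (ham : a + 2 * k ≤ m + 1) (hj : j ≤ m) (h1 : G.Adj (p m) (p a)) (h2 : G.Adj (p m) (p j))
    (e1 : lv (p m) = i ↔ ¬ lv (p a) = i) (e2 : lv (p m) = i ↔ ¬ lv (p j) = i) :
    j = a ∨ j + 1 = m := by
  by_contra hcon
  push Not at hcon
  have hjm : j ≠ m := by rintro rfl; exact G.irrefl h2
  have := hG.pos
  have := hG.lt
  rcases lt_or_ge a j with h | h
  · exact hp.false_of_adj_left hG h (by omega) le_rfl ham h1 h2 e1 e2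
  · exact hp.false_of_adj_left hG (a := j) (j := a) (b := m) (by omega) (by omega) le_rfl (by omega)
      h2 h1 e2 e1

open Classical in
lemma card_le_of_adj_last (hp : IsGoodPath G lv i p m) (hG : IsLevelled G k i lv) (W : Finset V)
    (hW : ∀ w ∈ W, G.Adj (p m) w ∧ (lv (p m) = i ↔ ¬ lv w = i) ∧ ∃ t ≤ m, p t = w) :
    W.card ≤ k := by
  by_contra hk
  have := hG.pos
  have := hG.lt
  let I := (Finset.range m).filter fun t => p t ∈ W
  have hI : k + 1 ≤ I.card := by
    refine (show k + 1 ≤ W.card by omega).trans ((Finset.card_le_card fun w hw => ?_).trans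
      (Finset.card_image_le (s := I) (f := p)))
    obtain ⟨hadj, -, t, ht, rfl⟩ := hW w hw
    refine Finset.mem_image.2 ⟨t, Finset.mem_filter.2 ⟨Finset.mem_range.2 ?_, hw⟩, rfl⟩
    rcases Nat.lt_or_ge t m with h | h
    · exact h
    · rw [show t = m by omega] at hadj; exact (G.irrefl hadj).elim
  have hIne : I.Nonempty := Finset.card_pos.1 (by omega)
  set a := I.min' hIne with ha
  have haI : a ∈ I := I.min'_mem hIne
  have hparI : ∀ t ∈ I, a ≤ t ∧ t ≤ m - 1 ∧ t % 2 = (m + 1) % 2 := by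
    intro t ht
    refine ⟨I.min'_le t ht, ?_, ?_⟩ <;> obtain ⟨h1, h2⟩ := Finset.mem_filter.1 ht <;>
    rw [Finset.mem_range] at h1
    · omega
    · have a1 := hp.lv_eq_iff h1.le
      have a2 := hp.lv_eq_iff (le_refl m)
      have a3 := (hW _ h2).2.1
      by_contra hne
      have : t % 2 = 0 ↔ m % 2 = 0 := by omega
      tauto
  have hcard := mul_card_le_of_mod_eq two_pos hparI
  obtain ⟨ham, haW⟩ := Finset.mem_filter.1 haI
  rw [Finset.mem_range] at ham
  have hsub : I ⊆ {a, m - 1} := fun t ht => by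
    obtain ⟨h1, h2⟩ := Finset.mem_filter.1 ht
    rw [Finset.mem_range] at h1
    have := hp.eq_or_eq_of_far hG (a := a) (j := t) (by omega) h1.le (hW _ haW).1 (hW _ h2).1
      (hW _ haW).2.1 (hW _ h2).2.1
    have : t = a ∨ t = m - 1 := by omega
    simpa using this
  have := (Finset.card_le_card hsub).trans Finset.card_le_two
  omega

end IsGoodPath

open Classical in
/-- Three consecutive layers of a levelled graph joined by edges `v → u`, `u ∈ N v`, with lower
bounds on the degrees. -/
structure IsTrilayer {V : Type*} (G : SimpleGraph V) (k i : ℕ) (lv : V → ℕ) (N : V → Finset V)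
    (X₁ X₂ X₃ : Finset V) (A B C D d s : ℕ) : Prop extends IsLevelled G k i lv where
  adj : ∀ v, ∀ u ∈ N v, G.Adj v u
  lv₁ : ∀ v ∈ X₁, lv v + 1 = i
  lv₂ : ∀ v ∈ X₂, lv v = i
  lv₃ : ∀ v ∈ X₃, lv v = i + 1
  deg₁₂ : ∀ v ∈ X₁, A ≤ (X₂.filter fun u => u ∈ N v).card
  deg₂₁ : ∀ u ∈ X₂, B ≤ (X₁.filter fun v => u ∈ N v).card
  deg₂₃ : ∀ u ∈ X₂, C ≤ (X₃.filter fun w => w ∈ N u).card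
  deg₃₂ : ∀ w ∈ X₃, D ≤ (X₂.filter fun u => w ∈ N u).card
  card_le : ∀ u ∈ X₂, (N u).card ≤ d
  s_pos : 1 ≤ s
  s_le : 4 * s ≤ D
  D_ge : 64 ≤ D
  B_ge : 10 ≤ B
  sB : 2 * k ≤ s * (B - 4)
  C_ge : 4 * (k + 1) ≤ C
  d_le : d ≤ 8 * C
  A_gt : (k + 2) ^ s * (2 * k + 1) + k < A

open Classical in
/-- A path running through a trilayer, visiting the first layer every `2 * s` steps. -/
structure IsTriPath {V : Type*} (G : SimpleGraph V) (N : V → Finset V) (X₁ X₂ X₃ : Finset V)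
    (B s : ℕ) (p : ℕ → V) (m c : ℕ) : Prop extends IsPathFn G p m where
  mem₂ : ∀ t ≤ m, t % 2 = 1 → p t ∈ X₂
  mem₁ : ∀ t ≤ m, t % (2 * s) = 0 → p t ∈ X₁
  mem₃ : ∀ t ≤ m, t % 2 = 0 → t % (2 * s) ≠ 0 → p t ∈ X₃
  few : ∀ t ≤ m, t % 2 = 1 →
    (X₁.filter fun v => p t ∈ N v ∧ ∃ t' ≤ m, p t' = v).card + c ≤ B

namespace IsTrilayer

variable {V : Type*} {G : SimpleGraph V} {lv : V → ℕ} {k i m : ℕ} {p : ℕ → V} {N : V → Finset V}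
  {X₁ X₂ X₃ : Finset V} {A B C D d s : ℕ}

lemma lv_tri {c : ℕ} (hT : IsTrilayer G k i lv N X₁ X₂ X₃ A B C D d s)
    (hp : IsTriPath G N X₁ X₂ X₃ B s p m c) {t : ℕ} (ht : t ≤ m) :
    i ≤ lv (p t) + 1 ∧ (lv (p t) = i ↔ t % 2 = 1) := by
  by_cases h : t % 2 = 1
  · have := hT.lv₂ _ (hp.mem₂ t ht h)
    exact ⟨by omega, by simp [h, this]⟩
  · by_cases h' : t % (2 * s) = 0
    · have := hT.lv₁ _ (hp.mem₁ t ht h')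
      exact ⟨by omega, by simp only [h, iff_false]; omega⟩
    · have := hT.lv₃ _ (hp.mem₃ t ht (by omega) h')
      exact ⟨by omega, by simp only [h, iff_false]; omega⟩

lemma isGoodPath {c : ℕ} (hT : IsTrilayer G k i lv N X₁ X₂ X₃ A B C D d s)
    (hp : IsTriPath G N X₁ X₂ X₃ B s p m c) (hc : 1 ≤ c) : IsGoodPath G lv i p m where
  adj := hp.adj
  inj := hp.inj
  alt t ht := by rw [(hT.lv_tri hp ht.le).2, (hT.lv_tri hp ht).2]; omega
  low t ht := (hT.lv_tri hp ht).1
  off t ht h := by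
    classical
    have ht2 := (hT.lv_tri hp ht).2.1 h
    have h1 := hp.few t ht ht2
    have h2 := hT.deg₂₁ _ (hp.mem₂ t ht ht2)
    by_contra hcon
    push Not at hcon
    refine absurd (Finset.card_le_card (?_ : (X₁.filter fun v => p t ∈ N v) ⊆
      X₁.filter fun v => p t ∈ N v ∧ ∃ t' ≤ m, p t' = v)) (by omega)
    intro v hv
    rw [Finset.mem_filter] at hv ⊢
    exact ⟨hv.1, hv.2, hcon v (hT.adj _ _ hv.2).symm (hT.lv₁ v hv.1)⟩

end IsTrilayer

namespace IsTriPath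

variable {V : Type*} {G : SimpleGraph V} {k i m : ℕ} {p : ℕ → V} {N : V → Finset V}
  {X₁ X₂ X₃ : Finset V} {B s c c' : ℕ}

open Classical in
lemma snoc (hp : IsTriPath G N X₁ X₂ X₃ B s p m c) {v : V} (hadj : G.Adj (p m) v)
    (hnew : ∀ t ≤ m, p t ≠ v) (hc : c' ≤ c) (h2 : (m + 1) % 2 = 1 → v ∈ X₂)
    (h1 : (m + 1) % (2 * s) = 0 → v ∈ X₁)
    (h3 : (m + 1) % 2 = 0 → (m + 1) % (2 * s) ≠ 0 → v ∈ X₃)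
    (hfew : (m + 1) % 2 = 1 →
      (X₁.filter fun x => v ∈ N x ∧ ∃ t' ≤ m, p t' = x).card + c' ≤ B)
    (hv : ∀ t ≤ m, t % 2 = 1 → (v ∈ X₁ ∧ p t ∈ N v) → c' + 1 ≤ c) (hvv : v ∉ N v) :
    IsTriPath G N X₁ X₂ X₃ B s (Function.update p (m + 1) v) (m + 1) c' := by
  have e1 : Function.update p (m + 1) v (m + 1) = v := Function.update_self ..
  have e2 : ∀ t ≤ m, Function.update p (m + 1) v t = p t := fun t ht =>
    Function.update_of_ne (by omega) ..
  have split : ∀ t ≤ m + 1, t ≤ m ∨ t = m + 1 := fun t ht => by omega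
  have hex : ∀ x, (∃ t ≤ m + 1, Function.update p (m + 1) v t = x) →
      (∃ t ≤ m, p t = x) ∨ x = v := by
    rintro x ⟨t, ht, e⟩
    rcases split t ht with h | rfl
    · exact Or.inl ⟨t, h, by rw [← e2 t h, e]⟩
    · exact Or.inr (by rw [← e, e1])
  refine ⟨⟨fun t ht => ?_, fun s t hs ht h => ?_⟩, fun t ht h => ?_, fun t ht h => ?_,
    fun t ht h h' => ?_, fun t ht h => ?_⟩
  · rw [e2 t (by omega)]
    rcases split (t + 1) (by omega) with h | h
    · rw [e2 _ h]; exact hp.adj t (by omega)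
    · rw [h, e1, show t = m by omega]; exact hadj
  · rcases split s hs with hs | rfl <;> rcases split t ht with ht | rfl
    · rw [e2 _ hs, e2 _ ht] at h; exact hp.inj _ _ hs ht h
    · rw [e2 _ hs, e1] at h; exact (hnew _ hs h).elim
    · rw [e2 _ ht, e1] at h; exact (hnew _ ht h.symm).elim
    · rfl
  · rcases split t ht with ht | rfl
    · rw [e2 _ ht]; exact hp.mem₂ t ht h
    · rw [e1]; exact h2 h
  · rcases split t ht with ht | rfl
    · rw [e2 _ ht]; exact hp.mem₁ t ht h
    · rw [e1]; exact h1 h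
  · rcases split t ht with ht | rfl
    · rw [e2 _ ht]; exact hp.mem₃ t ht h h'
    · rw [e1]; exact h3 h h'
  · rcases split t ht with ht | rfl
    · rw [e2 _ ht]
      have hold := hp.few t ht h
      by_cases hvt : v ∈ X₁ ∧ p t ∈ N v
      · have := hv t ht h hvt
        refine le_trans ?_ hold
        have hsub : (X₁.filter fun x => p t ∈ N x ∧ ∃ t' ≤ m + 1, Function.update p (m + 1) v t' = x) ⊆
            insert v (X₁.filter fun x => p t ∈ N x ∧ ∃ t' ≤ m, p t' = x) := by
          intro x hx
          obtain ⟨hx1, hx2, hx3⟩ := Finset.mem_filter.1 hx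
          rcases hex x hx3 with h | h
          · exact Finset.mem_insert_of_mem (Finset.mem_filter.2 ⟨hx1, hx2, h⟩)
          · exact h ▸ Finset.mem_insert_self _ _
        have := (Finset.card_le_card hsub).trans (Finset.card_insert_le _ _)
        omega
      · refine le_trans (Nat.add_le_add (Finset.card_le_card fun x hx => ?_) hc) hold
        obtain ⟨hx1, hx2, hx3⟩ := Finset.mem_filter.1 hx
        rcases hex x hx3 with h | rfl
        · exact Finset.mem_filter.2 ⟨hx1, hx2, h⟩
        · exact (hvt ⟨hx1, hx2⟩).elim
    · rw [e1]
      refine le_trans (Nat.add_le_add_right (Finset.card_le_card fun x hx => ?_) _) (hfew h)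
      obtain ⟨hx1, hx2, hx3⟩ := Finset.mem_filter.1 hx
      rcases hex x hx3 with h | rfl
      · exact Finset.mem_filter.2 ⟨hx1, hx2, h⟩
      · exact (hvv hx2).elim

end IsTriPath

namespace IsTrilayer

variable {V : Type*} {G : SimpleGraph V} {lv : V → ℕ} {k i m : ℕ} {p : ℕ → V} {N : V → Finset V}
  {X₁ X₂ X₃ : Finset V} {A B C D d s : ℕ}

lemma snoc₃ {c : ℕ} (hT : IsTrilayer G k i lv N X₁ X₂ X₃ A B C D d s)
    (hp : IsTriPath G N X₁ X₂ X₃ B s p m c) {w : V} (hm : m % 2 = 1)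
    (hs : (m + 1) % (2 * s) ≠ 0) (hw : w ∈ X₃) (hadj : w ∈ N (p m)) (hnew : ∀ t ≤ m, p t ≠ w) :
    IsTriPath G N X₁ X₂ X₃ B s (Function.update p (m + 1) w) (m + 1) c := by
  refine hp.snoc (hT.adj _ _ hadj) hnew le_rfl (fun h => by omega) (fun h => (hs h).elim)
    (fun _ _ => hw) (fun h => by omega) (fun t _ _ h => ?_) fun h => G.irrefl (hT.adj _ _ h)
  have := hT.lv₁ _ h.1
  have := hT.lv₃ _ hw
  omega

open Classical in
lemma snoc₂ (hT : IsTrilayer G k i lv N X₁ X₂ X₃ A B C D d s)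
    (hp : IsTriPath G N X₁ X₂ X₃ B s p m 2) {u : V} (hm : m % 2 = 0) (hu : u ∈ X₂)
    (hadj : G.Adj (p m) u) (hnew : ∀ t ≤ m, p t ≠ u) :
    IsTriPath G N X₁ X₂ X₃ B s (Function.update p (m + 1) u) (m + 1) 2 := by
  have hgood := hT.isGoodPath hp (by omega)
  have hlvu := hT.lv₂ u hu
  refine hp.snoc hadj hnew le_rfl (fun h => hu) (fun h => ?_) (fun h => by omega) (fun _ => ?_)
    (fun t _ _ h => ?_) fun h => G.irrefl (hT.adj _ _ h)
  · have := Nat.mod_mod_of_dvd (m + 1) (Dvd.intro s rfl : 2 ∣ 2 * s)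
    omega
  · by_contra hcon
    have hs := hT.s_pos
    have hB := hT.B_ge
    set F := X₁.filter fun x => u ∈ N x ∧ ∃ t' ≤ m, p t' = x with hF
    let I := (Finset.range (m + 1)).filter fun t => p t ∈ F
    have hI : B - 1 ≤ I.card := by
      refine (show B - 1 ≤ F.card by omega).trans ((Finset.card_le_card fun x hx => ?_).trans
        (Finset.card_image_le (s := I) (f := p)))
      obtain ⟨-, -, t, ht, rfl⟩ := Finset.mem_filter.1 hx
      exact Finset.mem_image.2 ⟨t, Finset.mem_filter.2 ⟨Finset.mem_range.2 (by omega), hx⟩, rfl⟩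
    have hIprop : ∀ t ∈ I, t ≤ m ∧ t % 2 = 0 ∧ t % (2 * s) = 0 ∧ G.Adj u (p t) ∧
        lv (p t) + 1 = i := by
      intro t ht
      obtain ⟨h1, h2⟩ := Finset.mem_filter.1 ht
      obtain ⟨h3, h4, -⟩ := Finset.mem_filter.1 h2
      have h1 : t ≤ m := by have := Finset.mem_range.1 h1; omega
      have l1 := hT.lv₁ _ h3
      have e1 : t % 2 = 0 := by
        have := (hT.lv_tri hp h1).2
        omega
      refine ⟨h1, e1, ?_, (hT.adj _ _ h4).symm, l1⟩
      by_contra hne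
      have := hT.lv₃ _ (hp.mem₃ t h1 e1 hne)
      omega
    have hIne : I.Nonempty := Finset.card_pos.1 (by omega)
    set b := I.min' hIne with hb
    have hbI : b ∈ I := I.min'_mem hIne
    have hJ : (I.erase b).card + 1 = I.card := Finset.card_erase_add_one hbI
    have hJne : (I.erase b).Nonempty := Finset.card_pos.1 (by omega)
    set a := (I.erase b).min' hJne with ha
    have haJ : a ∈ I.erase b := Finset.min'_mem _ hJne
    have haI := Finset.mem_of_mem_erase haJ
    have hba : b < a := lt_of_le_of_ne (I.min'_le a haI) (Finset.ne_of_mem_erase haJ).symm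
    have hJcard := mul_card_le_of_mod_eq (P := I.erase b) (q := 2 * s) (a := a) (b := m) (r := 0)
      (by omega) fun t ht => ⟨Finset.min'_le _ t ht, (hIprop t (Finset.mem_of_mem_erase ht)).1,
        (hIprop t (Finset.mem_of_mem_erase ht)).2.2.1⟩
    obtain ⟨j, hj, hja, hjm⟩ : ∃ j ∈ I.erase b, j ≠ a ∧ j ≠ m := by
      by_contra hcon
      push Not at hcon
      have : I.erase b ⊆ {a, m} := fun t ht => by
        by_cases h : t = a
        · simp [h]
        · simp [hcon t ht h]
      have := (Finset.card_le_card this).trans Finset.card_le_two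
      omega
    have haj : a < j := lt_of_le_of_ne (Finset.min'_le _ j hj) hja.symm
    have hjI := hIprop j (Finset.mem_of_mem_erase hj)
    have haP := hIprop a haI
    have hbP := hIprop b hbI
    have hlong : 2 * k ≤ m - a := by
      have h1 := hT.sB
      have h2 : s * (B - 4) ≤ s * ((I.erase b).card - 1) := Nat.mul_le_mul_left _ (by omega)
      have h3 : 2 * s * (I.erase b).card = s * ((I.erase b).card - 1) + s * ((I.erase b).card - 1) + 2 * s := by
        obtain ⟨e, he⟩ : ∃ e, (I.erase b).card = e + 1 := ⟨(I.erase b).card - 1, by omega⟩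
        rw [he, Nat.add_sub_cancel]
        ring
      omega
    have hlast := (hT.lv_tri hp le_rfl).2
    have hext := (hgood.window le_rfl haP.1).snoc_of_le (v := u)
      (by simpa only [show a + (m - a) = m by omega] using hadj) (fun t ht => hnew _ (by omega))
      (by simp only [show a + (m - a) = m by omega]; omega) hlvu.ge
      (fun _ => ⟨p b, hbP.2.2.2.1, hbP.2.2.2.2, fun t ht e => by
        have := hp.inj _ _ (by omega) (by omega) e; omega⟩)
    have ev : ∀ t, t ≤ m - a → Function.update (fun t => p (a + t)) (m - a + 1) u t = p (a + t) :=
      fun t ht => Function.update_of_ne (by omega) ..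
    have ea := ev 0 (by omega)
    have ej := ev (j - a) (by omega)
    rw [add_zero] at ea
    rw [show a + (j - a) = j by omega] at ej
    have hlva := haP.2.2.2.2
    have hlvj := hjI.2.2.2.2
    refine hext.false_of_adj_left hT.toIsLevelled (a := 0) (j := j - a) (b := m - a + 1) (by omega)
      (by omega) le_rfl (by omega) ?_ ?_ ?_ ?_
    · rw [Function.update_self, ea]; exact haP.2.2.2.1
    · rw [Function.update_self, ej]; exact hjI.2.2.2.1
    · rw [Function.update_self, ea]; omega
    · rw [Function.update_self, ej]; omega
  · have := hT.lv₁ _ h.1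
    omega

open Classical in
lemma snoc₁ (hT : IsTrilayer G k i lv N X₁ X₂ X₃ A B C D d s)
    (hp : IsTriPath G N X₁ X₂ X₃ B s p m 2) {v : V} (hm : (m + 1) % (2 * s) = 0) (hv : v ∈ X₁)
    (hadj : p m ∈ N v) (hnew : ∀ t ≤ m, p t ≠ v) :
    IsTriPath G N X₁ X₂ X₃ B s (Function.update p (m + 1) v) (m + 1) 2 := by
  have hm2 : (m + 1) % 2 = 0 := by
    have := Nat.mod_mod_of_dvd (m + 1) (Dvd.intro s rfl : 2 ∣ 2 * s)
    omega
  have hq := hp.snoc (c' := 1) (hT.adj _ _ hadj).symm hnew (by omega) (fun h => by omega)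
    (fun _ => hv) (fun _ h => (h hm).elim) (fun h => by omega) (fun t _ _ h => le_rfl)
    fun h => G.irrefl (hT.adj _ _ h)
  set q := Function.update p (m + 1) v with hqdef
  have hgood := hT.isGoodPath hq le_rfl
  refine ⟨hq.toIsPathFn, hq.mem₂, hq.mem₁, hq.mem₃, fun b hb hb2 => ?_⟩
  by_contra hcon
  have hs := hT.s_pos
  have hB := hT.B_ge
  set F := X₁.filter fun x => q b ∈ N x ∧ ∃ t' ≤ m + 1, q t' = x with hF
  let I := (Finset.range (m + 2)).filter fun t => q t ∈ F
  have hI : B - 1 ≤ I.card := by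
    refine (show B - 1 ≤ F.card by omega).trans ((Finset.card_le_card fun x hx => ?_).trans
      (Finset.card_image_le (s := I) (f := q)))
    obtain ⟨-, -, t, ht, rfl⟩ := Finset.mem_filter.1 hx
    exact Finset.mem_image.2 ⟨t, Finset.mem_filter.2 ⟨Finset.mem_range.2 (by omega), hx⟩, rfl⟩
  have hlvb := hT.lv₂ _ (hq.mem₂ b hb hb2)
  have hIprop : ∀ t ∈ I, t ≤ m + 1 ∧ t % 2 = 0 ∧ t % (2 * s) = 0 ∧ G.Adj (q b) (q t) ∧
      lv (q t) + 1 = i := by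
    intro t ht
    obtain ⟨h1, h2⟩ := Finset.mem_filter.1 ht
    obtain ⟨h3, h4, -⟩ := Finset.mem_filter.1 h2
    have h1 : t ≤ m + 1 := by have := Finset.mem_range.1 h1; omega
    have l1 := hT.lv₁ _ h3
    have e1 : t % 2 = 0 := by
      have := (hT.lv_tri hq h1).2
      omega
    refine ⟨h1, e1, ?_, (hT.adj _ _ h4).symm, l1⟩
    by_contra hne
    have := hT.lv₃ _ (hq.mem₃ t h1 e1 hne)
    omega
  have hlong : ∀ n, B - 1 ≤ 2 * n → ∀ a, 2 * s * n ≤ a + 2 * s → 2 * k ≤ a := by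
    intro n hn a ha
    have h1 := hT.sB
    have h2 : s * (B - 4) ≤ s * (2 * (n - 1)) := Nat.mul_le_mul_left _ (by omega)
    have h3 : 2 * s * n = s * (2 * (n - 1)) + 2 * s := by
      obtain ⟨e, rfl⟩ : ∃ e, n = e + 1 := ⟨n - 1, by omega⟩
      rw [Nat.add_sub_cancel]
      ring
    omega
  have hsplit := Finset.card_filter_add_card_filter_not (s := I) (fun t => t < b)
  by_cases hside : B - 1 ≤ 2 * (I.filter fun t => t < b).card
  · set J := I.filter fun t => t < b with hJ
    have hJp : ∀ t ∈ J, t ∈ I ∧ t < b := fun t ht => Finset.mem_filter.1 ht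
    have hJne : J.Nonempty := Finset.card_pos.1 (by omega)
    set a := J.min' hJne with ha
    have haJ : a ∈ J := J.min'_mem hJne
    have hc := mul_card_le_of_mod_eq (P := J) (q := 2 * s) (a := a) (b := b) (r := 0) (by omega)
      fun t ht => ⟨J.min'_le t ht, (hJp t ht).2.le, (hIprop t (hJp t ht).1).2.2.1⟩
    have := hlong _ hside _ hc
    obtain ⟨j, hj, hja, hjm⟩ : ∃ j ∈ J, j ≠ a ∧ j ≠ b - 1 := by
      by_contra hcon
      push Not at hcon
      have : J ⊆ {a, b - 1} := fun t ht => by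
        by_cases h : t = a
        · simp [h]
        · simp [hcon t ht h]
      have := (Finset.card_le_card this).trans Finset.card_le_two
      omega
    have haj : a < j := lt_of_le_of_ne (Finset.min'_le _ j hj) hja.symm
    have h1 := hIprop a (hJp a haJ).1
    have h2 := hIprop j (hJp j hj).1
    have h3 := (hJp j hj).2
    have h4 := h1.2.2.2.2
    have h5 := h2.2.2.2.2
    exact hgood.false_of_adj_left hT.toIsLevelled (a := a) (j := j) (b := b) haj (by omega) hb
      (by omega) h1.2.2.2.1 h2.2.2.2.1 (by omega) (by omega)
  · set J := I.filter fun t => ¬ t < b with hJ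
    have hJp : ∀ t ∈ J, t ∈ I ∧ b < t := fun t ht => by
      obtain ⟨h1, h2⟩ := Finset.mem_filter.1 ht
      have := (hIprop t h1).2.1
      exact ⟨h1, by omega⟩
    have hJne : J.Nonempty := Finset.card_pos.1 (by omega)
    set a := J.max' hJne with ha
    have haJ : a ∈ J := J.max'_mem hJne
    have hc := mul_card_le_of_mod_eq (P := J) (q := 2 * s) (a := b) (b := a) (r := 0) (by omega)
      fun t ht => ⟨(hJp t ht).2.le, J.le_max' t ht, (hIprop t (hJp t ht).1).2.2.1⟩
    have := hlong J.card (by omega) _ hc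
    obtain ⟨j, hj, hja, hjm⟩ : ∃ j ∈ J, j ≠ a ∧ j ≠ b + 1 := by
      by_contra hcon
      push Not at hcon
      have : J ⊆ {a, b + 1} := fun t ht => by
        by_cases h : t = a
        · simp [h]
        · simp [hcon t ht h]
      have := (Finset.card_le_card this).trans Finset.card_le_two
      omega
    have haj : j < a := lt_of_le_of_ne (Finset.le_max' _ j hj) hja
    have h1 := hIprop a (hJp a haJ).1
    have h2 := hIprop j (hJp j hj).1
    have h3 := (hJp j hj).2
    have h4 := h1.2.2.2.2
    have h5 := h2.2.2.2.2
    exact hgood.false_of_adj_right hT.toIsLevelled (a := b) (j := j) (b := a) (by omega) haj h1.1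
      (by omega) h1.2.2.2.1 h2.2.2.2.1 (by omega) (by omega)

end IsTrilayer

open Classical in
/-- Adds to `R` the vertices of `X₂` half of whose neighbours in `X₃` have half of their
neighbours in `R`. -/
noncomputable def trilayerGrow {V : Type*} (N : V → Finset V) (X₂ X₃ : Finset V) (C D : ℕ)
    (R : Finset V) : Finset V :=
  R ∪ X₂.filter fun u => C ≤ 2 * (X₃.filter fun w =>
    w ∈ N u ∧ D ≤ 2 * (R.filter fun u' => w ∈ N u').card).card

namespace IsTrilayer

variable {V : Type*} {G : SimpleGraph V} {lv : V → ℕ} {k i m : ℕ} {p : ℕ → V} {N : V → Finset V}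
  {X₁ X₂ X₃ : Finset V} {A B C D d s : ℕ}

open Classical in
lemma card_grow_le [Fintype V] (hT : IsTrilayer G k i lv N X₁ X₂ X₃ A B C D d s) {R : Finset V}
    (hR : R ⊆ X₂) : (trilayerGrow N X₂ X₃ C D R).card ≤ (k + 2) * R.card := by
  set W := X₃.filter fun w => D ≤ 2 * (R.filter fun u' => w ∈ N u').card with hW
  set Y := X₂.filter fun u => C ≤ 2 * (X₃.filter fun w =>
    w ∈ N u ∧ D ≤ 2 * (R.filter fun u' => w ∈ N u').card).card with hY
  have hYW : ∀ u, (X₃.filter fun w => w ∈ N u ∧ D ≤ 2 * (R.filter fun u' => w ∈ N u').card) =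
      W.filter fun w => w ∈ N u := by
    intro u
    ext w
    simp only [hW, Finset.mem_filter]
    tauto
  have h1 : W.card * D ≤ 2 * (d * R.card) := by
    calc W.card * D = ∑ w ∈ W, D := by simp
      _ ≤ ∑ w ∈ W, 2 * (R.filter fun u' => w ∈ N u').card :=
        Finset.sum_le_sum fun w hw => (Finset.mem_filter.1 hw).2
      _ = 2 * ∑ u ∈ R, (W.filter fun w => w ∈ N u).card := by
        rw [← Finset.mul_sum]
        congr 1
        exact (Finset.sum_card_bipartiteAbove_eq_sum_card_bipartiteBelow fun u w => w ∈ N u).symm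
      _ ≤ 2 * ∑ u ∈ R, d := by
        refine Nat.mul_le_mul_left _ (Finset.sum_le_sum fun u hu => ?_)
        refine le_trans (Finset.card_le_card fun w hw => ?_) (hT.card_le u (hR hu))
        exact (Finset.mem_filter.1 hw).2
      _ = _ := by simp [mul_comm]
  have h2 : Y.card * C ≤ 2 * ((k + 1) * (Y.card + W.card)) := by
    calc Y.card * C = ∑ u ∈ Y, C := by simp
      _ ≤ ∑ u ∈ Y, 2 * (W.filter fun w => w ∈ N u).card :=
        Finset.sum_le_sum fun w hw => by rw [← hYW]; exact (Finset.mem_filter.1 hw).2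
      _ ≤ 2 * ∑ u ∈ Y, (W.filter (G.Adj u)).card := by
        rw [← Finset.mul_sum]
        refine Nat.mul_le_mul_left _ (Finset.sum_le_sum fun u hu => Finset.card_le_card fun w hw => ?_)
        rw [Finset.mem_filter] at hw ⊢
        exact ⟨hw.1, hT.adj _ _ hw.2⟩
      _ ≤ _ := by
        refine Nat.mul_le_mul_left _ (hT.toIsLevelled.sum_card_le
          (fun u hu => hT.lv₂ u (Finset.mem_filter.1 hu).1) fun w hw => ?_)
        have := hT.lv₃ w (Finset.mem_filter.1 hw).1
        omega
  have hC := hT.C_ge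
  have hD := hT.D_ge
  have hd := hT.d_le
  have h3 : Y.card * C ≤ 4 * (k + 1) * W.card := by nlinarith
  have h4 : (C * D) * Y.card ≤ (C * D) * ((k + 1) * R.card) := by
    calc (C * D) * Y.card = D * (Y.card * C) := by ring
      _ ≤ D * (4 * (k + 1) * W.card) := Nat.mul_le_mul_left _ h3
      _ = 4 * (k + 1) * (W.card * D) := by ring
      _ ≤ 4 * (k + 1) * (2 * (d * R.card)) := Nat.mul_le_mul_left _ h1
      _ ≤ 4 * (k + 1) * (2 * (8 * C * R.card)) := by gcongr
      _ = (C * 64) * ((k + 1) * R.card) := by ring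
      _ ≤ _ := by gcongr
  have h5 : Y.card ≤ (k + 1) * R.card := Nat.le_of_mul_le_mul_left h4 (Nat.mul_pos (by omega) (by omega))
  have h6 : (trilayerGrow N X₂ X₃ C D R).card ≤ R.card + Y.card := Finset.card_union_le _ _
  nlinarith

open Classical in
/-- A path through the trilayer ending in the first layer can be prolonged. -/
lemma exists_longer [Fintype V] (hT : IsTrilayer G k i lv N X₁ X₂ X₃ A B C D d s) {l : ℕ}
    (hp : IsTriPath G N X₁ X₂ X₃ B s p (2 * s * l) 2) :
    ∃ p', IsTriPath G N X₁ X₂ X₃ B s p' (2 * s * (l + 1)) 2 := by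
  have hs := hT.s_pos
  have hsD := hT.s_le
  have hD := hT.D_ge
  have hCk := hT.C_ge
  set L := 2 * s * l with hL
  have hLmod : ∀ x, (L + x) % (2 * s) = x % (2 * s) := fun x => by rw [hL, Nat.mul_add_mod]
  have hL2 : L % 2 = 0 := by rw [hL, mul_assoc]; exact Nat.mul_mod_right _ _
  have hpL : p L ∈ X₁ := hp.mem₁ L le_rfl (by simpa using hLmod 0)
  let R₀ := ((Finset.range (L + 1)).filter fun t => L ≤ t + 2 * k ∧ t % 2 = 1).image p
  let R : ℕ → Finset V := fun n => (trilayerGrow N X₂ X₃ C D)^[n] R₀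
  have hRsucc : ∀ n, R (n + 1) = trilayerGrow N X₂ X₃ C D (R n) := fun n =>
    Function.iterate_succ_apply' _ _ _
  have hR₀ : R₀ ⊆ X₂ := by
    intro u hu
    obtain ⟨t, ht, rfl⟩ := Finset.mem_image.1 hu
    obtain ⟨h1, -, h3⟩ := Finset.mem_filter.1 ht
    exact hp.mem₂ t (by have := Finset.mem_range.1 h1; omega) h3
  have hRsub : ∀ n, R n ⊆ X₂ := by
    intro n
    induction n with
    | zero => exact hR₀
    | succ n ih => rw [hRsucc]; exact Finset.union_subset ih (Finset.filter_subset _ _)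
  have hR₀R : ∀ n, R₀ ⊆ R n := by
    intro n
    induction n with
    | zero => exact subset_rfl
    | succ n ih => rw [hRsucc]; exact ih.trans Finset.subset_union_left
  have hRcard : ∀ n, (R n).card ≤ (k + 2) ^ n * (2 * k + 1) := by
    intro n
    induction n with
    | zero =>
      have : (R 0).card ≤ (Finset.Icc (L - 2 * k) L).card := by
        refine Finset.card_image_le.trans (Finset.card_le_card fun t ht => ?_)
        obtain ⟨h1, h2, -⟩ := Finset.mem_filter.1 ht
        have := Finset.mem_range.1 h1
        exact Finset.mem_Icc.2 ⟨by omega, by omega⟩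
      rw [Nat.card_Icc] at this
      rw [pow_zero, one_mul]
      omega
    | succ n ih =>
      rw [hRsucc, pow_succ, mul_comm _ (k + 2), mul_assoc]
      exact (hT.card_grow_le (hRsub n)).trans (Nat.mul_le_mul_left _ ih)
  have main : ∀ q, q < s → ∃ p', IsTriPath G N X₁ X₂ X₃ B s p' (L + 2 * q + 1) 2 ∧
      (∀ t ≤ L, p' t = p t) ∧ p' (L + 2 * q + 1) ∉ R (s - 1 - q) := by
    intro q
    induction q with
    | zero =>
      intro _
      have hgood := hT.isGoodPath hp (by omega)
      have hon := hgood.card_le_of_adj_last hT.toIsLevelled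
        ((X₂.filter fun u => u ∈ N (p L)).filter fun u => ∃ t ≤ L, p t = u) fun w hw => by
          obtain ⟨h1, h2⟩ := Finset.mem_filter.1 hw
          obtain ⟨h1, h3⟩ := Finset.mem_filter.1 h1
          have := hT.lv₁ _ hpL
          have := hT.lv₂ _ h1
          exact ⟨hT.adj _ _ h3, by omega, h2⟩
      have hA := hT.deg₁₂ _ hpL
      have hA' := hT.A_gt
      have hRs := hRcard (s - 1)
      have hRs' : (k + 2) ^ (s - 1) * (2 * k + 1) ≤ (k + 2) ^ s * (2 * k + 1) :=
        Nat.mul_le_mul_right _ (Nat.pow_le_pow_right (by omega) (by omega))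
      obtain ⟨u, hu, hu1, hu2⟩ : ∃ u ∈ X₂.filter fun u => u ∈ N (p L),
          u ∉ R (s - 1) ∧ ¬ ∃ t ≤ L, p t = u := by
        by_contra hcon
        push Not at hcon
        have hsub : (X₂.filter fun u => u ∈ N (p L)) ⊆ R (s - 1) ∪
            ((X₂.filter fun u => u ∈ N (p L)).filter fun u => ∃ t ≤ L, p t = u) := by
          intro u hu
          by_cases h : u ∈ R (s - 1)
          · exact Finset.mem_union_left _ h
          · exact Finset.mem_union_right _ (Finset.mem_filter.2 ⟨hu, hcon u hu h⟩)
        have := (Finset.card_le_card hsub).trans (Finset.card_union_le _ _)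
        omega
      obtain ⟨hu3, hu4⟩ := Finset.mem_filter.1 hu
      push Not at hu2
      refine ⟨Function.update p (L + 1) u, hT.snoc₂ hp hL2 hu3 (hT.adj _ _ hu4) hu2, fun t ht =>
        Function.update_of_ne (by omega) .., ?_⟩
      rw [mul_zero, add_zero, Function.update_self, Nat.sub_zero]
      exact hu1
    | succ q ih =>
      intro hq
      obtain ⟨p', hp', hagree, hnot⟩ := ih (by omega)
      set M := L + 2 * q + 1 with hM
      have hgood := hT.isGoodPath hp' (by omega)
      have hu2 : p' M ∈ X₂ := hp'.mem₂ M le_rfl (by omega)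
      have hlvu := hT.lv₂ _ hu2
      -- the next vertex of the third layer
      have hon := hgood.card_le_of_adj_last hT.toIsLevelled
        ((X₃.filter fun w => w ∈ N (p' M)).filter fun w => ∃ t ≤ M, p' t = w) fun w hw => by
          obtain ⟨h1, h2⟩ := Finset.mem_filter.1 hw
          obtain ⟨h1, h3⟩ := Finset.mem_filter.1 h1
          have := hT.lv₃ _ h1
          exact ⟨hT.adj _ _ h3, by omega, h2⟩
      have hC := hT.deg₂₃ _ hu2
      set r := s - 1 - (q + 1) with hr
      have hbad : 2 * (X₃.filter fun w => w ∈ N (p' M) ∧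
          D ≤ 2 * ((R r).filter fun u' => w ∈ N u').card).card < C := by
        rw [show s - 1 - q = r + 1 by omega, hRsucc] at hnot
        by_contra hcon
        exact hnot (Finset.mem_union_right _ (Finset.mem_filter.2 ⟨hu2, by omega⟩))
      obtain ⟨w, hw, hw1, hw2⟩ : ∃ w ∈ X₃.filter fun w => w ∈ N (p' M),
          2 * ((R r).filter fun u' => w ∈ N u').card < D ∧ ¬ ∃ t ≤ M, p' t = w := by
        by_contra hcon
        push Not at hcon
        have hsub : (X₃.filter fun w => w ∈ N (p' M)) ⊆ (X₃.filter fun w => w ∈ N (p' M) ∧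
            D ≤ 2 * ((R r).filter fun u' => w ∈ N u').card) ∪
            ((X₃.filter fun w => w ∈ N (p' M)).filter fun w => ∃ t ≤ M, p' t = w) := by
          intro w hw
          by_cases h : D ≤ 2 * ((R r).filter fun u' => w ∈ N u').card
          · obtain ⟨h1, h2⟩ := Finset.mem_filter.1 hw
            exact Finset.mem_union_left _ (Finset.mem_filter.2 ⟨h1, h2, h⟩)
          · exact Finset.mem_union_right _ (Finset.mem_filter.2 ⟨hw, hcon w hw (by omega)⟩)
        have := (Finset.card_le_card hsub).trans (Finset.card_union_le _ _)
        omega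
      obtain ⟨hw3, hw4⟩ := Finset.mem_filter.1 hw
      push Not at hw2
      have hmod : (M + 1) % (2 * s) ≠ 0 := by
        rw [show M + 1 = L + (2 * q + 2) by omega, hLmod, Nat.mod_eq_of_lt (by omega)]
        omega
      have hp2 := hT.snoc₃ hp' (by omega) hmod hw3 hw4 hw2
      set p'' := Function.update p' (M + 1) w with hp''
      have e1 : p'' (M + 1) = w := Function.update_self ..
      have e2 : ∀ t ≤ M, p'' t = p' t := fun t ht => Function.update_of_ne (by omega) ..
      have hgood2 := hT.isGoodPath hp2 (by omega)
      have hlvw := hT.lv₃ _ hw3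
      -- the next vertex of the second layer
      have hDw := hT.deg₃₂ _ hw3
      obtain ⟨u, hu, hu1, hu2⟩ : ∃ u ∈ X₂.filter fun u => w ∈ N u,
          u ∉ R r ∧ ¬ ∃ t ≤ M + 1, p'' t = u := by
        by_contra hcon
        push Not at hcon
        set Z := ((X₂.filter fun u => w ∈ N u).filter fun u => u ∉ R r) with hZ
        have hZp : ∀ u ∈ Z, u ∈ X₂ ∧ w ∈ N u ∧ u ∉ R r ∧ ∃ t ≤ M + 1, p'' t = u := by
          intro u hu
          obtain ⟨h1, h2⟩ := Finset.mem_filter.1 hu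
          obtain ⟨h3, h4⟩ := Finset.mem_filter.1 h1
          exact ⟨h3, h4, h2, hcon u h1 h2⟩
        have hZcard : D < 2 * Z.card := by
          have h1 : ((X₂.filter fun u => w ∈ N u).filter fun u => u ∈ R r).card + Z.card =
              (X₂.filter fun u => w ∈ N u).card := by
            rw [hZ]
            convert Finset.card_filter_add_card_filter_not (s := X₂.filter fun u => w ∈ N u)
              (fun u => u ∈ R r)
          have h2 : ((X₂.filter fun u => w ∈ N u).filter fun u => u ∈ R r).card ≤
              ((R r).filter fun u' => w ∈ N u').card := by
            refine Finset.card_le_card fun u hu => ?_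
            obtain ⟨h1, h2⟩ := Finset.mem_filter.1 hu
            exact Finset.mem_filter.2 ⟨h2, (Finset.mem_filter.1 h1).2⟩
          omega
        by_cases hfar : ∃ a, a + 2 * k ≤ M + 2 ∧ p'' a ∈ Z
        · obtain ⟨a, ha, haZ⟩ := hfar
          obtain ⟨ha1, ha2, -⟩ := hZp _ haZ
          have hlva := hT.lv₂ _ ha1
          have : Z ⊆ {p'' a, p'' M} := by
            intro u hu
            obtain ⟨hu1, hu2, -, t, ht, rfl⟩ := hZp u hu
            have hlvt := hT.lv₂ _ hu1
            have := hgood2.eq_or_eq_of_far hT.toIsLevelled (a := a) (j := t) ha ht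
              (by rw [e1]; exact (hT.adj _ _ ha2).symm) (by rw [e1]; exact (hT.adj _ _ hu2).symm)
              (by rw [e1]; omega) (by rw [e1]; omega)
            rcases this with rfl | h
            · simp
            · rw [show t = M by omega]; simp
          have := (Finset.card_le_card this).trans Finset.card_le_two
          omega
        · push Not at hfar
          have : Z ⊆ (Finset.range (q + 1)).image fun t => p'' (L + 2 * t + 1) := by
            intro u hu
            obtain ⟨hu1, hu2, hu3, t, ht, rfl⟩ := hZp u hu
            have hlvt := (hT.lv_tri hp2 ht).2.1 (hT.lv₂ _ hu1)
            have hnear : ¬ t + 2 * k ≤ M + 2 := fun h => hfar t h hu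
            by_cases htL : t ≤ L
            · refine absurd (hR₀R r (Finset.mem_image.2 ⟨t, ?_, ?_⟩)) hu3
              · exact Finset.mem_filter.2 ⟨Finset.mem_range.2 (by omega), by omega, hlvt⟩
              · rw [e2 t (by omega), hagree t htL]
            · refine Finset.mem_image.2 ⟨(t - L) / 2, Finset.mem_range.2 (by omega), ?_⟩
              rw [show L + 2 * ((t - L) / 2) + 1 = t by omega]
          have := (Finset.card_le_card this).trans Finset.card_image_le
          rw [Finset.card_range] at this
          omega
      obtain ⟨hu3, hu4⟩ := Finset.mem_filter.1 hu
      push Not at hu2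
      have hp3 := hT.snoc₂ hp2 (by omega) hu3 (by rw [e1]; exact (hT.adj _ _ hu4).symm) hu2
      refine ⟨Function.update p'' (M + 1 + 1) u, hp3, fun t ht => ?_, ?_⟩
      · rw [Function.update_of_ne (by omega), e2 t (by omega), hagree t ht]
      · rw [show L + 2 * (q + 1) + 1 = M + 1 + 1 by omega, Function.update_self]
        exact hu1
  obtain ⟨p', hp', -, -⟩ := main (s - 1) (by omega)
  set M := L + 2 * (s - 1) + 1 with hM
  have hM2 : 2 * s * (l + 1) = M + 1 := by rw [mul_add, mul_one, ← hL]; omega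
  have hu2 := hp'.mem₂ M le_rfl (by omega)
  have h1 := hT.deg₂₁ _ hu2
  have h2 := hp'.few M le_rfl (by omega)
  obtain ⟨v, hv, hv1, hv2⟩ : ∃ v ∈ X₁, p' M ∈ N v ∧ ¬ ∃ t ≤ M, p' t = v := by
    by_contra hcon
    push Not at hcon
    have := Finset.card_le_card (?_ : (X₁.filter fun v => p' M ∈ N v) ⊆
      X₁.filter fun v => p' M ∈ N v ∧ ∃ t' ≤ M, p' t' = v)
    · omega
    · intro v hv
      rw [Finset.mem_filter] at hv ⊢
      exact ⟨hv.1, hv.2, hcon v hv.1 hv.2⟩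
  push Not at hv2
  rw [hM2]
  exact ⟨_, hT.snoc₁ hp' (by rw [← hM2]; exact Nat.mul_mod_right _ _) hv hv1 hv2⟩

lemma isEmpty₁ [Fintype V] (hT : IsTrilayer G k i lv N X₁ X₂ X₃ A B C D d s) : X₁ = ∅ := by
  by_contra hne
  obtain ⟨v, hv⟩ := Finset.nonempty_iff_ne_empty.2 hne
  have hs := hT.s_pos
  have key : ∀ l, ∃ p, IsTriPath G N X₁ X₂ X₃ B s p (2 * s * l) 2 := by
    intro l
    induction l with
    | zero =>
      refine ⟨fun _ => v, ⟨fun t ht => by omega, fun s t hs ht _ => by omega⟩, fun t ht h => ?_,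
        fun _ _ _ => hv, fun t ht h h' => ?_, fun t ht h => ?_⟩
      · omega
      · obtain rfl : t = 0 := by omega
        simp at h'
      · omega
    | succ l ih =>
      obtain ⟨p, hp⟩ := ih
      exact hT.exists_longer hp
  obtain ⟨p, hp⟩ := key (Fintype.card V)
  have h1 := (hT.isGoodPath hp (by omega)).lt_card
  have h2 : Fintype.card V ≤ 2 * s * Fintype.card V := Nat.le_mul_of_pos_left _ (by omega)
  omega

end IsTrilayer

open Classical in
/-- Cleaning of a three-layered relation. -/
lemma exists_clean_trilayer {V : Type*} (N : V → Finset V) (δ : V → ℕ) (A B C D d : ℕ)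
    (X₁ X₂ X₃ : Finset V) (hd : ∀ u ∈ X₂, (N u).card ≤ d) (hB : ∀ u ∈ X₂, B ≤ δ u)
    (hδ : ∀ u ∈ X₂, (X₁.filter fun v => u ∈ N v).card ≤ δ u)
    (h : C * X₂.card + d * ∑ u ∈ X₂, δ u + A * d * X₁.card + D * X₃.card <
      d * ∑ u ∈ X₂, (X₁.filter fun v => u ∈ N v).card +
        ∑ u ∈ X₂, (X₃.filter fun w => w ∈ N u).card) :
    ∃ Y₁ ⊆ X₁, ∃ Y₂ ⊆ X₂, ∃ Y₃ ⊆ X₃, Y₂.Nonempty ∧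
      (∀ v ∈ Y₁, A ≤ (Y₂.filter fun u => u ∈ N v).card) ∧
      (∀ u ∈ Y₂, B ≤ (Y₁.filter fun v => u ∈ N v).card) ∧
      (∀ u ∈ Y₂, C ≤ (Y₃.filter fun w => w ∈ N u).card) ∧
      (∀ w ∈ Y₃, D ≤ (Y₂.filter fun u => w ∈ N u).card) := by
  induction hn : X₁.card + X₂.card + X₃.card generalizing X₁ X₂ X₃ with
  | zero =>
    obtain rfl : X₂ = ∅ := by rw [← Finset.card_eq_zero]; omega
    simp at h
  | succ n ih =>
    have e1 : ∀ X₁ : Finset V, ∑ u ∈ X₂, (X₁.filter fun v => u ∈ N v).card =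
        ∑ v ∈ X₁, (X₂.filter fun u => u ∈ N v).card := fun X₁ =>
      (Finset.sum_card_bipartiteAbove_eq_sum_card_bipartiteBelow fun v u => u ∈ N v).symm
    have e3 : ∀ X₃ : Finset V, ∑ u ∈ X₂, (X₃.filter fun w => w ∈ N u).card =
        ∑ w ∈ X₃, (X₂.filter fun u => w ∈ N u).card := fun X₃ =>
      Finset.sum_card_bipartiteAbove_eq_sum_card_bipartiteBelow fun u w => w ∈ N u
    by_cases h1 : ∃ v ∈ X₁, (X₂.filter fun u => u ∈ N v).card < A
    · obtain ⟨v, hv, hlt⟩ := h1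
      have c := Finset.card_erase_add_one hv
      have c2 := Finset.add_sum_erase X₁ (fun v => (X₂.filter fun u => u ∈ N v).card) hv
      obtain ⟨Y₁, s1, Y₂, s2, Y₃, s3, H⟩ := ih (X₁.erase v) X₂ X₃ hd hB
        (fun u hu => le_trans (Finset.card_le_card (Finset.filter_subset_filter _
          (Finset.erase_subset _ _))) (hδ u hu)) (by
            rw [e1] at h ⊢
            rw [← c2, ← c] at h
            have := Nat.mul_le_mul_left d hlt.le
            have := mul_comm A d
            simp only [mul_add, mul_one] at h
            omega) (by omega)
      exact ⟨Y₁, s1.trans (Finset.erase_subset _ _), Y₂, s2, Y₃, s3, H⟩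
    by_cases h2 : ∃ u ∈ X₂, (X₁.filter fun v => u ∈ N v).card < δ u ∨
        (X₃.filter fun w => w ∈ N u).card < C
    · obtain ⟨u, hu, hlt⟩ := h2
      have c := Finset.card_erase_add_one hu
      have c1 := Finset.add_sum_erase X₂ (fun u => (X₁.filter fun v => u ∈ N v).card) hu
      have c2 := Finset.add_sum_erase X₂ (fun u => (X₃.filter fun w => w ∈ N u).card) hu
      have c3 := Finset.add_sum_erase X₂ δ hu
      have hn3 : (X₃.filter fun w => w ∈ N u).card ≤ d :=
        le_trans (Finset.card_le_card fun w hw => (Finset.mem_filter.1 hw).2) (hd u hu)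
      have key : d * (X₁.filter fun v => u ∈ N v).card + (X₃.filter fun w => w ∈ N u).card ≤
          C + d * δ u := by
        rcases hlt with hlt | hlt
        · have := Nat.mul_le_mul_left d hlt
          rw [Nat.mul_succ] at this
          omega
        · have := Nat.mul_le_mul_left d (hδ u hu)
          omega
      have sub := Finset.erase_subset u X₂
      obtain ⟨Y₁, s1, Y₂, s2, Y₃, s3, H⟩ := ih X₁ (X₂.erase u) X₃ (fun u hu => hd u (sub hu))
        (fun u hu => hB u (sub hu)) (fun u hu => hδ u (sub hu)) (by
          rw [← c1, ← c2, ← c3, ← c] at h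
          simp only [mul_add, mul_one] at h
          omega) (by omega)
      exact ⟨Y₁, s1, Y₂, s2.trans sub, Y₃, s3, H⟩
    by_cases h3 : ∃ w ∈ X₃, (X₂.filter fun u => w ∈ N u).card < D
    · obtain ⟨w, hw, hlt⟩ := h3
      have c := Finset.card_erase_add_one hw
      have c2 := Finset.add_sum_erase X₃ (fun w => (X₂.filter fun u => w ∈ N u).card) hw
      obtain ⟨Y₁, s1, Y₂, s2, Y₃, s3, H⟩ := ih X₁ X₂ (X₃.erase w) hd hB hδ (by
        rw [e3] at h ⊢
        rw [← c2, ← c] at h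
        rw [mul_add, mul_one] at h
        omega) (by omega)
      exact ⟨Y₁, s1, Y₂, s2, Y₃, s3.trans (Finset.erase_subset _ _), H⟩
    push Not at h1 h2 h3
    refine ⟨X₁, subset_rfl, X₂, subset_rfl, X₃, subset_rfl, ?_, h1,
      fun u hu => (hB u hu).trans (h2 u hu).1, fun u hu => (h2 u hu).2, h3⟩
    rw [Finset.nonempty_iff_ne_empty]
    rintro rfl
    simp at h

open Classical in
/-- Upper bound for the number of edges between the second and the third layer, where each vertex
of the second layer has many neighbours in the first. -/
lemma IsLevelled.sum_card_le_of_trilayer {V : Type*} [Fintype V] {G : SimpleGraph V}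
    {k i : ℕ} {lv : V → ℕ} (hG : IsLevelled G k i lv) {N : V → Finset V} {X₁ X₂ X₃ : Finset V}
    {A B C D d s : ℕ} (adj : ∀ v, ∀ u ∈ N v, G.Adj v u) (lv₁ : ∀ v ∈ X₁, lv v + 1 = i)
    (lv₂ : ∀ v ∈ X₂, lv v = i) (lv₃ : ∀ v ∈ X₃, lv v = i + 1)
    (hB : ∀ u ∈ X₂, B ≤ (X₁.filter fun v => u ∈ N v).card) (card_le : ∀ u ∈ X₂, (N u).card ≤ d)
    (s_pos : 1 ≤ s) (s_le : 4 * s ≤ D) (D_ge : 64 ≤ D) (B_ge : 10 ≤ B)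
    (sB : 2 * k ≤ s * (B - 4)) (C_ge : 4 * (k + 1) ≤ C) (d_le : d ≤ 8 * C)
    (A_gt : (k + 2) ^ s * (2 * k + 1) + k < A) :
    ∑ u ∈ X₂, (X₃.filter fun w => w ∈ N u).card ≤
      C * X₂.card + A * d * X₁.card + D * X₃.card := by
  by_contra hcon
  obtain ⟨Y₁, s1, Y₂, s2, Y₃, s3, ⟨u, hu⟩, h12, h21, h23, h32⟩ := exists_clean_trilayer N
    (fun u => (X₁.filter fun v => u ∈ N v).card) A B C D d X₁ X₂ X₃ card_le hB (fun _ _ => le_rfl)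
    (by omega)
  have hT : IsTrilayer G k i lv N Y₁ Y₂ Y₃ A B C D d s :=
    ⟨hG, adj, fun v hv => lv₁ v (s1 hv), fun v hv => lv₂ v (s2 hv), fun v hv => lv₃ v (s3 hv),
      h12, h21, h23, h32, fun u hu => card_le u (s2 hu), s_pos, s_le, D_ge, B_ge, sB, C_ge, d_le,
      A_gt⟩
  have := h21 u hu
  rw [hT.isEmpty₁] at this
  simp at this
  omega

open Classical in
/-- The set of vertices of level `i`. -/
noncomputable def layer {V : Type*} [Fintype V] (lv : V → ℕ) (i : ℕ) : Finset V :=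
  Finset.univ.filter fun v => lv v = i

lemma mem_layer {V : Type*} [Fintype V] {lv : V → ℕ} {i : ℕ} {v : V} :
    v ∈ layer lv i ↔ lv v = i := by
  simp [layer]

open Classical in
/-- A trimmed breadth first search which has reached level `j`. Unexplored vertices have
level `k + 1`. -/
structure IsExploration {V : Type*} [Fintype V] (G : SimpleGraph V) (k d j : ℕ) (lv : V → ℕ)
    (N : V → Finset V) : Prop where
  root : ∃ x, (∃ y, G.Adj x y) ∧ ∀ v, lv v = 0 ↔ v = x
  range : ∀ v, lv v ≤ j ∨ lv v = k + 1
  N_spec : ∀ v, ∀ u ∈ N v, G.Adj v u ∧ lv u = lv v + 1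
  N_card : ∀ v, (N v).card ≤ d
  cover : ∀ u, 0 < lv u → lv u ≤ j → ∃ v, u ∈ N v
  N_sum : ∀ i < j, d * (layer lv i).card ≤
    ∑ v ∈ layer lv i, (N v).card + (2 * k + 2) * (layer lv i).card
  low : ∀ v, lv v ≤ j → (Finset.univ.filter fun u => G.Adj v u ∧ lv u < lv v).card ≤ d

namespace IsExploration

variable {V : Type*} [Fintype V] {G : SimpleGraph V} {k d j : ℕ} {lv : V → ℕ} {N : V → Finset V}

lemma isLevelled (hE : IsExploration G k d j lv N) (hG : CycleFree (2 * k) G) {i : ℕ} (hi : 1 ≤ i)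
    (hik : i < k) (hij : i ≤ j) : IsLevelled G k i lv where
  free := hG
  root u v hu hv := by
    obtain ⟨x, -, hx⟩ := hE.root
    rw [(hx u).1 hu, (hx v).1 hv]
  par v h1 h2 := by
    obtain ⟨u, hu⟩ := hE.cover v h1 (by omega)
    obtain ⟨h3, h4⟩ := hE.N_spec u v hu
    exact ⟨u, h3.symm, h4.symm⟩
  pos := hi
  lt := hik

open Classical in
lemma sum_card_le (hE : IsExploration G k d j lv N) (hG : CycleFree (2 * k) G) {i : ℕ}
    (hik : i < k) (hij : i ≤ j) {S T : Finset V} (hS : ∀ v ∈ S, lv v = i)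
    (hT : ∀ v ∈ T, i < lv v) :
    ∑ s ∈ S, (T.filter (G.Adj s)).card ≤ (k + 1) * (S.card + T.card) := by
  rcases Nat.eq_zero_or_pos i with rfl | hi
  · obtain ⟨x, -, hx⟩ := hE.root
    have hSx : S ⊆ {x} := fun v hv => by rw [Finset.mem_singleton, ← hx]; exact hS v hv
    calc ∑ s ∈ S, (T.filter (G.Adj s)).card ≤ ∑ s ∈ ({x} : Finset V), (T.filter (G.Adj s)).card :=
        Finset.sum_le_sum_of_subset hSx
      _ = (T.filter (G.Adj x)).card := by simp
      _ ≤ T.card := Finset.card_filter_le _ _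
      _ ≤ 1 * (S.card + T.card) := by omega
      _ ≤ _ := Nat.mul_le_mul_right _ (by omega)
  · exact (hE.isLevelled hG hi hik hij).sum_card_le hS hT

open Classical in
lemma sum_N_le (hE : IsExploration G k d j lv N) (hG : CycleFree (2 * k) G) {i : ℕ} (hik : i < k)
    (hij : i < j) {S : Finset V} (hS : ∀ v ∈ S, lv v = i) :
    ∑ s ∈ S, (N s).card ≤ (k + 1) * (S.card + (layer lv (i + 1)).card) := by
  refine le_trans (Finset.sum_le_sum fun v hv => Finset.card_le_card fun u hu => ?_)
    (hE.sum_card_le hG hik hij.le hS (T := layer lv (i + 1)) fun v hv => ?_)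
  · obtain ⟨h1, h2⟩ := hE.N_spec v u hu
    rw [Finset.mem_filter, mem_layer, h2, hS v hv]
    exact ⟨rfl, h1⟩
  · rw [mem_layer.1 hv]; omega

lemma growth (hE : IsExploration G k d j lv N) (hG : CycleFree (2 * k) G) {i : ℕ} (hik : i < k)
    (hij : i < j) : d * (layer lv i).card ≤
      (3 * k + 3) * (layer lv i).card + (k + 1) * (layer lv (i + 1)).card := by
  have h1 := hE.N_sum i hij
  have h2 := hE.sum_N_le hG hik hij (S := layer lv i) fun v hv => mem_layer.1 hv
  nlinarith

lemma card_layer_le_succ (hE : IsExploration G k d j lv N) (hG : CycleFree (2 * k) G)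
    (hd : 4 * k + 4 ≤ d) {i : ℕ} (hik : i < k) (hij : i < j) :
    (layer lv i).card ≤ (layer lv (i + 1)).card := by
  have h1 := hE.growth hG hik hij
  have h2 := Nat.mul_le_mul_right (layer lv i).card hd
  have h3 : (k + 1) * (layer lv i).card ≤ (k + 1) * (layer lv (i + 1)).card := by nlinarith
  exact Nat.le_of_mul_le_mul_left h3 (by omega)

lemma card_layer_le (hE : IsExploration G k d j lv N) (hG : CycleFree (2 * k) G)
    (hd : 4 * k + 4 ≤ d) (hjk : j ≤ k) {i : ℕ} (hij : i ≤ j) :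
    (layer lv i).card ≤ (layer lv j).card := by
  induction h : j - i generalizing i with
  | zero => rw [show i = j by omega]
  | succ n ih =>
    exact (hE.card_layer_le_succ hG hd (by omega) (by omega)).trans
      (ih (i := i + 1) (by omega) (by omega))

lemma color (hE : IsExploration G k d j lv N) {f : V → Prop} (hf : ∀ u v, G.Adj u v → (f u ↔ ¬ f v)) :
    ∀ i ≤ j, ∀ u v, lv u = i → lv v = i → (f u ↔ f v) := by
  intro i
  induction i with
  | zero =>
    intro _ u v hu hv
    obtain ⟨x, -, hx⟩ := hE.root
    rw [(hx u).1 hu, (hx v).1 hv]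
  | succ i ih =>
    intro hi u v hu hv
    obtain ⟨u', hu'⟩ := hE.cover u (by omega) (by omega)
    obtain ⟨v', hv'⟩ := hE.cover v (by omega) (by omega)
    obtain ⟨h1, h2⟩ := hE.N_spec _ _ hu'
    obtain ⟨h3, h4⟩ := hE.N_spec _ _ hv'
    have := hf _ _ h1
    have := hf _ _ h3
    have := ih (by omega) u' v' (by omega) (by omega)
    tauto

open Classical in
lemma step (hE : IsExploration G k d j lv N) (hG : CycleFree (2 * k) G) (hjk : j < k)
    (hd : 2 * k * (k + 1) ≤ d) (hd' : 4 * k + 4 ≤ d) {f : V → Prop}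
    (hf : ∀ u v, G.Adj u v → (f u ↔ ¬ f v))
    (hdeg : ∀ v, lv v = j → 2 * d ≤ (Finset.univ.filter (G.Adj v)).card) :
    ∃ lv' N', IsExploration G k d (j + 1) lv' N' := by
  set S := Finset.univ.filter fun u => lv u = k + 1 ∧
    d < (Finset.univ.filter fun v => G.Adj v u ∧ lv v ≤ j).card with hS
  have hSm : ∀ u, u ∈ S ↔ lv u = k + 1 ∧
    d < (Finset.univ.filter fun v => G.Adj v u ∧ lv v ≤ j).card := fun u => by simp [hS]
  -- the size of `S`
  have hScard : S.card ≤ (layer lv j).card := by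
    have h1 : d * S.card ≤ ∑ u ∈ S, (Finset.univ.filter fun v => G.Adj v u ∧ lv v ≤ j).card := by
      calc d * S.card = ∑ u ∈ S, d := by simp [mul_comm]
        _ ≤ _ := Finset.sum_le_sum fun u hu => ((hSm u).1 hu).2.le
    have h2 : ∀ u, (Finset.univ.filter fun v => G.Adj v u ∧ lv v ≤ j).card =
        ∑ i ∈ Finset.range (j + 1), ((layer lv i).filter fun v => G.Adj v u).card := by
      intro u
      rw [Finset.card_eq_sum_card_fiberwise (f := lv) (t := Finset.range (j + 1))]
      · refine Finset.sum_congr rfl fun i hi => ?_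
        congr 1
        ext v
        have := Finset.mem_range.1 hi
        simp only [Finset.mem_filter, Finset.mem_univ, true_and, mem_layer]
        constructor
        · rintro ⟨⟨a, b⟩, c⟩; exact ⟨c, a⟩
        · rintro ⟨c, a⟩; exact ⟨⟨a, by omega⟩, c⟩
      · intro v hv
        have := (Finset.mem_filter.1 hv).2.2
        simp only [Finset.coe_range, Set.mem_Iio]
        omega
    have h3 : ∑ u ∈ S, (Finset.univ.filter fun v => G.Adj v u ∧ lv v ≤ j).card ≤
        k * ((k + 1) * ((layer lv j).card + S.card)) := by
      simp only [h2]
      rw [Finset.sum_comm]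
      calc _ ≤ ∑ i ∈ Finset.range (j + 1), (k + 1) * ((layer lv j).card + S.card) := by
            refine Finset.sum_le_sum fun i hi => ?_
            have hi := Finset.mem_range.1 hi
            have e := Finset.sum_card_bipartiteAbove_eq_sum_card_bipartiteBelow (s := layer lv i)
              (t := S) G.Adj
            have h4 := hE.sum_card_le hG (i := i) (by omega) (by omega) (S := layer lv i) (T := S)
              (fun v hv => mem_layer.1 hv) fun v hv => by rw [((hSm v).1 hv).1]; omega
            have h5 := hE.card_layer_le hG hd' hjk.le (i := i) (by omega)
            refine e.symm.le.trans (h4.trans (Nat.mul_le_mul_left _ (by omega)))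
        _ = (j + 1) * ((k + 1) * ((layer lv j).card + S.card)) := by simp
        _ ≤ _ := Nat.mul_le_mul_right _ (by omega)
    have h4 : k * (k + 1) * S.card ≤ k * (k + 1) * (layer lv j).card := by nlinarith
    exact Nat.le_of_mul_le_mul_left h4 (Nat.mul_pos (by omega) (by omega))
  have hN : ∀ v, ∃ W ⊆ Finset.univ.filter (fun u => lv u = k + 1 ∧ G.Adj v u ∧ u ∉ S),
      W.card = min d (Finset.univ.filter (fun u => lv u = k + 1 ∧ G.Adj v u ∧ u ∉ S)).card :=
    fun v => Finset.exists_subset_card_eq (min_le_right _ _)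
  choose N₁ hN₁ hN₁c using hN
  have hN₁m : ∀ v, ∀ u ∈ N₁ v, lv u = k + 1 ∧ G.Adj v u ∧ u ∉ S := fun v u hu => by
    simpa using hN₁ v hu
  let N' : V → Finset V := fun v => if lv v = j then N₁ v else N v
  have hN'1 : ∀ v, lv v = j → N' v = N₁ v := fun v h => if_pos h
  have hN'2 : ∀ v, lv v ≠ j → N' v = N v := fun v h => if_neg h
  let lv' : V → ℕ := fun u => if lv u = k + 1 ∧ ∃ v, lv v = j ∧ u ∈ N₁ v then j + 1 else lv u
  have hlv1 : ∀ u v, lv v = j → u ∈ N₁ v → lv' u = j + 1 := fun u v hv hu =>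
    if_pos ⟨(hN₁m v u hu).1, v, hv, hu⟩
  have hlv2 : ∀ u, lv u ≤ j → lv' u = lv u := fun u hu => if_neg (by rintro ⟨h, -⟩; omega)
  have hlv3 : ∀ u, lv' u = lv u ∨ (lv' u = j + 1 ∧ lv u = k + 1 ∧ ∃ v, lv v = j ∧ u ∈ N₁ v) := by
    intro u
    by_cases h : lv u = k + 1 ∧ ∃ v, lv v = j ∧ u ∈ N₁ v
    · exact Or.inr ⟨if_pos h, h⟩
    · exact Or.inl (if_neg h)
  have hlv4 : ∀ u, lv' u ≤ j → lv u = lv' u := fun u hu => by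
    rcases hlv3 u with h | ⟨h, -⟩
    · exact h.symm
    · omega
  have hlay : ∀ i ≤ j, layer lv' i = layer lv i := by
    intro i hi
    ext v
    rw [mem_layer, mem_layer]
    constructor
    · intro h; rw [hlv4 v (by omega), h]
    · intro h; rw [hlv2 v (by omega), h]
  refine ⟨lv', N', ?_, fun v => ?_, fun v u hu => ?_, fun v => ?_, fun u h1 h2 => ?_,
    fun i hi => ?_, fun v hv => ?_⟩
  · obtain ⟨x, hy, hx⟩ := hE.root
    refine ⟨x, hy, fun v => ?_⟩
    rw [← hx]
    exact ⟨fun h => by rw [hlv4 v (by omega), h], fun h => by rw [hlv2 v (by omega), h]⟩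
  · rcases hlv3 v with h | ⟨h, -⟩
    · have := hE.range v
      omega
    · omega
  · by_cases hv : lv v = j
    · rw [hN'1 v hv] at hu
      exact ⟨(hN₁m v u hu).2.1, by rw [hlv1 u v hv hu, hlv2 v hv.le, hv]⟩
    · rw [hN'2 v hv] at hu
      obtain ⟨h1, h2⟩ := hE.N_spec v u hu
      have h3 := hE.range u
      have h4 := hE.range v
      exact ⟨h1, by rw [hlv2 u (by omega), hlv2 v (by omega), h2]⟩
  · by_cases hv : lv v = j
    · rw [hN'1 v hv, hN₁c]; exact min_le_left _ _
    · rw [hN'2 v hv]; exact hE.N_card v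
  · rcases hlv3 u with h | ⟨h, -, v, hv, hu⟩
    · have h3 := hE.range u
      obtain ⟨v, hv⟩ := hE.cover u (by omega) (by omega)
      have := (hE.N_spec v u hv).2
      exact ⟨v, by rw [hN'2 v (by omega)]; exact hv⟩
    · exact ⟨v, by rw [hN'1 v hv]; exact hu⟩
  · rw [hlay i (by omega)]
    by_cases hij : i = j
    · subst hij
      have h1 := hE.sum_card_le hG hjk le_rfl (S := layer lv i) (T := S)
        (fun v hv => mem_layer.1 hv) fun v hv => by rw [((hSm v).1 hv).1]; omega
      have h2 : d * (layer lv i).card ≤ ∑ v ∈ layer lv i, (N' v).card +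
          ∑ v ∈ layer lv i, (S.filter (G.Adj v)).card := by
        calc d * (layer lv i).card = ∑ v ∈ layer lv i, d := by simp [mul_comm]
          _ ≤ ∑ v ∈ layer lv i, ((N' v).card + (S.filter (G.Adj v)).card) := by
            refine Finset.sum_le_sum fun v hv => ?_
            have hv := mem_layer.1 hv
            rw [hN'1 v hv, hN₁c]
            have h3 := hdeg v hv
            have h4 := hE.low v hv.le
            have h5 : Finset.univ.filter (G.Adj v) ⊆
                (Finset.univ.filter fun u => G.Adj v u ∧ lv u < lv v) ∪
                ((Finset.univ.filter (fun u => lv u = k + 1 ∧ G.Adj v u ∧ u ∉ S)) ∪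
                S.filter (G.Adj v)) := by
              intro u hu
              have hadj : G.Adj v u := (Finset.mem_filter.1 hu).2
              simp only [Finset.mem_union, Finset.mem_filter, Finset.mem_univ, true_and, hadj, and_true]
              have h6 : lv u ≠ i := fun h => by
                have := hE.color hf i le_rfl u v h hv
                have := hf _ _ hadj
                tauto
              rcases hE.range u with h | h
              · left; omega
              · right
                by_cases hu : u ∈ S
                · exact Or.inr hu
                · exact Or.inl ⟨h, hu⟩
            have h6 := Finset.card_le_card h5
            have h7 := Finset.card_union_le (Finset.univ.filter fun u => G.Adj v u ∧ lv u < lv v)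
              ((Finset.univ.filter (fun u => lv u = k + 1 ∧ G.Adj v u ∧ u ∉ S)) ∪
                S.filter (G.Adj v))
            have h8 := Finset.card_union_le
              (Finset.univ.filter (fun u => lv u = k + 1 ∧ G.Adj v u ∧ u ∉ S)) (S.filter (G.Adj v))
            omega
          _ = _ := Finset.sum_add_distrib
      nlinarith
    · rw [Finset.sum_congr rfl fun v hv => by rw [hN'2 v (by rw [mem_layer.1 hv]; exact hij)]]
      exact hE.N_sum i (by omega)
  · rcases hlv3 v with h | ⟨h, h1, w, hw, hvw⟩
    · have hr := hE.range v
      refine le_trans (Finset.card_le_card fun u hu => ?_) (hE.low v (by omega))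
      simp only [Finset.mem_filter, Finset.mem_univ, true_and] at hu ⊢
      exact ⟨hu.1, by rw [hlv4 u (by omega)]; omega⟩
    · have h2 := (hN₁m w v hvw).2.2
      rw [hSm] at h2
      have h3 : (Finset.univ.filter fun v' => G.Adj v' v ∧ lv v' ≤ j).card ≤ d := by
        by_contra hcon
        exact h2 ⟨h1, by omega⟩
      refine le_trans (Finset.card_le_card fun u hu => ?_) h3
      simp only [Finset.mem_filter, Finset.mem_univ, true_and] at hu ⊢
      exact ⟨hu.1.symm, by rw [hlv4 u (by omega)]; omega⟩

open Classical in
/-- The trimmed breadth first search in a `C_{2k}`-free bipartite graph of large minimum degree. -/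
lemma _root_.exists_isExploration {V : Type*} [Fintype V] {G : SimpleGraph V} {k d : ℕ}
    (hG : CycleFree (2 * k) G) (hd : 2 * k * (k + 1) ≤ d) (hd' : 4 * k + 4 ≤ d) {f : V → Prop}
    (hf : ∀ u v, G.Adj u v → (f u ↔ ¬ f v))
    (hdeg : ∀ v u, G.Adj v u → 2 * d ≤ (Finset.univ.filter (G.Adj v)).card)
    (hne : ∃ u v, G.Adj u v) {j : ℕ} (hj : j ≤ k) : ∃ lv N, IsExploration G k d j lv N := by
  induction j with
  | zero =>
    obtain ⟨x, y, hxy⟩ := hne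
    refine ⟨fun v => if v = x then 0 else k + 1, fun _ => ∅, ⟨x, ⟨y, hxy⟩, fun v => ?_⟩, fun v => ?_,
      fun v u hu => ?_, fun v => ?_, fun u h1 h2 => ?_, fun i hi => ?_, fun v hv => ?_⟩
    · split_ifs with h <;> simp [h]
    · split_ifs <;> simp
    · simp at hu
    · simp
    · omega
    · omega
    · rw [Nat.le_zero.1 hv]
      simp
  | succ j ih =>
    obtain ⟨lv, N, hE⟩ := ih (by omega)
    refine hE.step hG (by omega) hd hd' hf fun v hv => ?_
    rcases Nat.eq_zero_or_pos j with rfl | h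
    · obtain ⟨x, ⟨y, hxy⟩, hx⟩ := hE.root
      exact hdeg v y ((hx v).1 hv ▸ hxy)
    · obtain ⟨u, hu⟩ := hE.cover v (by omega) (by omega)
      exact hdeg v u (hE.N_spec _ _ hu).1.symm

end IsExploration

set_option maxHeartbeats 1600000 in
/-- The numerical core of the two-step growth estimate. -/
lemma two_step_growth_arith {k l d a b u c σ A : ℕ} (hk : 64 ≤ k) (hl : 6 ≤ l) (ha : 0 < a)
    (hc : 0 < c) (hb : b ≤ 2 * k + 1) (hA : 40 * ((2 * k + 1) * (l + 2)) ≤ A)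
    (hA' : 1000 * (k + 1) ≤ A) (hd : A * A ≤ d)
    (h1 : d * a ≤ 2 * b * (l + 2) * u + (4 * k + 4) * a)
    (h2 : d * u ≤ σ + (2 * k + 2) * (d * a)) (h3 : σ ≤ (k + 1) * (u + c))
    (h4 : 192 * k * l ^ 2 * c < d ^ 2 * a)
    (h5 : ∀ D s, 1 ≤ s → 4 * s ≤ D → D ≤ k → 64 ≤ D → 10 ≤ b → 2 * k ≤ s * (b - 4) →
      σ ≤ d / 4 * u + A * d * a + D * c) : False := by
  have hdA : 1000 * (k + 1) ≤ d := by nlinarith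
  have hd0 : 0 < d := by omega
  -- `u` is much larger than `a`
  have hu : 10 * A * a ≤ u := by
    have e1 : A * A * a ≤ d * a := Nat.mul_le_mul_right _ hd
    have e2 : 1000 * (k + 1) * a ≤ d * a := Nat.mul_le_mul_right _ hdA
    have e3 : 40 * (b * (l + 2)) ≤ A :=
      le_trans (Nat.mul_le_mul_left _ (Nat.mul_le_mul_right _ hb)) hA
    have e4 : 40 * (b * (l + 2)) * u ≤ A * u := Nat.mul_le_mul_right _ e3
    have e5 : A * (10 * A * a) ≤ A * u := by nlinarith
    exact Nat.le_of_mul_le_mul_left e5 (by omega)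
  have hu0 : 0 < u := lt_of_lt_of_le (Nat.mul_pos (by omega) ha) hu
  obtain ⟨D, hD1, hD2⟩ : ∃ D, 2 * c * D ≤ d * u ∧ d * u < 2 * c * (D + 1) :=
    ⟨d * u / (2 * c), Nat.mul_div_le _ _, Nat.lt_mul_div_succ _ (by omega)⟩
  have hDk : D ≤ k := by
    by_contra hcon
    have e1 : 2 * c * (k + 1) ≤ 2 * c * D := Nat.mul_le_mul_left _ (by omega)
    have e2 : 1000 * (k + 1) * u ≤ d * u := Nat.mul_le_mul_right _ hdA
    have e3 : d * u ≤ d * ((8 * k + 8) * a) := by nlinarith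
    have e4 := Nat.le_of_mul_le_mul_left e3 hd0
    have e5 : 1000 * (k + 1) * a ≤ A * a := Nat.mul_le_mul_right _ hA'
    nlinarith
  have hbD : 211 * k < b * (D + 1) := by
    have e1 : 192 * k * l ^ 2 * u < 2 * (D + 1) * (d * a) := by
      have : d * (192 * k * l ^ 2 * u) < d * (2 * (D + 1) * (d * a)) := by
        calc d * (192 * k * l ^ 2 * u) = 192 * k * l ^ 2 * (d * u) := by ring
          _ ≤ 192 * k * l ^ 2 * (2 * c * (D + 1)) := Nat.mul_le_mul_left _ hD2.le
          _ = 192 * k * l ^ 2 * c * (2 * (D + 1)) := by ring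
          _ < d ^ 2 * a * (2 * (D + 1)) := Nat.mul_lt_mul_of_pos_right h4 (by omega)
          _ = _ := by ring
      exact Nat.lt_of_mul_lt_mul_left this
    have e2 : 99 * (d * a) ≤ 200 * b * (l + 2) * u := by
      have e2 : 1000 * (k + 1) * a ≤ d * a := Nat.mul_le_mul_right _ hdA
      nlinarith
    have e3 : 99 * (192 * k * l ^ 2) < 2 * (D + 1) * (200 * b * (l + 2)) := by
      have : 99 * (192 * k * l ^ 2) * u < 2 * (D + 1) * (200 * b * (l + 2)) * u := by
        calc 99 * (192 * k * l ^ 2) * u = 99 * (192 * k * l ^ 2 * u) := by ring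
          _ < 99 * (2 * (D + 1) * (d * a)) := Nat.mul_lt_mul_of_pos_left e1 (by omega)
          _ = 2 * (D + 1) * (99 * (d * a)) := by ring
          _ ≤ 2 * (D + 1) * (200 * b * (l + 2) * u) := Nat.mul_le_mul_left _ e2
          _ = _ := by ring
      exact Nat.lt_of_mul_lt_mul_right this
    have e4 : 36 * (l + 2) ≤ 8 * l ^ 2 := by nlinarith
    have e5 : k * (36 * (l + 2)) ≤ k * (8 * l ^ 2) := Nat.mul_le_mul_left _ e4
    have e6 : (l + 2) * (211 * k) < (l + 2) * (b * (D + 1)) := by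
      have r1 : 99 * (192 * k * l ^ 2) = 2376 * (k * (8 * l ^ 2)) := by ring
      have r2 : k * (36 * (l + 2)) = 36 * ((l + 2) * k) := by ring
      have r3 : 2 * (D + 1) * (200 * b * (l + 2)) = 400 * ((l + 2) * (b * (D + 1))) := by ring
      have r4 : (l + 2) * (211 * k) = 211 * ((l + 2) * k) := by ring
      omega
    exact Nat.lt_of_mul_lt_mul_left e6
  have hb1 : 200 ≤ b := by
    by_contra hcon
    have : b * (D + 1) ≤ 199 * (k + 1) := Nat.mul_le_mul (by omega) (by omega)
    omega
  have hD64 : 64 ≤ D := by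
    by_contra hcon
    have : b * (D + 1) ≤ (2 * k + 1) * 64 := Nat.mul_le_mul hb (by omega)
    omega
  have hs : 2 * k ≤ D / 4 * (b - 4) := by
    obtain ⟨s, hs⟩ : ∃ s, s = D / 4 := ⟨_, rfl⟩
    obtain ⟨b', hb'⟩ : ∃ b', b = b' + 4 := ⟨b - 4, by omega⟩
    have e1 : D + 1 ≤ 5 * s := by omega
    have e2 : b * (D + 1) ≤ (2 * b') * (5 * s) := Nat.mul_le_mul (by omega) e1
    rw [← hs, hb', Nat.add_sub_cancel]
    have e3 : (2 * b') * (5 * s) = 10 * (s * b') := by ring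
    omega
  have h6 := h5 D (D / 4) (by omega) (by omega) hDk hD64 (by omega) hs
  have e1 : 4 * (d / 4) * u ≤ d * u := Nat.mul_le_mul_right _ (Nat.mul_div_le _ _)
  have e2 : d * u ≤ d * ((4 * A + 8 * k + 8) * a) := by nlinarith
  have e3 := Nat.le_of_mul_le_mul_left e2 hd0
  have e4 : 1000 * (k + 1) * a ≤ A * a := Nat.mul_le_mul_right _ hA'
  nlinarith

open Classical in
/-- A dyadic pigeonhole principle. -/
lemma exists_dyadic_class {α : Type*} (S : Finset α) (δ : α → ℕ) {J M : ℕ} (hJ : 0 < J)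
    (hS : ∀ u ∈ S, δ u ≠ 0 ∧ δ u < 2 ^ J) (hM : M ≤ ∑ u ∈ S, δ u) :
    ∃ t, ∃ U ⊆ S, (∀ u ∈ U, 2 ^ t ≤ δ u) ∧ M ≤ 2 * 2 ^ t * J * U.card := by
  by_contra! hcon
  have h1 : ∀ u ∈ S, Nat.log 2 (δ u) ∈ Finset.range J := fun u hu =>
    Finset.mem_range.2 (Nat.log_lt_of_lt_pow (hS u hu).1 (hS u hu).2)
  have h2 := Finset.sum_fiberwise_of_maps_to h1 δ
  have h3 : ∀ t ∈ Finset.range J, J * ∑ u ∈ S with Nat.log 2 (δ u) = t, δ u < M := by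
    intro t _
    have h4 := hcon t (S.filter fun u => Nat.log 2 (δ u) = t) (Finset.filter_subset _ _)
      fun u hu => by
        obtain ⟨h5, rfl⟩ := Finset.mem_filter.1 hu
        exact Nat.pow_log_le_self 2 (hS u h5).1
    refine lt_of_le_of_lt ?_ h4
    calc J * ∑ u ∈ S with Nat.log 2 (δ u) = t, δ u
        ≤ J * ∑ u ∈ S with Nat.log 2 (δ u) = t, 2 * 2 ^ t := by
          refine Nat.mul_le_mul_left _ (Finset.sum_le_sum fun u hu => ?_)
          obtain ⟨h5, rfl⟩ := Finset.mem_filter.1 hu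
          have := Nat.lt_pow_succ_log_self (b := 2) (by norm_num) (δ u)
          rw [pow_succ] at this
          omega
      _ = _ := by rw [Finset.sum_const, smul_eq_mul]; ring
  have h4 : J * ∑ u ∈ S, δ u < J * M := by
    rw [← h2, Finset.mul_sum]
    calc _ < ∑ t ∈ Finset.range J, M :=
          Finset.sum_lt_sum_of_nonempty ⟨0, Finset.mem_range.2 hJ⟩ h3
      _ = J * M := by simp
  exact absurd (Nat.lt_of_mul_lt_mul_left h4) (by omega)

namespace IsExploration

variable {V : Type*} [Fintype V] {G : SimpleGraph V} {k d j : ℕ} {lv : V → ℕ} {N : V → Finset V}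

lemma N_subset (hE : IsExploration G k d j lv N) {v : V} {i : ℕ} (hv : lv v = i) :
    N v ⊆ layer lv (i + 1) := fun u hu => by
  rw [mem_layer, (hE.N_spec v u hu).2, hv]

lemma card_layer_zero (hE : IsExploration G k d j lv N) : (layer lv 0).card = 1 := by
  obtain ⟨x, -, hx⟩ := hE.root
  rw [Finset.card_eq_one]
  exact ⟨x, by ext v; rw [mem_layer, hx, Finset.mem_singleton]⟩

lemma card_layer_pos (hE : IsExploration G k d j lv N) (hG : CycleFree (2 * k) G)
    (hd : 4 * k + 4 ≤ d) {i : ℕ} (hik : i ≤ k) (hij : i ≤ j) : 0 < (layer lv i).card := by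
  induction i with
  | zero => rw [hE.card_layer_zero]; exact one_pos
  | succ i ih =>
    exact (ih (by omega) (by omega)).trans_le (hE.card_layer_le_succ hG hd (by omega) (by omega))

open Classical in
lemma card_layer_succ_le (hE : IsExploration G k d j lv N) {i : ℕ} (hij : i < j) :
    (layer lv (i + 1)).card ≤ d * (layer lv i).card := by
  have h : layer lv (i + 1) ⊆ (layer lv i).biUnion N := fun u hu => by
    have hu := mem_layer.1 hu
    obtain ⟨v, hv⟩ := hE.cover u (by omega) (by omega)
    have := (hE.N_spec v u hv).2
    exact Finset.mem_biUnion.2 ⟨v, mem_layer.2 (by omega), hv⟩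
  refine (Finset.card_le_card h).trans (Finset.card_biUnion_le.trans ?_)
  calc _ ≤ ∑ v ∈ layer lv i, d := Finset.sum_le_sum fun v _ => hE.N_card v
    _ = _ := by simp [mul_comm]

open Classical in
/-- Two steps of the exploration multiply the size by `d ^ 2 / (192 k log₂² k)`. -/
lemma two_step_growth_of_large (hE : IsExploration G k d j lv N) (hG : CycleFree (2 * k) G)
    (hk : 64 ≤ k) (hd : (2 * k) ^ (8 * k) ≤ d) {i : ℕ} (hik : i + 1 < k) (hij : i + 1 < j) :
    d ^ 2 * (layer lv i).card ≤ 192 * k * Nat.log 2 k ^ 2 * (layer lv (i + 2)).card := by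
  by_contra! hcon
  set l := Nat.log 2 k with hl
  have hl6 : 6 ≤ l := (Nat.le_log_iff_pow_le (by norm_num) (by omega)).2 (by omega)
  have hlk : l ≤ k := Nat.log_le_self 2 k
  have hk2 : k < 2 ^ (l + 1) := Nat.lt_pow_succ_log_self (by norm_num) k
  have hpow : ∀ m, 4 ≤ m → (2 * k) ^ 4 ≤ (2 * k) ^ m := fun m hm =>
    Nat.pow_le_pow_right (by omega) hm
  have hA4 : (2 * k) ^ 4 ≤ (2 * k) ^ (4 * k) := hpow _ (by omega)
  have hk4 : 1000 * (k * k) ≤ (2 * k) ^ 4 := by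
    have : 64 * 64 ≤ k * k := Nat.mul_le_mul hk hk
    nlinarith
  have hdd : (2 * k) ^ (4 * k) * (2 * k) ^ (4 * k) ≤ d := by
    rw [← pow_add]; convert hd using 2; ring
  have hA1 : 1000 * (k + 1) ≤ (2 * k) ^ (4 * k) := by nlinarith
  have hdA : (2 * k) ^ (4 * k) ≤ d := le_trans (Nat.le_mul_of_pos_left _ (by positivity)) hdd
  have hd4 : 4 * k + 4 ≤ d := by omega
  set δ : V → ℕ := fun u => ((layer lv i).filter fun v => u ∈ N v).card with hδ
  have ha := hE.card_layer_pos hG hd4 (i := i) (by omega) (by omega)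
  have hc := hE.card_layer_pos hG hd4 (i := i + 2) (by omega) (by omega)
  have hdouble : ∑ v ∈ layer lv i, (N v).card = ∑ u ∈ layer lv (i + 1), δ u := by
    refine Eq.trans ?_ (Finset.sum_card_bipartiteAbove_eq_sum_card_bipartiteBelow
      (s := layer lv i) (t := layer lv (i + 1)) fun v u => u ∈ N v)
    refine Finset.sum_congr rfl fun v hv => ?_
    congr 1
    ext u
    simp only [Finset.bipartiteAbove, Finset.mem_filter]
    exact ⟨fun h => ⟨hE.N_subset (mem_layer.1 hv) h, h⟩, fun h => h.2⟩
  -- vertices of large back degree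
  have hbig : ∑ u ∈ (layer lv (i + 1)).filter (fun u => 2 * k + 2 ≤ δ u), δ u ≤
      (2 * k + 2) * (layer lv i).card := by
    set T := (layer lv (i + 1)).filter (fun u => 2 * k + 2 ≤ δ u) with hT
    have e1 : ∑ u ∈ T, δ u ≤ ∑ v ∈ layer lv i, (T.filter (G.Adj v)).card := by
      have := Finset.sum_card_bipartiteAbove_eq_sum_card_bipartiteBelow (s := layer lv i)
        (t := T) (fun v u => u ∈ N v)
      refine this.symm.le.trans (Finset.sum_le_sum fun v _ => Finset.card_le_card fun u hu => ?_)
      simp only [Finset.bipartiteAbove, Finset.mem_filter] at hu ⊢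
      exact ⟨hu.1, (hE.N_spec v u hu.2).1⟩
    have e2 := hE.sum_card_le hG (i := i) (by omega) (by omega) (S := layer lv i) (T := T)
      (fun v hv => mem_layer.1 hv) fun v hv => by
        rw [mem_layer.1 (Finset.mem_filter.1 hv).1]; omega
    have e3 : (2 * k + 2) * T.card ≤ ∑ u ∈ T, δ u := by
      calc (2 * k + 2) * T.card = ∑ u ∈ T, (2 * k + 2) := by simp [mul_comm]
        _ ≤ _ := Finset.sum_le_sum fun u hu => (Finset.mem_filter.1 hu).2
    nlinarith
  have hsmall : d * (layer lv i).card - (4 * k + 4) * (layer lv i).card ≤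
      ∑ u ∈ (layer lv (i + 1)).filter (fun u => δ u ≠ 0 ∧ δ u < 2 * k + 2), δ u := by
    have e1 := hE.N_sum i (by omega)
    rw [hdouble] at e1
    have e2 : ∑ u ∈ layer lv (i + 1), δ u ≤
        ∑ u ∈ (layer lv (i + 1)).filter (fun u => δ u ≠ 0 ∧ δ u < 2 * k + 2), δ u +
        ∑ u ∈ (layer lv (i + 1)).filter (fun u => 2 * k + 2 ≤ δ u), δ u := by
      simp only [Finset.sum_filter]
      rw [← Finset.sum_add_distrib]
      refine Finset.sum_le_sum fun u _ => ?_
      split_ifs <;> omega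
    have e3 : (4 * k + 4) * (layer lv i).card =
      (2 * k + 2) * (layer lv i).card + (2 * k + 2) * (layer lv i).card := by ring
    omega
  obtain ⟨t, U, hUs, hUδ, hU⟩ := exists_dyadic_class _ δ (J := l + 2) (by omega)
    (fun u hu => by
      have := (Finset.mem_filter.1 hu).2
      refine ⟨this.1, this.2.trans_le ?_⟩
      rw [pow_succ]; omega) hsmall
  have hUlv : ∀ u ∈ U, lv u = i + 1 := fun u hu => mem_layer.1 (Finset.mem_filter.1 (hUs hu)).1
  have hUN : ∀ u ∈ U, N u ⊆ layer lv (i + 2) := fun u hu => hE.N_subset (hUlv u hu)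
  have hUne : U.Nonempty := by
    rw [Finset.nonempty_iff_ne_empty]
    rintro rfl
    rw [Finset.card_empty, mul_zero, Nat.le_zero, ← Nat.sub_mul, mul_eq_zero] at hU
    have : 1000 * (k + 1) ≤ d := hA1.trans hdA
    omega
  obtain ⟨u₀, hu₀⟩ := hUne
  have hb : 2 ^ t ≤ 2 * k + 1 := by
    have e1 := hUδ u₀ hu₀
    have e2 := (Finset.mem_filter.1 (hUs hu₀)).2.2
    omega
  refine two_step_growth_arith (σ := ∑ u ∈ U, (N u).card) hk hl6 ha hc hb
    (A := (2 * k) ^ (4 * k)) ?_ hA1 hdd (by omega) ?_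
    (hE.sum_N_le hG (i := i + 1) (by omega) (by omega) hUlv) hcon ?_
  · have e1 : (2 * k + 1) * (l + 2) ≤ (3 * k) * (2 * k) := Nat.mul_le_mul (by omega) (by omega)
    nlinarith
  · have e1 := hE.N_sum (i + 1) (by omega)
    have e2 := hE.card_layer_succ_le (i := i) (by omega)
    have hUl : U ⊆ layer lv (i + 1) := hUs.trans (Finset.filter_subset _ _)
    have e3 := Finset.sum_sdiff hUl (f := fun u => (N u).card)
    have e4 : ∑ u ∈ layer lv (i + 1) \ U, (N u).card ≤ d * (layer lv (i + 1) \ U).card := by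
      calc _ ≤ ∑ u ∈ layer lv (i + 1) \ U, d := Finset.sum_le_sum fun v _ => hE.N_card v
        _ = _ := by simp [mul_comm]
    have e5 := Finset.card_sdiff_add_card_eq_card hUl
    have e6 : d * (layer lv (i + 1)).card = d * (layer lv (i + 1) \ U).card + d * U.card := by
      rw [← mul_add, e5]
    have e7 := Nat.mul_le_mul_left (2 * k + 2) e2
    omega
  · intro D s hs hsD hDk hD hB hsB
    have e1 := (hE.isLevelled hG (i := i + 1) (by omega) (by omega)
      (by omega)).sum_card_le_of_trilayer (N := N) (X₁ := layer lv i) (X₂ := U)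
      (X₃ := layer lv (i + 2)) (A := (2 * k) ^ (4 * k)) (B := 2 ^ t) (C := d / 4) (D := D) (d := d)
      (s := s) (fun v u hu => (hE.N_spec v u hu).1) (fun v hv => by rw [mem_layer.1 hv]) hUlv
      (fun v hv => mem_layer.1 hv) hUδ (fun u _ => hE.N_card u) hs hsD hD hB hsB
      (by omega) (by omega) (by
        have f1 : (k + 2) ^ s ≤ (2 * k) ^ k :=
          (Nat.pow_le_pow_left (by omega) s).trans (Nat.pow_le_pow_right (by omega) (by omega))
        have f2 : 1 ≤ (2 * k) ^ k := Nat.one_le_pow _ _ (by omega)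
        calc (k + 2) ^ s * (2 * k + 1) + k ≤ (2 * k) ^ k * (2 * k + 1) + (2 * k) ^ k * k := by
              refine Nat.add_le_add (Nat.mul_le_mul_right _ f1) ?_
              exact Nat.le_mul_of_pos_left _ (by omega)
          _ = (2 * k) ^ k * (3 * k + 1) := by ring
          _ < (2 * k) ^ k * (2 * k) ^ 4 := by
              refine Nat.mul_lt_mul_of_pos_left ?_ (by omega)
              nlinarith
          _ = (2 * k) ^ (k + 4) := by rw [pow_add]
          _ ≤ _ := Nat.pow_le_pow_right (by omega) (by omega))
    refine le_trans (Finset.sum_le_sum fun u hu => Finset.card_le_card fun w hw => ?_) e1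
    exact Finset.mem_filter.2 ⟨hUN u hu hw, hw⟩

lemma two_step_growth (hE : IsExploration G k d j lv N) (hG : CycleFree (2 * k) G)
    (hk : 2 ≤ k) (hd : (2 * k) ^ (8 * k) ≤ d) {i : ℕ} (hik : i + 1 < k) (hij : i + 1 < j) :
    d ^ 2 * (layer lv i).card ≤ 192 * k * Nat.log 2 k ^ 2 * (layer lv (i + 2)).card := by
  rcases le_or_gt 64 k with h | h
  · exact hE.two_step_growth_of_large hG h hd hik hij
  have hl : 1 ≤ Nat.log 2 k := Nat.log_pos (by norm_num) hk
  have hd2 : 64 * k * k ≤ d := by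
    calc 64 * k * k ≤ (2 * k) ^ 8 := by
          have : 1 ≤ k ^ 6 := Nat.one_le_pow _ _ (by omega)
          calc 64 * k * k = 64 * 1 * k ^ 2 := by ring
            _ ≤ 256 * k ^ 6 * k ^ 2 := Nat.mul_le_mul_right _ (Nat.mul_le_mul (by omega) this)
            _ = _ := by ring
      _ ≤ (2 * k) ^ (8 * k) := Nat.pow_le_pow_right (by omega) (by omega)
      _ ≤ d := hd
  have h1 := hE.growth hG (i := i) (by omega) (by omega)
  have h2 := hE.growth hG (i := i + 1) (by omega) (by omega)
  set a := (layer lv i).card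
  set b := (layer lv (i + 1)).card
  set c := (layer lv (i + 1 + 1)).card
  have h3 : 12 * (k + 1) ≤ d := by nlinarith
  have h4 : 3 * (d * a) ≤ 4 * ((k + 1) * b) := by nlinarith
  have h5 : 3 * (d * b) ≤ 4 * ((k + 1) * c) := by nlinarith
  have h6 : 9 * (d ^ 2 * a) ≤ 16 * ((k + 1) ^ 2 * c) := by
    calc 9 * (d ^ 2 * a) = 3 * d * (3 * (d * a)) := by ring
      _ ≤ 3 * d * (4 * ((k + 1) * b)) := Nat.mul_le_mul_left _ h4
      _ = 4 * (k + 1) * (3 * (d * b)) := by ring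
      _ ≤ 4 * (k + 1) * (4 * ((k + 1) * c)) := Nat.mul_le_mul_left _ h5
      _ = _ := by ring
  have h7 : (k + 1) ^ 2 ≤ 96 * k := by nlinarith
  have h8 : (k + 1) ^ 2 * c ≤ 96 * k * c := Nat.mul_le_mul_right _ h7
  have h9 : 192 * k * c ≤ 192 * k * Nat.log 2 k ^ 2 * c :=
    Nat.mul_le_mul_right _ (Nat.le_mul_of_pos_right _ (by positivity))
  change d ^ 2 * a ≤ 192 * k * Nat.log 2 k ^ 2 * c
  nlinarith

lemma pow_le_card_layer_sq (hE : IsExploration G k d k lv N) (hG : CycleFree (2 * k) G)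
    (hk : 2 ≤ k) (hd : (2 * k) ^ (8 * k) ≤ d) {i : ℕ} (hik : i ≤ k) :
    d ^ (2 * i) ≤ (192 * k * Nat.log 2 k ^ 2) ^ i * (layer lv i).card ^ 2 := by
  induction i using Nat.twoStepInduction with
  | zero => simp [hE.card_layer_zero]
  | one =>
    have h1 := hE.N_sum 0 (by omega)
    have h2 : ∑ v ∈ layer lv 0, (N v).card ≤ ∑ v ∈ layer lv 0, (layer lv 1).card :=
      Finset.sum_le_sum fun v hv => Finset.card_le_card (hE.N_subset (mem_layer.1 hv))
    rw [Finset.sum_const, hE.card_layer_zero, one_smul] at h2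
    rw [hE.card_layer_zero] at h1
    have h3 : 4 * k + 4 ≤ d := by
      calc 4 * k + 4 ≤ 2 * k * (2 * k) ^ 2 := by nlinarith
        _ = (2 * k) ^ 3 := by ring
        _ ≤ (2 * k) ^ (8 * k) := Nat.pow_le_pow_right (by omega) (by omega)
        _ ≤ d := hd
    have h4 : d ≤ 2 * (layer lv 1).card := by omega
    have hl : 1 ≤ Nat.log 2 k := Nat.log_pos (by norm_num) hk
    have h5 : 4 ≤ 192 * k * Nat.log 2 k ^ 2 := by
      have := Nat.mul_le_mul (show 4 ≤ 192 * k by omega) (Nat.one_le_pow 2 _ hl)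
      omega
    calc d ^ (2 * 1) ≤ (2 * (layer lv 1).card) ^ 2 := Nat.pow_le_pow_left h4 2
      _ = 4 * (layer lv 1).card ^ 2 := by ring
      _ ≤ _ := by rw [pow_one]; exact Nat.mul_le_mul_right _ h5
  | more i ih _ =>
    have h1 := ih (by omega)
    have h2 := hE.two_step_growth hG hk hd (i := i) (by omega) (by omega)
    calc d ^ (2 * (i + 2)) = d ^ 4 * d ^ (2 * i) := by ring
      _ ≤ d ^ 4 * ((192 * k * Nat.log 2 k ^ 2) ^ i * (layer lv i).card ^ 2) :=
        Nat.mul_le_mul_left _ h1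
      _ = (192 * k * Nat.log 2 k ^ 2) ^ i * (d ^ 2 * (layer lv i).card) ^ 2 := by ring
      _ ≤ (192 * k * Nat.log 2 k ^ 2) ^ i *
          (192 * k * Nat.log 2 k ^ 2 * (layer lv (i + 2)).card) ^ 2 :=
        Nat.mul_le_mul_left _ (Nat.pow_le_pow_left h2 2)
      _ = _ := by ring

end IsExploration

open Classical in
/-- A bipartite `C_{2k}`-free graph of minimum degree at least `2 d` has many vertices. -/
lemma CycleFree.pow_lt_card {V : Type*} [Fintype V] {G : SimpleGraph V} {k d : ℕ}
    (hG : CycleFree (2 * k) G) (hk : 2 ≤ k) (hd : (2 * k) ^ (8 * k) ≤ d) {f : V → Prop}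
    (hf : ∀ u v, G.Adj u v → (f u ↔ ¬ f v))
    (hdeg : ∀ v u, G.Adj v u → 2 * d ≤ (Finset.univ.filter (G.Adj v)).card)
    (hne : ∃ u v, G.Adj u v) :
    d ^ (2 * k) < (192 * k * Nat.log 2 k ^ 2) ^ k * Fintype.card V ^ 2 := by
  have h0 : (2 * k) ^ 3 ≤ d := (Nat.pow_le_pow_right (by omega) (by omega)).trans hd
  have h0' : 2 * k * (k + 1) ≤ (2 * k) ^ 3 ∧ 4 * k + 4 ≤ (2 * k) ^ 3 := by
    have e1 : 2 * 2 ≤ k * k := Nat.mul_le_mul hk hk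
    have e2 : (2 * k) ^ 3 = 8 * k * (k * k) := by ring
    constructor <;> nlinarith
  obtain ⟨lv, N, hE⟩ := exists_isExploration hG (h0'.1.trans h0) (h0'.2.trans h0) hf hdeg hne le_rfl
  have h1 := hE.pow_le_card_layer_sq hG hk hd le_rfl
  refine h1.trans_lt (Nat.mul_lt_mul_of_pos_left (Nat.pow_lt_pow_left ?_ (by norm_num)) ?_)
  · obtain ⟨x, -, hx⟩ := hE.root
    refine Finset.card_lt_univ_of_notMem (x := x) fun h => ?_
    have h2 := mem_layer.1 h
    have h3 := (hx x).2 rfl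
    omega
  · have hl : 1 ≤ Nat.log 2 k := Nat.log_pos (by norm_num) hk
    positivity

open Classical in
/-- A symmetric weight function has a cut of at least half of the total weight. -/
lemma exists_large_cut {V : Type*} (φ : V → V → ℕ) (hφ : ∀ u v, φ u v = φ v u)
    (hφ' : ∀ u, φ u u = 0) (W : Finset V) : ∃ S T, S ∪ T = W ∧ Disjoint S T ∧
      ∑ u ∈ W, ∑ v ∈ W, φ u v ≤ 4 * ∑ u ∈ S, ∑ v ∈ T, φ u v := by
  induction W using Finset.induction_on with
  | empty => exact ⟨∅, ∅, by simp⟩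
  | insert x W hx ih =>
    obtain ⟨S, T, rfl, hdisj, h⟩ := ih
    rw [Finset.mem_union, not_or] at hx
    have hx' : x ∉ S ∪ T := by simpa using hx
    have e1 : ∑ u ∈ insert x (S ∪ T), ∑ v ∈ insert x (S ∪ T), φ u v =
        ∑ u ∈ S ∪ T, ∑ v ∈ S ∪ T, φ u v + 2 * (∑ v ∈ S, φ x v + ∑ v ∈ T, φ x v) := by
      rw [Finset.sum_insert hx', Finset.sum_insert hx', hφ', zero_add]
      simp only [Finset.sum_insert hx', Finset.sum_add_distrib, hφ _ x]
      rw [Finset.sum_union hdisj (f := fun v => φ x v)]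
      ring
    rcases le_total (∑ v ∈ S, φ x v) (∑ v ∈ T, φ x v) with hle | hle
    · refine ⟨insert x S, T, by rw [Finset.insert_union], ?_, ?_⟩
      · exact Finset.disjoint_insert_left.2 ⟨hx.2, hdisj⟩
      · rw [e1, Finset.sum_insert hx.1]
        omega
    · refine ⟨S, insert x T, by rw [Finset.union_insert], ?_, ?_⟩
      · exact Finset.disjoint_insert_right.2 ⟨hx.1, hdisj⟩
      · rw [e1]
        simp only [Finset.sum_insert hx.2, Finset.sum_add_distrib, hφ _ x]
        omega

open Classical in
/-- A `C_{2k}`-free graph with more than `4 d n` edges has many vertices. -/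
lemma CycleFree.pow_lt_card_of_lt_edges {V : Type*} [Fintype V] {G : SimpleGraph V} {k d : ℕ}
    (hG : CycleFree (2 * k) G) (hk : 2 ≤ k) (hd : (2 * k) ^ (8 * k) ≤ d)
    (hE : 4 * d * Fintype.card V < G.edgeSet.ncard) :
    d ^ (2 * k) < (192 * k * Nat.log 2 k ^ 2) ^ k * Fintype.card V ^ 2 := by
  have hsum : 2 * G.edgeSet.ncard = ∑ u, ∑ v, if G.Adj u v then 1 else 0 := by
    rw [Set.ncard_eq_toFinset_card', ← SimpleGraph.edgeFinset, ← G.sum_degrees_eq_twice_card_edges]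
    refine Finset.sum_congr rfl fun u _ => ?_
    rw [← Finset.card_filter, ← G.card_neighborFinset_eq_degree, G.neighborFinset_eq_filter]
  obtain ⟨S, T, hST, hdisj, hcut⟩ := exists_large_cut (fun u v => if G.Adj u v then 1 else 0)
    (fun u v => by simp only [G.adj_comm]) (fun u => by simp) Finset.univ
  rw [← hsum] at hcut
  have hc : S.card + T.card = Fintype.card V := by
    rw [← Finset.card_union_of_disjoint hdisj, hST, Finset.card_univ]
  have hcut' : 2 * d * (S.card + T.card) < ∑ s ∈ S, (T.filter (G.Adj s)).card := by
    simp only [Finset.card_filter]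
    rw [hc]
    have : 4 * d * Fintype.card V = 2 * (2 * d * Fintype.card V) := by ring
    omega
  obtain ⟨S', hS', T', hT', ⟨x, hx⟩, h1, h2⟩ := exists_min_degree_of_lt_sum G.Adj (2 * d) S T hcut'
  have hdis : ∀ v, v ∈ S' → v ∉ T' := fun v h h' =>
    Finset.disjoint_left.1 hdisj (hS' h) (hT' h')
  obtain ⟨H, hHadj⟩ : ∃ H : SimpleGraph V, ∀ u v, H.Adj u v ↔
      G.Adj u v ∧ (u ∈ S' ∧ v ∈ T' ∨ v ∈ S' ∧ u ∈ T') :=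
    ⟨{ Adj := fun u v => G.Adj u v ∧ (u ∈ S' ∧ v ∈ T' ∨ v ∈ S' ∧ u ∈ T')
       symm := ⟨fun u v h => ⟨h.1.symm, h.2.symm⟩⟩
       loopless := ⟨fun u h => G.loopless.irrefl u h.1⟩ }, fun _ _ => Iff.rfl⟩
  have hH : CycleFree (2 * k) H := by
    rintro ⟨g, hg⟩
    exact hG ⟨⟨g, fun h => ((hHadj _ _).1 (g.map_adj h)).1⟩, hg⟩
  refine hH.pow_lt_card hk hd (f := fun v => v ∈ S') (fun u v h => ?_) (fun v u h => ?_) ?_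
  · rcases ((hHadj _ _).1 h).2 with h | h
    · exact ⟨fun _ h' => hdis _ h' h.2, fun _ => h.1⟩
    · exact ⟨fun h' => (hdis _ h' h.2).elim, fun h' => (h' h.1).elim⟩
  · rcases ((hHadj _ _).1 h).2 with h | h
    · refine (h1 v h.1).le.trans (Finset.card_le_card fun w hw => ?_)
      obtain ⟨hw1, hw2⟩ := Finset.mem_filter.1 hw
      exact Finset.mem_filter.2 ⟨Finset.mem_univ _, (hHadj _ _).2 ⟨hw2, Or.inl ⟨h.1, hw1⟩⟩⟩
    · refine (h2 v h.2).le.trans (Finset.card_le_card fun w hw => ?_)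
      obtain ⟨hw1, hw2⟩ := Finset.mem_filter.1 hw
      exact Finset.mem_filter.2 ⟨Finset.mem_univ _, (hHadj _ _).2 ⟨hw2.symm, Or.inr ⟨hw1, h.2⟩⟩⟩
  · obtain ⟨y, hy⟩ := Finset.card_pos.1 ((Nat.zero_le _).trans_lt (h1 x hx))
    obtain ⟨hy1, hy2⟩ := Finset.mem_filter.1 hy
    exact ⟨x, y, (hHadj _ _).2 ⟨hy2, Or.inl ⟨hx, hy1⟩⟩⟩

/-- `ex(n, C_{2k}) ≤ 80 √k (log k) n^{1+1/k} + 10 k² n` for `n ≥ (2k)^{8k²}`. -/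
theorem stmt_12 (k n : ℕ) (hk : 2 ≤ k) (hn : (2 * k) ^ (8 * k ^ 2) ≤ n)
    (G : SimpleGraph (Fin n)) (hG : CycleFree (2 * k) G) :
    (G.edgeSet.ncard : ℝ) ≤
      80 * Real.sqrt k * Real.log k * (n : ℝ) ^ ((1 : ℝ) + 1 / k) +
        10 * k ^ 2 * n := by
  by_contra! hE
  have hk0 : (0 : ℝ) < k := by exact_mod_cast (by omega : 0 < k)
  have hk2 : (2 : ℝ) ≤ k := by exact_mod_cast hk
  have hn0 : (0 : ℝ) < n := by
    have : 0 < (2 * k) ^ (8 * k ^ 2) := by positivity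
    exact_mod_cast this.trans_le hn
  set r : ℝ := (n : ℝ) ^ ((1 : ℝ) / k) with hr
  have hr0 : 0 < r := Real.rpow_pos_of_pos hn0 _
  have hrk : r ^ k = n := by
    rw [hr, ← Real.rpow_natCast, ← Real.rpow_mul hn0.le, one_div, inv_mul_cancel₀ hk0.ne',
      Real.rpow_one]
  set L : ℝ := 20 * Real.sqrt k * Real.log k with hL
  -- comparison of the natural logarithm with the integer part of the binary one
  have hlog : (0.693 : ℝ) * (Nat.log 2 k : ℕ) ≤ Real.log k := by
    have h1 : ((2 : ℝ)) ^ (Nat.log 2 k) ≤ k := by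
      exact_mod_cast Nat.pow_log_le_self 2 (by omega : k ≠ 0)
    have h2 := Real.log_le_log (by positivity) h1
    rw [Real.log_pow] at h2
    have h3 := Real.log_two_gt_d9
    have h4 : (0 : ℝ) ≤ (Nat.log 2 k : ℕ) := Nat.cast_nonneg _
    nlinarith
  have hl1 : (1 : ℝ) ≤ (Nat.log 2 k : ℕ) := by
    exact_mod_cast Nat.log_pos (by norm_num) hk
  have hQ : (192 * k * (Nat.log 2 k : ℕ) ^ 2 : ℝ) ≤ L ^ 2 := by
    have h1 : L ^ 2 = 400 * k * Real.log k ^ 2 := by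
      rw [hL, mul_pow, mul_pow, Real.sq_sqrt hk0.le]; norm_num
    have h2 : ((0.693 : ℝ) * (Nat.log 2 k : ℕ)) ^ 2 ≤ Real.log k ^ 2 :=
      pow_le_pow_left₀ (by positivity) hlog 2
    have h3 : 0 ≤ (k : ℝ) * (Nat.log 2 k : ℕ) ^ 2 := by positivity
    have h4 := mul_le_mul_of_nonneg_left h2 (by positivity : (0 : ℝ) ≤ 400 * k)
    rw [h1]
    nlinarith
  have hL1 : 1 ≤ L := by
    have h1 : 1 ≤ Real.sqrt k := Real.one_le_sqrt.2 (by linarith)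
    have h2 : 0.693 ≤ Real.log k := by linarith
    rw [hL]
    nlinarith
  have hd : (2 * k) ^ (8 * k) ≤ ⌈L * r⌉₊ := by
    have h1 : ((2 * k : ℝ) ^ (8 * k)) ^ k ≤ r ^ k := by
      rw [hrk, ← pow_mul, show 8 * k * k = 8 * k ^ 2 by ring]
      exact_mod_cast hn
    have h2 := le_of_pow_le_pow_left₀ (by omega : k ≠ 0) hr0.le h1
    have h3 : ((2 * k : ℝ) ^ (8 * k)) ≤ (⌈L * r⌉₊ : ℝ) :=
      h2.trans ((le_mul_of_one_le_left hr0.le hL1).trans (Nat.le_ceil _))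
    exact_mod_cast h3
  have hlt := hG.pow_lt_card_of_lt_edges hk hd (by
    rw [Fintype.card_fin]
    have h1 := Nat.ceil_lt_add_one (by positivity : 0 ≤ L * r)
    have h2 : (n : ℝ) ^ ((1 : ℝ) + 1 / k) = n * r := by
      rw [Real.rpow_add hn0, Real.rpow_one]
    rw [h2] at hE
    have h3 : ((4 * ⌈L * r⌉₊ * n : ℕ) : ℝ) < (G.edgeSet.ncard : ℝ) := by
      push_cast
      refine lt_of_le_of_lt ?_ hE
      have h4 : (⌈L * r⌉₊ : ℝ) * n ≤ (L * r + 1) * n :=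
        mul_le_mul_of_nonneg_right h1.le hn0.le
      have h5 : (4 : ℝ) * n ≤ 10 * k ^ 2 * n :=
        mul_le_mul_of_nonneg_right (by nlinarith) hn0.le
      have h6 : 80 * Real.sqrt k * Real.log k * (n * r) = 4 * (L * r * n) := by
        rw [hL]; ring
      rw [h6]
      linarith
    exact_mod_cast h3)
  rw [Fintype.card_fin] at hlt
  have hlt' : ((⌈L * r⌉₊ : ℝ)) ^ (2 * k) < (192 * k * (Nat.log 2 k : ℕ) ^ 2 : ℝ) ^ k * n ^ 2 := by
    exact_mod_cast hlt
  have h1 : (192 * k * (Nat.log 2 k : ℕ) ^ 2 : ℝ) ^ k * n ^ 2 ≤ (L * r) ^ (2 * k) := by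
    calc _ ≤ (L ^ 2) ^ k * n ^ 2 :=
          mul_le_mul_of_nonneg_right (pow_le_pow_left₀ (by positivity) hQ k) (by positivity)
      _ = (L * r) ^ (2 * k) := by
        rw [mul_pow L r, pow_mul L, pow_mul' r, hrk]
  have h2 : (L * r) ^ (2 * k) ≤ (⌈L * r⌉₊ : ℝ) ^ (2 * k) :=
    pow_le_pow_left₀ (by positivity) (Nat.le_ceil _) _
  linarith
end

section
/- For every integer r ≥ 2 and every real ε > 0, there exist a real δ > 0 and a positive integer N such that for every n ≥ N, every maximal K_{r+1}-free graph G on n vertices with at least t_r(n) − δ·n^{(r+1)/r} edges contains an induced complete r-partite subgraph on at least (1−ε)n vertices. -/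
open SimpleGraph

/-- `G` is a maximal `K_{r+1}`-free graph: it has no `(r+1)`-clique and adding any edge
of the complement creates one. -/
def MaximalCliqueFree {β : Type*} (r : ℕ) (G : SimpleGraph β) : Prop :=
  G.CliqueFree (r + 1) ∧
    ∀ v w : β, v ≠ w → ¬ G.Adj v w →
      ¬ (G ⊔ fromEdgeSet {s(v, w)}).CliqueFree (r + 1)

/-- The induced subgraph of `G` on `S` is a complete multipartite graph with at most
`r` parts: there is a coloring of `S` with `r` colors so that two vertices of `S` are
adjacent iff they get different colors. -/
def IsInducedCompleteMultipartiteOn {β : Type*} (r : ℕ) (G : SimpleGraph β)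
    (S : Set β) : Prop :=
  ∃ c : β → Fin r, ∀ u ∈ S, ∀ v ∈ S, (G.Adj u v ↔ c u ≠ c v)

open Finset in
/-- In a `K_{r+1}`-free graph, let each `x ∈ X` have a partner `y x` and a set `K x ⊇ T` completing
both `x` and `y x` to `r`-cliques. If all nonneighbours of each `y x'` among the sets
`insert x (K x)` lie in a set of size at most `D`, then `X` has fewer than `(D + 1) ^ (m + 1)`
elements, where `m = #(K x) - #T`. -/
theorem card_add_one_le_pow_of_isNClique_insert {V : Type*} [DecidableEq V]
    {G : SimpleGraph V} {r : ℕ}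
    (hG : G.CliqueFree (r + 1)) (y : V → V) (K F : V → Finset V) (D m : ℕ) (X T : Finset V)
    (hT : ∀ x ∈ X, T ⊆ K x) (hm : ∀ x ∈ X, #(K x) = #T + m)
    (hK : ∀ x ∈ X, G.IsNClique r (insert x (K x)))
    (hy : ∀ x ∈ X, ∀ a ∈ K x, G.Adj (y x) a)
    (hD : ∀ x ∈ X, #(F (y x)) ≤ D)
    (hF : ∀ x ∈ X, ∀ x' ∈ X, ∀ a ∈ insert x (K x), ¬ G.Adj (y x') a → a ∈ F (y x')) :
    #X + 1 ≤ (D + 1) ^ (m + 1) := by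
  induction m generalizing X T with
  | zero =>
    rcases X.eq_empty_or_nonempty with rfl | ⟨x₀, hx₀⟩
    · simp
    have hsub : X ⊆ F (y x₀) := by
      intro x hx
      obtain ⟨a, ha, hna⟩ := (hK x hx).exists_not_adj_of_cliqueFree_succ hG (y x₀)
      have haF := hF x hx x₀ hx₀ a ha hna
      rcases mem_insert.1 ha with rfl | ha
      · exact haF
      · rw [← eq_of_subset_of_card_le (hT x hx) (hm x hx).le] at ha
        exact absurd (hy x₀ hx₀ a (hT x₀ hx₀ ha)) hna
    simpa using (card_le_card hsub).trans (hD x₀ hx₀)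
  | succ m ih =>
    rcases X.eq_empty_or_nonempty with rfl | ⟨x₀, hx₀⟩
    · simpa using Nat.one_le_pow _ _ (Nat.succ_pos D)
    have hsub : X ⊆ F (y x₀) ∪ (F (y x₀)).biUnion fun a ↦ {x ∈ X | a ∈ K x ∧ a ∉ T} := by
      intro x hx
      obtain ⟨a, ha, hna⟩ := (hK x hx).exists_not_adj_of_cliqueFree_succ hG (y x₀)
      have haF := hF x hx x₀ hx₀ a ha hna
      rcases mem_insert.1 ha with rfl | ha
      · exact mem_union_left _ haF
      · refine mem_union_right _ (mem_biUnion.2 ⟨a, haF, mem_filter.2 ⟨hx, ha, fun haT ↦ ?_⟩⟩)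
        exact hna (hy x₀ hx₀ a (hT x₀ hx₀ haT))
    have hfib (a : V) : #{x ∈ X | a ∈ K x ∧ a ∉ T} + 1 ≤ (D + 1) ^ (m + 1) := by
      by_cases haT : a ∈ T
      · simpa [haT] using Nat.one_le_pow _ _ (Nat.succ_pos D)
      have hX {x : V} (hx : x ∈ ({x ∈ X | a ∈ K x ∧ a ∉ T} : Finset V)) : x ∈ X :=
        (mem_filter.1 hx).1
      refine ih _ (insert a T) (fun x hx ↦ ?_) (fun x hx ↦ ?_) (fun x hx ↦ hK x (hX hx))
        (fun x hx ↦ hy x (hX hx)) (fun x hx ↦ hD x (hX hx))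
        (fun x hx x' hx' ↦ hF x (hX hx) x' (hX hx'))
      · exact insert_subset (mem_filter.1 hx).2.1 (hT x (hX hx))
      · rw [hm x (hX hx), card_insert_of_notMem haT]
        ring
    have h1 := (card_le_card hsub).trans (card_union_le _ _)
    have h2 := card_biUnion_le_card_mul (F (y x₀)) (fun a ↦ {x ∈ X | a ∈ K x ∧ a ∉ T})
      ((D + 1) ^ (m + 1) - 1) fun a _ ↦ Nat.le_sub_one_of_lt (hfib a)
    have h3 := hD x₀ hx₀
    have h4 : 1 ≤ (D + 1) ^ (m + 1) := Nat.one_le_pow _ _ (Nat.succ_pos D)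
    obtain ⟨p, hp⟩ := Nat.exists_eq_add_of_le h4
    have h5 := Nat.mul_le_mul_right p h3
    rw [hp, Nat.add_sub_cancel_left] at h2
    rw [pow_succ, hp]
    nlinarith

open Finset in
/-- In a `K_{r+1}`-free graph with a vertex partition into large parts, two adjacent vertices
outside a small exceptional set `C` lie in different parts, provided that vertices outside `C` miss
few vertices of the other parts. -/
theorem ne_color_of_adj {V : Type*} [Fintype V] [DecidableEq V] {G : SimpleGraph V}
    [DecidableRel G.Adj] {r : ℕ} (hG : G.CliqueFree (r + 1)) (c : V → Fin r) (C : Finset V) (d : ℕ)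
    (hd : ∀ v ∉ C, #{a | c a ≠ c v ∧ ¬ G.Adj v a} ≤ d)
    (hc : ∀ i, r * d < #{a | c a = i ∧ a ∉ C}) {u v : V} (hu : u ∉ C) (hv : v ∉ C)
    (huv : G.Adj u v) : c u ≠ c v := by
  intro hcuv
  have key (J : Finset (Fin r)) (hJ : c u ∉ J) :
      ∃ S : Finset V, G.IsNClique (#J + 2) S ∧ ∀ a ∈ S, a ∉ C ∧ c a ∈ insert (c u) J := by
    induction J using Finset.induction_on with
    | empty =>
      refine ⟨{u, v}, ?_, ?_⟩
      · rw [card_empty, zero_add, isNClique_iff]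
        exact ⟨by simpa [isClique_pair] using fun _ ↦ huv, card_pair huv.ne⟩
      · simp [hu, hv, hcuv]
    | insert j J hj ih =>
      have hJ' := hJ
      simp only [mem_insert, not_or] at hJ
      obtain ⟨S, hS, hSC⟩ := ih hJ.2
      have hcard : #S ≤ r := by
        have := card_le_univ (insert (c u) (insert j J))
        rw [card_insert_of_notMem hJ', card_insert_of_notMem hj, Fintype.card_fin] at this
        rw [hS.card_eq]
        lia
      have hbad := card_biUnion_le_card_mul S (fun w ↦ {a | c a ≠ c w ∧ ¬ G.Adj w a}) d
        fun w hw ↦ hd w (hSC w hw).1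
      obtain ⟨a, ha, hab⟩ := exists_mem_notMem_of_card_lt_card
        ((hbad.trans (Nat.mul_le_mul_right d hcard)).trans_lt (hc j))
      simp only [mem_filter, mem_univ, true_and] at ha
      simp only [mem_biUnion, mem_filter, mem_univ, true_and, not_exists, not_and, not_not] at hab
      refine ⟨insert a S, ?_, ?_⟩
      · rw [card_insert_of_notMem hj, add_right_comm]
        refine hS.insert fun w hw ↦ (hab w hw fun h ↦ ?_).symm
        have := (hSC w hw).2
        rw [← h, ha.1] at this
        grind
      · intro w hw
        rcases mem_insert.1 hw with rfl | hw
        · simp [ha]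
        · have := hSC w hw
          grind
  obtain ⟨S, hS, -⟩ := key (univ.erase (c u)) (by simp)
  rw [card_erase_of_mem (mem_univ _), card_fin] at hS
  have := (c u).pos
  exact hG S (by convert hS using 1; lia)

open Finset in
/-- **Füredi's stability theorem**, counting ordered pairs: a `K_{r+1}`-free graph has a vertex
partition into `r` parts with few edges inside the parts. -/
theorem exists_coloring_on {V : Type*} [DecidableEq V] (G : SimpleGraph V)
    [DecidableRel G.Adj] (r : ℕ) (S : Finset V) (hS : G.CliqueFreeOn S (r + 1)) :
    ∃ c : V → ℕ, (∀ v ∈ S, c v < r) ∧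
      (∑ u ∈ S, #{v ∈ S | G.Adj u v}) + ∑ u ∈ S, #{v ∈ S | G.Adj u v ∧ c u = c v} ≤
        ∑ u ∈ S, #{v ∈ S | c u ≠ c v} := by
  induction r generalizing S with
  | zero =>
    have : S = ∅ := by
      by_contra h
      obtain ⟨v, hv⟩ := nonempty_iff_ne_empty.2 h
      exact hS (t := {v}) (by simpa using hv) (by simp [isNClique_iff])
    exact ⟨0, by simp [this]⟩
  | succ r ih =>
    rcases S.eq_empty_or_nonempty with rfl | hne
    · exact ⟨0, by simp⟩
    obtain ⟨w, hw, hmax⟩ := exists_max_image S (fun u ↦ #{v ∈ S | G.Adj u v}) hne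
    obtain ⟨c, hc, hle⟩ := ih {v ∈ S | G.Adj w v} (by
      convert CliqueFreeOn.of_succ G hS (mem_coe.2 hw) using 1
      ext; simp)
    refine ⟨fun v ↦ if G.Adj w v then c v else r, fun v hv ↦ ?_, ?_⟩
    · dsimp only
      split_ifs with h
      · exact (hc v (by simp [hv, h])).trans (Nat.lt_succ_self r)
      · exact Nat.lt_succ_self r
    set P := ({v ∈ S | G.Adj w v} : Finset V) with hP
    set Q := ({v ∈ S | ¬ G.Adj w v} : Finset V) with hQ
    simp only [card_filter] at hle ⊢
    have hsplit (h : V → V → ℕ) : ∑ u ∈ S, ∑ v ∈ S, h u v =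
        ∑ u ∈ P, ∑ v ∈ P, h u v + ∑ u ∈ P, ∑ v ∈ Q, h u v +
          (∑ u ∈ Q, ∑ v ∈ P, h u v + ∑ u ∈ Q, ∑ v ∈ Q, h u v) := by
      simp_rw [← sum_add_distrib, hP, hQ, sum_filter_add_sum_filter_not]
    have hPa {v : V} (hv : v ∈ P) : G.Adj w v := (mem_filter.1 hv).2
    have hQa {v : V} (hv : v ∈ Q) : ¬ G.Adj w v := (mem_filter.1 hv).2
    have hdeg : ∑ u ∈ Q, ∑ v ∈ P, (if G.Adj u v then 1 else 0) +
        ∑ u ∈ Q, ∑ v ∈ Q, (if G.Adj u v then 1 else 0) ≤ #Q * #P := by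
      simp_rw [← sum_add_distrib, hP, hQ, sum_filter_add_sum_filter_not, ← card_filter]
      rw [← smul_eq_mul]
      exact sum_le_card_nsmul _ _ _ fun u hu ↦ hmax u (mem_filter.1 hu).1
    have hsymm : ∑ u ∈ P, ∑ v ∈ Q, (if G.Adj u v then 1 else 0) =
        ∑ u ∈ Q, ∑ v ∈ P, (if G.Adj u v then 1 else 0) := by
      rw [sum_comm]
      simp_rw [G.adj_comm]
    rw [hsplit, hsplit, hsplit]
    have e1 : ∑ u ∈ P, ∑ v ∈ P, (if G.Adj u v ∧ (if G.Adj w u then c u else r) =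
        (if G.Adj w v then c v else r) then 1 else 0) =
        ∑ u ∈ P, ∑ v ∈ P, if G.Adj u v ∧ c u = c v then 1 else 0 :=
      sum_congr rfl fun u hu ↦ sum_congr rfl fun v hv ↦ by rw [if_pos (hPa hu), if_pos (hPa hv)]
    have e2 : ∑ u ∈ P, ∑ v ∈ Q, (if G.Adj u v ∧ (if G.Adj w u then c u else r) =
        (if G.Adj w v then c v else r) then 1 else 0) = 0 :=
      sum_eq_zero fun u hu ↦ sum_eq_zero fun v hv ↦ by
        rw [if_pos (hPa hu), if_neg (hQa hv), if_neg fun h ↦ (hc u hu).ne h.2]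
    have e3 : ∑ u ∈ Q, ∑ v ∈ P, (if G.Adj u v ∧ (if G.Adj w u then c u else r) =
        (if G.Adj w v then c v else r) then 1 else 0) = 0 :=
      sum_eq_zero fun u hu ↦ sum_eq_zero fun v hv ↦ by
        rw [if_neg (hQa hu), if_pos (hPa hv), if_neg fun h ↦ (hc v hv).ne h.2.symm]
    have e4 : ∑ u ∈ Q, ∑ v ∈ Q, (if G.Adj u v ∧ (if G.Adj w u then c u else r) =
        (if G.Adj w v then c v else r) then 1 else 0) =
        ∑ u ∈ Q, ∑ v ∈ Q, if G.Adj u v then 1 else 0 :=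
      sum_congr rfl fun u hu ↦ sum_congr rfl fun v hv ↦ by
        rw [if_neg (hQa hu), if_neg (hQa hv)]; simp
    have k1 : ∑ u ∈ P, ∑ v ∈ P, (if (if G.Adj w u then c u else r) ≠
        (if G.Adj w v then c v else r) then 1 else 0) =
        ∑ u ∈ P, ∑ v ∈ P, if c u ≠ c v then 1 else 0 :=
      sum_congr rfl fun u hu ↦ sum_congr rfl fun v hv ↦ by rw [if_pos (hPa hu), if_pos (hPa hv)]
    have k2 : ∑ u ∈ P, ∑ v ∈ Q, (if (if G.Adj w u then c u else r) ≠
        (if G.Adj w v then c v else r) then 1 else 0) = #P * #Q := by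
      refine sum_const_nat fun u hu ↦ ?_
      rw [card_eq_sum_ones]
      exact sum_congr rfl fun v hv ↦ by
        rw [if_pos (hPa hu), if_neg (hQa hv), if_pos (hc u hu).ne]
    have k3 : ∑ u ∈ Q, ∑ v ∈ P, (if (if G.Adj w u then c u else r) ≠
        (if G.Adj w v then c v else r) then 1 else 0) = #Q * #P := by
      refine sum_const_nat fun u hu ↦ ?_
      rw [card_eq_sum_ones]
      exact sum_congr rfl fun v hv ↦ by
        rw [if_neg (hQa hu), if_pos (hPa hv), if_pos (hc v hv).ne']
    rw [e1, e2, e3, e4, k1, k2, k3, mul_comm #P]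
    lia

theorem sum_sub_div_card_sq {r : ℕ} (hr : 0 < r) (f : Fin r → ℝ) :
    ∑ i, (f i - (∑ j, f j) / r) ^ 2 = ∑ i, f i ^ 2 - (∑ j, f j) ^ 2 / r := by
  have hr' : (r : ℝ) ≠ 0 := by positivity
  simp_rw [sub_sq, Finset.sum_add_distrib, Finset.sum_sub_distrib, ← Finset.sum_mul,
    ← Finset.mul_sum, Finset.sum_const, Finset.card_univ, Fintype.card_fin, nsmul_eq_mul]
  field_simp
  ring

open Finset in
/-- A `K_{r+1}`-free graph with almost as many edges as the Turán graph has a partition into `r`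
nearly equal parts with few missing edges between distinct parts. -/
theorem exists_coloring_missing {V : Type*} [Fintype V] [DecidableEq V] (G : SimpleGraph V)
    [DecidableRel G.Adj] {r : ℕ} (hr : 0 < r) (hG : G.CliqueFree (r + 1)) {L : ℝ}
    (hL : (1 - 1 / (r : ℝ)) * (Fintype.card V : ℝ) ^ 2 - L ≤ 2 * (#G.edgeFinset : ℝ)) :
    ∃ c : V → Fin r, (∑ v, (#{a | c a ≠ c v ∧ ¬ G.Adj v a} : ℝ)) ≤ 2 * L ∧
      ∀ i, ((#{v | c v = i} : ℝ) - Fintype.card V / r) ^ 2 ≤ L := by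
  obtain ⟨c₀, hc₀, hle⟩ := exists_coloring_on G r univ hG.cliqueFreeOn
  let c : V → Fin r := fun v ↦ ⟨c₀ v, hc₀ v (mem_univ v)⟩
  have hcc (u v : V) : c₀ u = c₀ v ↔ c u = c v := by simp [c, Fin.ext_iff]
  simp only [ne_eq, hcc] at hle
  have hdeg : ∑ u, #{v | G.Adj u v} = 2 * #G.edgeFinset := by
    rw [← G.sum_degrees_eq_twice_card_edges]
    simp_rw [← card_neighborFinset_eq_degree, neighborFinset_eq_filter]
  have hsplit : ∑ u, #{v | ¬ c u = c v} + ∑ u, #{v | G.Adj u v ∧ c u = c v} =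
      ∑ v, #{a | c a ≠ c v ∧ ¬ G.Adj v a} + ∑ u, #{v | G.Adj u v} := by
    rw [← sum_add_distrib, ← sum_add_distrib]
    refine sum_congr rfl fun u _ ↦ ?_
    simp only [card_filter, ← sum_add_distrib]
    refine sum_congr rfl fun v _ ↦ ?_
    by_cases h1 : G.Adj u v <;> by_cases h2 : c u = c v <;> grind
  have hK : ∑ u, #{v | ¬ c u = c v} + ∑ i, #{v | c v = i} ^ 2 = Fintype.card V ^ 2 := by
    have h1 : ∑ i, #{v | c v = i} ^ 2 = ∑ u, #{v | c u = c v} := by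
      rw [← sum_fiberwise_of_maps_to (s := univ) (t := univ) (g := c) (fun _ _ ↦ mem_univ _)]
      refine sum_congr rfl fun i _ ↦ ?_
      rw [sq]
      refine (sum_const_nat fun u hu ↦ ?_).symm
      rw [(mem_filter.1 hu).2]
      simp_rw [eq_comm]
    rw [h1, ← sum_add_distrib, sq, ← card_univ]
    refine sum_const_nat fun u _ ↦ ?_
    rw [add_comm, card_filter_add_card_filter_not]
  have hn : ∑ i, (#{v | c v = i} : ℝ) = Fintype.card V := by
    rw [← card_univ, card_eq_sum_card_fiberwise (f := c) (t := univ)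
      (fun _ _ ↦ mem_coe.2 (mem_univ _))]
    push_cast; rfl
  have hvar : ∑ i, ((#{v | c v = i} : ℝ) - Fintype.card V / r) ^ 2 =
      ∑ i, (#{v | c v = i} : ℝ) ^ 2 - (Fintype.card V : ℝ) ^ 2 / r := by
    rw [← hn]
    exact sum_sub_div_card_sq hr _
  have hvar0 : 0 ≤ ∑ i, ((#{v | c v = i} : ℝ) - Fintype.card V / r) ^ 2 :=
    sum_nonneg fun _ _ ↦ sq_nonneg _
  have hleR : (2 * #G.edgeFinset : ℝ) + ∑ u, (#{v | G.Adj u v ∧ c u = c v} : ℝ) ≤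
      ∑ u, (#{v | ¬ c u = c v} : ℝ) := by
    rw [hdeg] at hle
    exact_mod_cast hle
  have hsplitR : ∑ u, (#{v | ¬ c u = c v} : ℝ) + ∑ u, (#{v | G.Adj u v ∧ c u = c v} : ℝ) =
      ∑ v, (#{a | c a ≠ c v ∧ ¬ G.Adj v a} : ℝ) + 2 * #G.edgeFinset := by
    rw [hdeg] at hsplit
    exact_mod_cast hsplit
  have hKR : ∑ u, (#{v | ¬ c u = c v} : ℝ) + ∑ i, (#{v | c v = i} : ℝ) ^ 2 =
      (Fintype.card V : ℝ) ^ 2 := by exact_mod_cast hK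
  have hI : 0 ≤ ∑ u, (#{v | G.Adj u v ∧ c u = c v} : ℝ) :=
    sum_nonneg fun _ _ ↦ Nat.cast_nonneg _
  rw [sub_mul, one_mul, one_div_mul_eq_div] at hL
  refine ⟨c, by linarith, fun i ↦ ?_⟩
  refine (single_le_sum (f := fun i ↦ ((#{v | c v = i} : ℝ) - Fintype.card V / r) ^ 2)
    (fun _ _ ↦ sq_nonneg _) (mem_univ i)).trans ?_
  linarith

open Finset in
theorem MaximalCliqueFree.exists_isNClique_insert {V : Type*} [DecidableEq V] {G : SimpleGraph V}
    {r : ℕ} (hG : MaximalCliqueFree r G) {x y : V} (hne : x ≠ y) (hxy : ¬ G.Adj x y) :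
    ∃ K : Finset V, x ∉ K ∧ y ∉ K ∧ G.IsNClique r (insert x K) ∧ G.IsNClique r (insert y K) := by
  obtain ⟨t, hc⟩ := not_forall_not.1 (hG.2 x y hne hxy)
  change (G ⊔ edge x y).IsNClique _ _ at hc
  use (t.erase x).erase y, erase_right_comm (a := x) ▸ (notMem_erase _ _), notMem_erase _ _
  have h1 := hG.1.mem_of_sup_edge_isNClique hc
  have h2 := hG.1.mem_of_sup_edge_isNClique (edge_comm .. ▸ hc)
  rw [insert_erase <| mem_erase_of_ne_of_mem hne.symm h2, erase_right_comm,
      insert_erase <| mem_erase_of_ne_of_mem hne h1]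
  exact ⟨(edge_comm .. ▸ hc).erase_of_sup_edge_of_mem h2, hc.erase_of_sup_edge_of_mem h1⟩

open Finset in
theorem MaximalCliqueFree.exists_isInducedCompleteMultipartiteOn {V : Type*} [Fintype V]
    [DecidableEq V] {G : SimpleGraph V} [DecidableRel G.Adj] {r : ℕ} (hr : 0 < r)
    (hG : MaximalCliqueFree r G) (c : V → Fin r) (C : Finset V) (d h D : ℕ) (hhd : h ≤ d)
    (hC : C = ({v | d < #{a | c a ≠ c v ∧ ¬ G.Adj v a}} : Finset V)) (hD : #C + h ≤ D)
    (hc : ∀ i, r * d + #C < #{a | c a = i}) :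
    ∃ S : Finset V, IsInducedCompleteMultipartiteOn r G S ∧
      Fintype.card V ≤ #S + #{v | h < #{a | c a ≠ c v ∧ ¬ G.Adj v a}} + r * (D + 1) ^ r := by
  have hne {u v : V} : u ∉ C → v ∉ C → G.Adj u v → c u ≠ c v := by
    refine ne_color_of_adj hG.1 c C d (fun v hv ↦ ?_) fun i ↦ ?_
    · simpa [hC] using hv
    · have h1 : ({a | c a = i} : Finset V) ⊆ ({a | c a = i ∧ a ∉ C} : Finset V) ∪ C := by
        intro a ha
        by_cases haC : a ∈ C
        · exact mem_union_right _ haC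
        · exact mem_union_left _ (mem_filter.2 ⟨mem_univ _, (mem_filter.1 ha).2, haC⟩)
      have h2 := (card_le_card h1).trans (card_union_le _ _)
      have h3 := hc i
      lia
  set H : Finset V := {v | #{a | c a ≠ c v ∧ ¬ G.Adj v a} ≤ h} with hH
  have hHC {v : V} (hv : v ∈ H) : v ∉ C := by
    simp only [hH, hC, mem_filter, mem_univ, true_and] at hv ⊢
    lia
  set X : Finset V := {x ∈ H | ∃ y ∈ H, c x ≠ c y ∧ ¬ G.Adj x y} with hX
  have hex (x : V) : ∃ (y : V) (K : Finset V), x ∈ X → y ∈ H ∧ c x ≠ c y ∧ x ∉ K ∧ y ∉ K ∧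
      G.IsNClique r (insert x K) ∧ G.IsNClique r (insert y K) := by
    by_cases hx : x ∈ X
    · obtain ⟨y, hyH, hcy, hxy⟩ := (mem_filter.1 hx).2
      obtain ⟨K, hK⟩ := hG.exists_isNClique_insert (fun h ↦ hcy (congrArg c h)) hxy
      exact ⟨y, K, fun _ ↦ ⟨hyH, hcy, hK⟩⟩
    · exact ⟨x, ∅, fun h ↦ absurd h hx⟩
  choose y K hyK using hex
  have hyadj (x : V) (hx : x ∈ X) (a : V) (ha : a ∈ K x) : G.Adj (y x) a := by
    obtain ⟨-, -, -, hyn, -, hcl⟩ := hyK x hx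
    exact hcl.isClique (by simp) (by simp [ha]) fun h ↦ hyn (h ▸ ha)
  have hfib (i : Fin r) : #{x ∈ X | c (y x) = i} ≤ (D + 1) ^ r := by
    have hXi {x : V} (hx : x ∈ ({x ∈ X | c (y x) = i} : Finset V)) : x ∈ X := (mem_filter.1 hx).1
    have := card_add_one_le_pow_of_isNClique_insert hG.1 y K
      (fun v ↦ C ∪ ({a | c a ≠ c v ∧ ¬ G.Adj v a} : Finset V)) D (r - 1)
      {x ∈ X | c (y x) = i} ∅ (fun _ _ ↦ empty_subset _) (fun x hx ↦ ?_)
      (fun x hx ↦ (hyK x (hXi hx)).2.2.2.2.1) (fun x hx ↦ hyadj x (hXi hx)) (fun x hx ↦ ?_)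
      (fun x hx x' hx' a ha hna ↦ ?_)
    · rw [Nat.sub_add_cancel hr] at this
      lia
    · obtain ⟨-, -, hxn, -, hcl, -⟩ := hyK x (hXi hx)
      have := hcl.card_eq
      rw [card_insert_of_notMem hxn] at this
      rw [card_empty]
      lia
    · have h1 := (hyK x (hXi hx)).1
      simp only [hH, mem_filter, mem_univ, true_and] at h1
      exact (card_union_le _ _).trans (by lia)
    · by_cases haC : a ∈ C
      · exact mem_union_left _ haC
      refine mem_union_right _ (mem_filter.2 ⟨mem_univ _, ?_, hna⟩)
      rw [(mem_filter.1 hx').2, ← (mem_filter.1 hx).2]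
      rcases mem_insert.1 ha with rfl | ha
      · exact (hyK a (hXi hx)).2.1
      · exact (hne (hHC (hyK x (hXi hx)).1) haC (hyadj x (hXi hx) a ha)).symm
  have hXcard : #X ≤ r * (D + 1) ^ r := by
    rw [card_eq_sum_card_fiberwise (f := fun x ↦ c (y x)) (t := univ)
      (fun _ _ ↦ mem_coe.2 (mem_univ _))]
    simpa using sum_le_card_nsmul univ _ _ fun i _ ↦ hfib i
  refine ⟨H \ X, ⟨c, fun u hu v hv ↦ ⟨fun huv ↦ ?_, fun huv ↦ ?_⟩⟩, ?_⟩
  · rw [mem_coe, mem_sdiff] at hu hv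
    exact hne (hHC hu.1) (hHC hv.1) huv
  · rw [mem_coe, mem_sdiff] at hu hv
    by_contra hna
    exact hu.2 (mem_filter.2 ⟨hu.1, v, hv.1, huv, hna⟩)
  · have h1 : #H + #{v | h < #{a | c a ≠ c v ∧ ¬ G.Adj v a}} = Fintype.card V := by
      simp_rw [hH, ← not_le]
      rw [card_filter_add_card_filter_not, card_univ]
    have h2 := le_card_sdiff X H
    lia

theorem le_two_mul_card_edgeFinset_turanGraph (n : ℕ) {r : ℕ} (hr : 2 ≤ r) :
    (1 - 1 / (r : ℝ)) * (n : ℝ) ^ 2 - (r : ℝ) ^ 2 ≤ 2 * ((turanGraph n r).edgeFinset.card : ℝ) := by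
  have hs : n % r + 1 ≤ r := Nat.mod_lt _ (by lia)
  have hsn : (n % r) ^ 2 ≤ n ^ 2 := Nat.pow_le_pow_left (Nat.mod_le n r) 2
  have hlt := Nat.lt_div_mul_add (a := (n ^ 2 - (n % r) ^ 2) * (r - 1)) (b := 2 * r) (by lia)
  have hle : (n ^ 2 - (n % r) ^ 2) * (r - 1) / (2 * r) ≤ (turanGraph n r).edgeFinset.card := by
    rw [card_edgeFinset_turanGraph]
    exact Nat.le_add_right _ _
  generalize (n ^ 2 - (n % r) ^ 2) * (r - 1) / (2 * r) = q at hlt hle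
  generalize (turanGraph n r).edgeFinset.card = t at hle ⊢
  generalize n % r = s at hs hsn hlt
  have hlt' : (((n : ℝ) ^ 2 - (s : ℝ) ^ 2) * ((r : ℝ) - 1)) < q * (2 * r) + 2 * r := by
    have := (Nat.cast_lt (α := ℝ)).2 hlt
    rw [Nat.cast_mul, Nat.cast_sub hsn, Nat.cast_sub (by lia : 1 ≤ r)] at this
    push_cast at this
    exact this
  have hs' : (s : ℝ) + 1 ≤ r := by exact_mod_cast hs
  have hle' : (q : ℝ) ≤ t := by exact_mod_cast hle
  have hr' : (2 : ℝ) ≤ r := by exact_mod_cast hr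
  have hs0 : (0 : ℝ) ≤ s := by positivity
  have hs2 : (s : ℝ) ^ 2 * (r - 1) ≤ ((r : ℝ) - 1) ^ 2 * (r - 1) := by
    gcongr
    · linarith
    · linarith
  have hqt : (q : ℝ) * (2 * r) ≤ t * (2 * r) := by gcongr
  have key : ((r : ℝ) - 1) * n ^ 2 - r ^ 3 ≤ 2 * t * r := by nlinarith
  rw [← sub_nonneg] at key ⊢
  have : 2 * (t : ℝ) - ((1 - 1 / (r : ℝ)) * n ^ 2 - r ^ 2) =
      (2 * t * r - (((r : ℝ) - 1) * n ^ 2 - r ^ 3)) / r := by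
    field_simp
  rw [this]
  positivity

open Finset in
theorem card_filter_floor_lt_mul_le {V : Type*} [Fintype V] (f : V → ℕ) (x : ℝ) :
    (#{v | ⌊x⌋₊ < f v} : ℝ) * x ≤ ∑ v, (f v : ℝ) := by
  rw [← nsmul_eq_mul]
  refine (card_nsmul_le_sum _ (fun v ↦ (f v : ℝ)) x fun v hv ↦ ?_).trans
    (sum_le_sum_of_subset_of_nonneg (subset_univ _) fun _ _ _ ↦ Nat.cast_nonneg _)
  exact (Nat.lt_of_floor_lt (mem_filter.1 hv).2).le

open Finset in
theorem MaximalCliqueFree.exists_large_isInducedCompleteMultipartiteOn {V : Type*} [Fintype V]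
    [DecidableEq V] {G : SimpleGraph V} [DecidableRel G.Adj] {r : ℕ} (hr : 2 ≤ r)
    (hG : MaximalCliqueFree r G) {ε η δ m : ℝ} (hη : 0 < η) (hη₁ : η ≤ 1 / (8 * (r : ℝ) ^ 2))
    (hη₂ : η ≤ ε / (6 * r)) (hδ : 0 < δ) (hδ₁ : δ ≤ η / (48 * (r : ℝ) ^ 2)) (hδ₂ : δ ≤ η * ε / 12)
    (hm : m ^ r = Fintype.card V) (hmη : 1 ≤ η * m) (hrn : (r : ℝ) ^ 2 ≤ δ * Fintype.card V)
    (hm1 : 1 ≤ m)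
    (he : (1 - 1 / (r : ℝ)) * (Fintype.card V : ℝ) ^ 2 - (r : ℝ) ^ 2 -
      2 * (δ * (Fintype.card V * m)) ≤ 2 * (#G.edgeFinset : ℝ)) :
    ∃ S : Finset V, IsInducedCompleteMultipartiteOn r G S ∧
      (1 - ε) * (Fintype.card V : ℝ) ≤ #S := by
  set n : ℝ := (Fintype.card V : ℝ) with hn
  have hr' : (2 : ℝ) ≤ r := by exact_mod_cast hr
  have hmn : m ≤ n := hm ▸ le_self_pow₀ hm1 (by lia)
  have hn0 : 0 < n := by linarith
  have hL : r ^ 2 + 2 * (δ * (n * m)) ≤ 3 * δ * (n * m) := by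
    have : δ * n ≤ δ * n * m := le_mul_of_one_le_right (by positivity) hm1
    linarith
  obtain ⟨c, hmiss, hpart⟩ := exists_coloring_missing G (by lia) hG.1
    (L := 3 * δ * (n * m)) (by linarith)
  have hd := card_filter_floor_lt_mul_le
    (fun v ↦ #{a | c a ≠ c v ∧ ¬ G.Adj v a}) (n / (8 * r ^ 2))
  have hh := card_filter_floor_lt_mul_le
    (fun v ↦ #{a | c a ≠ c v ∧ ¬ G.Adj v a}) (η * m)
  set C : Finset V :=
    {v | ⌊n / (8 * r ^ 2)⌋₊ < #{a | c a ≠ c v ∧ ¬ G.Adj v a}} with hC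
  have hCcard : (#C : ℝ) ≤ η * m := by
    have h1 : (#C : ℝ) * (n / (8 * r ^ 2)) ≤ (48 * r ^ 2 * δ * m) * (n / (8 * r ^ 2)) := by
      refine (hd.trans hmiss).trans (le_of_eq ?_)
      field_simp
      ring
    have h2 := le_of_mul_le_mul_right h1 (by positivity)
    rw [le_div_iff₀ (by positivity)] at hδ₁
    exact h2.trans (mul_le_mul_of_nonneg_right (by linarith) (by linarith))
  have hlow : (#{v | ⌊η * m⌋₊ < #{a | c a ≠ c v ∧ ¬ G.Adj v a}} : ℝ) ≤ ε / 2 * n := by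
    have h1 := hh.trans hmiss
    refine le_of_mul_le_mul_right (h1.trans ?_) (by positivity : 0 < η * m)
    calc 2 * (3 * δ * (n * m)) = 6 * (n * m) * δ := by ring
      _ ≤ 6 * (n * m) * (η * ε / 12) := by gcongr
      _ = _ := by ring
  have hηm : η * m ≤ n / (8 * r ^ 2) := by
    calc η * m ≤ 1 / (8 * (r : ℝ) ^ 2) * n := by gcongr
      _ = _ := by ring
  have hsmall : n / (8 * r ^ 2) ≤ n / (16 * r) :=
    div_le_div_of_nonneg_left hn0.le (by positivity) (by nlinarith)
  have hCD : #C + ⌊η * m⌋₊ ≤ ⌊2 * (η * m)⌋₊ := by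
    refine Nat.le_floor ?_
    have := Nat.floor_le (by positivity : 0 ≤ η * m)
    push_cast
    linarith
  have hparts (i : Fin r) : r * ⌊n / (8 * r ^ 2)⌋₊ + #C < #{a | c a = i} := by
    have h1 : ((#{v | c v = i} : ℝ) - n / r) ^ 2 ≤ (n / (2 * r)) ^ 2 := by
      refine (hpart i).trans ?_
      have h3 : 3 * δ ≤ 1 / (4 * r ^ 2) := by
        rw [le_div_iff₀ (by positivity)] at hδ₁ hη₁ ⊢
        nlinarith
      calc 3 * δ * (n * m) ≤ 1 / (4 * r ^ 2) * (n * n) := by gcongr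
        _ = _ := by field_simp; ring
    have h2 := (abs_le_of_sq_le_sq' h1 (by positivity)).1
    have h3 := Nat.floor_le (by positivity : 0 ≤ n / (8 * (r : ℝ) ^ 2))
    have h4 : (r : ℝ) * ⌊n / (8 * (r : ℝ) ^ 2)⌋₊ ≤ n / (8 * r) := by
      calc (r : ℝ) * ⌊n / (8 * (r : ℝ) ^ 2)⌋₊ ≤ r * (n / (8 * (r : ℝ) ^ 2)) := by gcongr
        _ = _ := by field_simp
    have h5 : n / r = 16 * (n / (16 * r)) := by field_simp
    have h6 : n / (2 * r) = 8 * (n / (16 * r)) := by field_simp; ring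
    have h7 : n / (8 * r) = 2 * (n / (16 * r)) := by field_simp; ring
    have h8 : 0 < n / (16 * r) := by positivity
    rify
    linarith
  obtain ⟨S, hS, hcard⟩ := hG.exists_isInducedCompleteMultipartiteOn (by lia) c C
    ⌊n / (8 * r ^ 2)⌋₊ ⌊η * m⌋₊ ⌊2 * (η * m)⌋₊ (Nat.floor_le_floor hηm) hC hCD hparts
  refine ⟨S, hS, ?_⟩
  have hcard' : n ≤ #S + #{v | ⌊η * m⌋₊ < #{a | c a ≠ c v ∧ ¬ G.Adj v a}} +
      r * ((⌊2 * (η * m)⌋₊ : ℝ) + 1) ^ r := by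
    rw [hn]
    exact_mod_cast hcard
  have hD : (⌊2 * (η * m)⌋₊ : ℝ) + 1 ≤ 3 * η * m := by
    have := Nat.floor_le (by positivity : 0 ≤ 2 * (η * m))
    linarith
  have h3η : 3 * η ≤ 1 := by
    have : 1 / (8 * (r : ℝ) ^ 2) ≤ 1 / 3 := by
      gcongr
      nlinarith
    linarith
  have hpow : r * ((⌊2 * (η * m)⌋₊ : ℝ) + 1) ^ r ≤ ε / 2 * n := by
    calc r * ((⌊2 * (η * m)⌋₊ : ℝ) + 1) ^ r ≤ r * (3 * η * m) ^ r := by gcongr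
      _ = r * ((3 * η) ^ r * n) := by rw [mul_pow, hm]
      _ ≤ r * ((3 * η) * n) := by
        gcongr
        exact pow_le_of_le_one (by positivity) h3η (by lia)
      _ = 3 * r * n * η := by ring
      _ ≤ 3 * r * n * (ε / (6 * r)) := by gcongr
      _ = _ := by field_simp; ring
  linarith

theorem stmt_14 (r : ℕ) (hr : 2 ≤ r) (ε : ℝ) (hε : 0 < ε) :
    ∃ (δ : ℝ) (N : ℕ), 0 < δ ∧ 0 < N ∧
      ∀ n : ℕ, N ≤ n → ∀ G : SimpleGraph (Fin n),
        MaximalCliqueFree r G →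
        ((turanGraph n r).edgeSet.ncard : ℝ) - δ * (n : ℝ) ^ (((r : ℝ) + 1) / r) ≤
          (G.edgeSet.ncard : ℝ) →
        ∃ S : Set (Fin n), IsInducedCompleteMultipartiteOn r G S ∧
          (1 - ε) * (n : ℝ) ≤ (S.ncard : ℝ) := by
  have hr0 : (0 : ℝ) < r := by positivity
  set η : ℝ := min (1 / (8 * (r : ℝ) ^ 2)) (ε / (6 * r)) with hη
  have hη0 : 0 < η := lt_min (by positivity) (by positivity)
  set δ : ℝ := min (η / (48 * (r : ℝ) ^ 2)) (η * ε / 12) with hδ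
  have hδ0 : 0 < δ := lt_min (by positivity) (by positivity)
  refine ⟨δ, ⌈(1 / η) ^ r⌉₊ + ⌈(r : ℝ) ^ 2 / δ⌉₊ + 1, hδ0, Nat.succ_pos _, fun n hn G hG he ↦ ?_⟩
  classical
  have hn₁ : (1 / η) ^ r ≤ n := (Nat.le_ceil _).trans (by exact_mod_cast (by lia))
  have hn₂ : (r : ℝ) ^ 2 / δ ≤ n := (Nat.le_ceil _).trans (by exact_mod_cast (by lia))
  have hn0 : 0 < n := by lia
  have hm : ((n : ℝ) ^ (1 / (r : ℝ))) ^ r = n := by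
    rw [one_div, Real.rpow_inv_natCast_pow (by positivity) (by lia)]
  have hm0 : 0 ≤ (n : ℝ) ^ (1 / (r : ℝ)) := by positivity
  have hexp : (n : ℝ) ^ (((r : ℝ) + 1) / r) = n * (n : ℝ) ^ (1 / (r : ℝ)) := by
    rw [add_div, div_self hr0.ne', Real.rpow_add (by positivity), Real.rpow_one]
  have hmη : 1 / η ≤ (n : ℝ) ^ (1 / (r : ℝ)) := by
    rw [← hm] at hn₁
    exact le_of_pow_le_pow_left₀ (by lia) hm0 hn₁
  rw [hexp, ← coe_edgeFinset, ← coe_edgeFinset, Set.ncard_coe_finset, Set.ncard_coe_finset] at he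
  obtain ⟨S, hS, hcard⟩ := hG.exists_large_isInducedCompleteMultipartiteOn hr (ε := ε)
    (m := (n : ℝ) ^ (1 / (r : ℝ))) hη0
    (min_le_left _ _) (min_le_right _ _) hδ0 (min_le_left _ _) (min_le_right _ _)
    (by rw [hm, Fintype.card_fin]) (by rwa [div_le_iff₀' hη0] at hmη)
    (by rwa [Fintype.card_fin, ← div_le_iff₀' hδ0])
    (Real.one_le_rpow (by exact_mod_cast hn0) (by positivity))
    (by rw [Fintype.card_fin]; linarith [le_two_mul_card_edgeFinset_turanGraph n hr])
  exact ⟨S, hS, by simpa using hcard⟩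
end
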